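/- arXiv:0909.0717 — 2 statements merged into one kernel-verified Lean document; each statement's English description precedes it below -/
import Mathlib

section
/- There is an absolute constant C > 0 with the following property. Let P be a finite set of n points in ℝ², let k be an integer with 1 ≤ k ≤ n, and suppose P \ D_k(P) is nonempty. Then there exists a spanning tree T on the vertex set P \ D_k(P) (a connected acyclic graph whose vertices are the points of P \ D_k(P), with edges realized as straight segments between their endpoints) such that every line ℓ in ℝ² crosses at most C·√k·log(2n/k) edges of T, where ℓ crosses an edge {u,v} if u and v lie in the two different open halfplanes bounded by ℓ. -/
/-- A closed halfplane in `ℝ²`: the set `{x | 0 ≤ a·x₁ + b·x₂ + c}` for a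
nonconstant affine function. -/
def IsClosedHalfplane (H : Set (ℝ × ℝ)) : Prop :=
  ∃ a b c : ℝ, (a, b) ≠ (0, 0) ∧ H = {x : ℝ × ℝ | 0 ≤ a * x.1 + b * x.2 + c}

/-- `Dk P k` is the intersection of all closed halfplanes containing at least
`|P| − k` points of `P`. -/
noncomputable def Dk (P : Finset (ℝ × ℝ)) (k : ℕ) : Set (ℝ × ℝ) :=
  ⋂₀ {H : Set (ℝ × ℝ) | IsClosedHalfplane H ∧
      (P.card : ℤ) - (k : ℤ) ≤ (((↑P : Set (ℝ × ℝ)) ∩ H).ncard : ℤ)}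

/-- Signed vertical distance from the nonvertical line `y = ℓ.1 * x + ℓ.2` to the point `p`. -/
def gap (ℓ p : ℝ × ℝ) : ℝ := p.2 - (ℓ.1 * p.1 + ℓ.2)

/-- Abscissa of the intersection of two nonparallel, nonvertical lines. -/
noncomputable def meetX (ℓ ℓ' : ℝ × ℝ) : ℝ := (ℓ'.2 - ℓ.2) / (ℓ.1 - ℓ'.1)

/-- The point of the line `ℓ` with abscissa `x`. -/
def pointAt (ℓ : ℝ × ℝ) (x : ℝ) : ℝ × ℝ := (x, ℓ.1 * x + ℓ.2)

/-- Intersection point of two nonparallel, nonvertical lines. -/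
noncomputable def meet (ℓ ℓ' : ℝ × ℝ) : ℝ × ℝ := pointAt ℓ (meetX ℓ ℓ')

lemma gap_pointAt (ℓ t : ℝ × ℝ) (x : ℝ) :
    gap t (pointAt ℓ x) = (ℓ.1 - t.1) * x + (ℓ.2 - t.2) := by
  simp only [gap, pointAt]; ring

lemma gap_pointAt_of_ne {ℓ t : ℝ × ℝ} (h : t.1 ≠ ℓ.1) (x : ℝ) :
    gap t (pointAt ℓ x) = (ℓ.1 - t.1) * (x - meetX ℓ t) := by
  have : ℓ.1 - t.1 ≠ 0 := sub_ne_zero.2 h.symm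
  rw [gap_pointAt, meetX]; field_simp; ring

lemma gap_meet {ℓ t : ℝ × ℝ} (h : t.1 ≠ ℓ.1) : gap t (meet ℓ t) = 0 := by
  rw [meet, gap_pointAt_of_ne h]; simp

lemma eq_of_abs_le_of_sq_le {u w : ℝ} (hu : u ≠ 0) (h : u * u ≤ u * w) (h' : |w| ≤ |u|) :
    w = u := by
  rcases lt_or_gt_of_ne hu with h0 | h0
  · rw [abs_of_neg h0] at h'
    have : w ≤ u := by nlinarith
    have := neg_abs_le w
    linarith
  · rw [abs_of_pos h0] at h'
    have : u ≤ w := by nlinarith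
    have := le_abs_self w
    linarith

lemma Finset.exists_initial_subset {α : Type*} [DecidableEq α] (s : Finset α) (φ : α → ℝ) (n : ℕ)
    (hn : n ≤ s.card) :
    ∃ t ⊆ s, t.card = n ∧ ∀ a ∈ t, ∀ b ∈ s, b ∉ t → φ a ≤ φ b := by
  induction n with
  | zero => exact ⟨∅, by simp, by simp, by simp⟩
  | succ n ih =>
    obtain ⟨t, hts, htc, ht⟩ := ih (by omega)
    have hne : (s \ t).Nonempty := by
      rw [← Finset.card_pos, Finset.card_sdiff_of_subset hts]; omega
    obtain ⟨a, ha, hmin⟩ := Finset.exists_min_image (s \ t) φ hne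
    rw [Finset.mem_sdiff] at ha
    refine ⟨insert a t, ?_, ?_, ?_⟩
    · exact Finset.insert_subset ha.1 hts
    · rw [Finset.card_insert_of_notMem ha.2, htc]
    · intro x hx y hy hyt
      rw [Finset.mem_insert, not_or] at hyt
      rcases Finset.mem_insert.1 hx with rfl | hx
      · exact hmin y (Finset.mem_sdiff.2 ⟨hy, hyt.2⟩)
      · exact ht x hx y hy hyt.2

/-- No two lines of the family `ℓ` meet a line of the family at the same point. -/
def NoTripleMeet {I : Type*} (ℓ : I → ℝ × ℝ) : Prop :=
  ∀ i j t, (ℓ j).1 ≠ (ℓ i).1 → (ℓ t).1 ≠ (ℓ i).1 → meetX (ℓ i) (ℓ j) = meetX (ℓ i) (ℓ t) → j = t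

/-- The number of lines of the family that do not have `p` and `q` strictly on the same side. -/
noncomputable def lineDist {I : Type*} [Fintype I] (ℓ : I → ℝ × ℝ) (p q : ℝ × ℝ) : ℕ :=
  (Finset.univ.filter fun t => gap (ℓ t) p * gap (ℓ t) q ≤ 0).card

open Classical in
/-- Every point is close, in the line-crossing distance, to quadratically many vertices. -/
lemma sq_le_card_near_vertices {I : Type*} [Fintype I] (ℓ : I → ℝ × ℝ) (q : ℝ × ℝ)
    (hq : ∀ i, gap (ℓ i) q ≠ 0) (hinj : ∀ i j, gap (ℓ i) q = gap (ℓ j) q → i = j)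
    (hgen : NoTripleMeet ℓ) (ρ : ℕ) (hρ : ρ ≤ Fintype.card I)
    (hρ' : ∀ i, ρ ≤ (Finset.univ.filter fun j => (ℓ j).1 ≠ (ℓ i).1).card) :
    ρ * ρ ≤ (Finset.univ.filter fun x : I × I => (ℓ x.2).1 ≠ (ℓ x.1).1 ∧
      lineDist ℓ q (meet (ℓ x.1) (ℓ x.2)) ≤ 2 * ρ).card := by
  obtain ⟨S, -, hSc, hS⟩ := Finset.exists_initial_subset Finset.univ
    (fun i => |gap (ℓ i) q|) ρ (by simpa using hρ)
  choose S' hS's hS'c hS' using fun i => Finset.exists_initial_subset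
    (Finset.univ.filter fun j => (ℓ j).1 ≠ (ℓ i).1) (fun j => |meetX (ℓ i) (ℓ j) - q.1|) ρ (hρ' i)
  have hcard : (S.sigma S').card = ρ * ρ := by
    rw [Finset.card_sigma]; simp [hS'c, hSc]
  rw [← hcard]
  refine Finset.card_le_card_of_injOn (fun x => (x.1, x.2)) ?_ ?_
  swap
  · rintro ⟨a, b⟩ - ⟨c, d⟩ - h
    simp only [Prod.mk.injEq] at h
    obtain ⟨rfl, rfl⟩ := h
    rfl
  rintro ⟨i, j⟩ hij
  simp only [Finset.coe_sigma, Set.mem_sigma_iff, Finset.mem_coe] at hij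
  obtain ⟨hi, hj⟩ := hij
  have hji := hS's i hj
  simp only [Finset.mem_filter, Finset.mem_univ, true_and] at hji
  simp only [Finset.coe_filter, Finset.mem_univ, true_and, Set.mem_ofPred_eq]
  refine ⟨hji, ?_⟩
  have hsub : (Finset.univ.filter fun t => gap (ℓ t) q * gap (ℓ t) (meet (ℓ i) (ℓ j)) ≤ 0)
      ⊆ S ∪ S' i := by
    intro t ht
    simp only [Finset.mem_filter, Finset.mem_univ, true_and] at ht
    by_contra hcon
    rw [Finset.mem_union, not_or] at hcon
    obtain ⟨htS, htS'⟩ := hcon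
    have hy : gap (ℓ t) (pointAt (ℓ i) q.1) = gap (ℓ t) q - gap (ℓ i) q := by
      simp only [gap, pointAt]; ring
    have h1 : 0 < gap (ℓ t) q * gap (ℓ t) (pointAt (ℓ i) q.1) := by
      by_contra hle
      rw [hy] at hle
      have := eq_of_abs_le_of_sq_le (hq t) (w := gap (ℓ i) q) (by nlinarith)
        (hS i hi t (Finset.mem_univ _) htS)
      exact htS (hinj i t this ▸ hi)
    have h2 : gap (ℓ t) (pointAt (ℓ i) q.1) * gap (ℓ t) (meet (ℓ i) (ℓ j)) ≤ 0 := by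
      by_contra hlt
      push Not at hlt
      have h3 := mul_pos h1 hlt
      have h4 : 0 ≤ gap (ℓ t) (pointAt (ℓ i) q.1) ^ 2 := sq_nonneg _
      nlinarith [mul_nonneg h4 (neg_nonneg.2 ht)]
    have hne : gap (ℓ t) (pointAt (ℓ i) q.1) ≠ 0 := by
      rintro h; rw [h, mul_zero] at h1; exact lt_irrefl _ h1
    by_cases hpar : (ℓ t).1 = (ℓ i).1
    · have : gap (ℓ t) (meet (ℓ i) (ℓ j)) = gap (ℓ t) (pointAt (ℓ i) q.1) := by
        simp only [meet, gap_pointAt, hpar]; ring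
      rw [this] at h2
      have := mul_self_pos.2 hne
      linarith
    · rw [meet, gap_pointAt_of_ne hpar] at h2
      rw [gap_pointAt_of_ne hpar] at h2 hne
      have hpos : 0 < ((ℓ i).1 - (ℓ t).1) * ((ℓ i).1 - (ℓ t).1) :=
        mul_self_pos.2 (left_ne_zero_of_mul hne)
      have h3 : (q.1 - meetX (ℓ i) (ℓ t)) * (meetX (ℓ i) (ℓ j) - meetX (ℓ i) (ℓ t)) ≤ 0 := by
        by_contra hlt
        push Not at hlt
        nlinarith [mul_pos hpos hlt]
      have hne' := right_ne_zero_of_mul hne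
      have := eq_of_abs_le_of_sq_le (u := meetX (ℓ i) (ℓ t) - q.1)
        (w := meetX (ℓ i) (ℓ j) - q.1) (by rwa [← neg_sub, neg_ne_zero] at hne') (by nlinarith)
        (hS' i j hj t (by simpa using hpar) htS')
      have := hgen i j t hji hpar (by linarith)
      exact htS' (this ▸ hj)
  calc lineDist ℓ q (meet (ℓ i) (ℓ j)) ≤ (S ∪ S' i).card := Finset.card_le_card hsub
    _ ≤ S.card + (S' i).card := Finset.card_union_le _ _
    _ = 2 * ρ := by rw [hSc, hS'c]; ring

/-- The number of halfplanes above lines of the family containing `p`. -/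
noncomputable def lineDepth {κ : Type*} [Fintype κ] (ℓ : κ → ℝ × ℝ) (p : ℝ × ℝ) : ℕ :=
  (Finset.univ.filter fun a => 0 ≤ gap (ℓ a) p).card

open Classical in
lemma card_shallow_vertices_on_line_le {I κ : Type*} [Fintype I] [Fintype κ] (ℓ : I → ℝ × ℝ)
    (c o : κ → I) (i : I) (R : ℕ) (G : Finset I)
    (hR : ∀ j ∈ G, lineDepth (ℓ ∘ c) (meet (ℓ i) (ℓ j)) ≤ R)
    (hG : ∀ j ∈ G, ∃ a, (o a = j ∨ c a = j) ∧ 0 ≤ gap (ℓ (c a)) (meet (ℓ i) (ℓ j))) :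
    G.card ≤ 4 * R := by
  rcases G.eq_empty_or_nonempty with rfl | ⟨j₀, hj₀⟩
  · simp
  have : Nonempty κ := ⟨(hG j₀ hj₀).choose⟩
  choose! a ha hgap using hG
  have key : ∀ G' ⊆ G, (∀ j ∈ G', ∃ j' ∈ G', ∀ t ∈ G', 0 ≤ gap (ℓ (c (a t))) (meet (ℓ i) (ℓ j'))) →
      (G'.image a).card ≤ R := by
    intro G' hG' h
    rcases G'.eq_empty_or_nonempty with rfl | ⟨j, hj⟩
    · simp
    obtain ⟨j', hj', h⟩ := h j hj
    refine le_trans (Finset.card_le_card ?_) (hR j' (hG' hj'))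
    intro x hx
    obtain ⟨t, ht, rfl⟩ := Finset.mem_image.1 hx
    simpa using h t ht
  have h1 : ((G.filter fun j => (ℓ (c (a j))).1 ≤ (ℓ i).1).image a).card ≤ R := by
    refine key _ (Finset.filter_subset _ _) fun j hj => ?_
    obtain ⟨j', hj', hmax⟩ := Finset.exists_max_image _ (fun j => meetX (ℓ i) (ℓ j)) ⟨j, hj⟩
    refine ⟨j', hj', fun t ht => ?_⟩
    have h1 := hgap t (Finset.mem_filter.1 ht).1
    have h2 := (Finset.mem_filter.1 ht).2
    have h3 := hmax t ht
    rw [meet, gap_pointAt] at h1 ⊢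
    nlinarith
  have h2 : ((G.filter fun j => ¬ (ℓ (c (a j))).1 ≤ (ℓ i).1).image a).card ≤ R := by
    refine key _ (Finset.filter_subset _ _) fun j hj => ?_
    obtain ⟨j', hj', hmin⟩ := Finset.exists_min_image _ (fun j => meetX (ℓ i) (ℓ j)) ⟨j, hj⟩
    refine ⟨j', hj', fun t ht => ?_⟩
    have h1 := hgap t (Finset.mem_filter.1 ht).1
    have h2 := (Finset.mem_filter.1 ht).2
    have h3 := hmin t ht
    rw [meet, gap_pointAt] at h1 ⊢
    nlinarith
  have h3 : (G.image a).card ≤ 2 * R := by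
    rw [← Finset.filter_union_filter_not_eq (fun j => (ℓ (c (a j))).1 ≤ (ℓ i).1) G,
      Finset.image_union]
    exact (Finset.card_union_le _ _).trans (by omega)
  have h4 : G ⊆ (G.image a).image o ∪ (G.image a).image c := by
    intro j hj
    simp only [Finset.mem_union, Finset.mem_image, exists_exists_and_eq_and]
    rcases ha j hj with h | h
    · exact Or.inl ⟨j, hj, h⟩
    · exact Or.inr ⟨j, hj, h⟩
  calc G.card ≤ _ := Finset.card_le_card h4
    _ ≤ _ := Finset.card_union_le _ _
    _ ≤ (G.image a).card + (G.image a).card := add_le_add Finset.card_image_le Finset.card_image_le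
    _ ≤ 4 * R := by omega

open Classical in
lemma separation_le_lineDist_add {I : Type*} [Fintype I] (ℓ : I → ℝ × ℝ) (p q v : ℝ × ℝ) :
    (Finset.univ.filter fun i => gap (ℓ i) p * gap (ℓ i) q < 0).card ≤
      lineDist ℓ p v + lineDist ℓ q v := by
  refine le_trans (Finset.card_le_card ?_) (Finset.card_union_le _ _)
  intro i hi
  simp only [Finset.mem_filter, Finset.mem_univ, true_and, Finset.mem_union] at hi ⊢
  by_contra! h
  have := mul_pos h.1 h.2
  nlinarith [mul_nonneg (neg_nonneg.2 hi.le) (sq_nonneg (gap (ℓ i) v))]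

open Classical in
lemma lineDepth_le_add {I κ : Type*} [Fintype I] [Fintype κ] (ℓ : I → ℝ × ℝ) (c : κ → I)
    (hc : Function.Injective c) (q v : ℝ × ℝ) :
    lineDepth (ℓ ∘ c) v ≤ lineDepth (ℓ ∘ c) q + lineDist ℓ q v := by
  have : (Finset.univ.filter fun a => 0 ≤ gap ((ℓ ∘ c) a) v) ⊆
      (Finset.univ.filter fun a => 0 ≤ gap ((ℓ ∘ c) a) q) ∪
      (Finset.univ.filter fun a => gap (ℓ (c a)) q * gap (ℓ (c a)) v ≤ 0) := by
    intro a
    simp only [Finset.mem_filter, Finset.mem_univ, true_and, Finset.mem_union, Function.comp]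
    intro h
    by_cases h' : 0 ≤ gap (ℓ (c a)) q
    · exact Or.inl h'
    · exact Or.inr (mul_nonpos_of_nonpos_of_nonneg (le_of_not_ge h') h)
  refine (Finset.card_le_card this).trans ((Finset.card_union_le _ _).trans ?_)
  refine Nat.add_le_add_left ?_ _
  refine Finset.card_le_card_of_injOn c ?_ hc.injOn
  intro a ha
  simpa using ha

open Classical in
lemma card_le_two_mul_card_shallow {κ : Type*} [Fintype κ] (ℓ : κ → ℝ × ℝ) (Q : Finset (ℝ × ℝ))
    (K R : ℕ) (hK : ∀ a, (Q.filter fun q => 0 ≤ gap (ℓ a) q).card ≤ K)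
    (hR : 2 * Fintype.card κ * K ≤ R * Q.card) :
    Q.card ≤ 2 * (Q.filter fun q => lineDepth ℓ q ≤ R).card := by
  have hsum : ∑ q ∈ Q, lineDepth ℓ q ≤ Fintype.card κ * K := by
    have : ∑ q ∈ Q, lineDepth ℓ q = ∑ a, (Q.filter fun q => 0 ≤ gap (ℓ a) q).card := by
      simp only [lineDepth, Finset.card_filter]
      exact Finset.sum_comm
    rw [this]
    calc _ ≤ ∑ _a : κ, K := Finset.sum_le_sum fun a _ => hK a
      _ = _ := by simp
  have h1 : (Q.filter fun q => ¬ lineDepth ℓ q ≤ R).card * (R + 1) ≤ ∑ q ∈ Q, lineDepth ℓ q := by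
    rw [← smul_eq_mul]
    refine le_trans (Finset.card_nsmul_le_sum _ _ _ fun q hq => ?_)
      (Finset.sum_le_sum_of_subset (Finset.filter_subset (fun q => ¬ lineDepth ℓ q ≤ R) Q))
    have := (Finset.mem_filter.1 hq).2
    omega
  have h2 := Finset.card_filter_add_card_filter_not (s := Q) (fun q => lineDepth ℓ q ≤ R)
  set x := (Q.filter fun q => ¬ lineDepth ℓ q ≤ R).card
  by_contra hcon
  have h3 : Q.card < 2 * x := by omega
  have h4 : R * Q.card ≤ R * (2 * x) := Nat.mul_le_mul_left _ h3.le
  have h5 : 0 < x := by omega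
  nlinarith

open Classical in
/-- Balls around pairwise far shallow points contain disjoint families of shallow vertices. -/
theorem card_mul_sq_le_of_separated {I κ : Type*} [Fintype I] [Fintype κ] (ℓ : I → ℝ × ℝ)
    (c o : κ → I) (hc : Function.Injective c) (Q : Finset (ℝ × ℝ)) (ρ K R : ℕ)
    (hq : ∀ q ∈ Q, ∀ i, gap (ℓ i) q ≠ 0)
    (hinj : ∀ q ∈ Q, ∀ i j, gap (ℓ i) q = gap (ℓ j) q → i = j)
    (hgen : NoTripleMeet ℓ) (hρ : ρ ≤ Fintype.card I)
    (hρ' : ∀ i, ρ ≤ (Finset.univ.filter fun j => (ℓ j).1 ≠ (ℓ i).1).card)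
    (hsep : ∀ p ∈ Q, ∀ q ∈ Q, p ≠ q →
      4 * ρ < (Finset.univ.filter fun i => gap (ℓ i) p * gap (ℓ i) q < 0).card)
    (hown : ∀ q ∈ Q, ∀ i j, (ℓ j).1 ≠ (ℓ i).1 → lineDist ℓ q (meet (ℓ i) (ℓ j)) ≤ 2 * ρ →
      ∃ a, (o a = j ∨ c a = j) ∧ 0 ≤ gap (ℓ (c a)) (meet (ℓ i) (ℓ j)))
    (hK : ∀ a, (Q.filter fun q => 0 ≤ gap (ℓ (c a)) q).card ≤ K)
    (hR : 2 * Fintype.card κ * K ≤ R * Q.card) :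
    Q.card * (ρ * ρ) ≤ 8 * (R + 2 * ρ) * Fintype.card I := by
  set Q' := Q.filter fun q => lineDepth (ℓ ∘ c) q ≤ R with hQ'
  have hhalf : Q.card ≤ 2 * Q'.card := card_le_two_mul_card_shallow (ℓ ∘ c) Q K R hK hR
  let ball : ℝ × ℝ → Finset (I × I) := fun q => Finset.univ.filter fun x : I × I =>
    (ℓ x.2).1 ≠ (ℓ x.1).1 ∧ lineDist ℓ q (meet (ℓ x.1) (ℓ x.2)) ≤ 2 * ρ
  have hdisj : (Q' : Set (ℝ × ℝ)).PairwiseDisjoint ball := by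
    intro p hp q hq' hpq
    simp only [Function.onFun]
    rw [Finset.disjoint_left]
    intro x hx hx'
    simp only [ball, Finset.mem_filter, Finset.mem_univ, true_and] at hx hx'
    have h1 := hsep p (Finset.mem_filter.1 hp).1 q (Finset.mem_filter.1 hq').1 hpq
    have h2 := separation_le_lineDist_add ℓ p q (meet (ℓ x.1) (ℓ x.2))
    omega
  have h1 : Q'.card * (ρ * ρ) ≤ (Q'.biUnion ball).card := by
    rw [Finset.card_biUnion hdisj, ← smul_eq_mul]
    refine Finset.card_nsmul_le_sum _ _ _ fun q hqm => ?_
    have hqQ := (Finset.mem_filter.1 hqm).1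
    exact sq_le_card_near_vertices ℓ q (hq q hqQ) (hinj q hqQ) hgen ρ hρ hρ'
  let G : I → Finset I := fun i => Finset.univ.filter fun j => (i, j) ∈ Q'.biUnion ball
  have hmem : ∀ i, ∀ j ∈ G i, ∃ q ∈ Q', (ℓ j).1 ≠ (ℓ i).1 ∧
      lineDist ℓ q (meet (ℓ i) (ℓ j)) ≤ 2 * ρ := by
    intro i j hj
    simpa [G, ball] using hj
  have h2 : (Q'.biUnion ball).card ≤ (Finset.univ.sigma G).card := by
    refine Finset.card_le_card_of_injOn (fun x => ⟨x.1, x.2⟩) ?_ ?_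
    · intro x hx
      simpa [G] using hx
    · rintro ⟨a, b⟩ - ⟨a', b'⟩ - h
      simpa using h
  have h3 : (Finset.univ.sigma G).card ≤ Fintype.card I * (4 * (R + 2 * ρ)) := by
    rw [Finset.card_sigma]
    refine (Finset.sum_le_card_nsmul _ _ (4 * (R + 2 * ρ)) fun i _ => ?_).trans (by simp)
    refine card_shallow_vertices_on_line_le ℓ c o i (R + 2 * ρ) (G i) ?_ ?_
    · intro j hj
      obtain ⟨q, hqQ, -, hd⟩ := hmem i j hj
      have := lineDepth_le_add ℓ c hc q (meet (ℓ i) (ℓ j))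
      have := (Finset.mem_filter.1 hqQ).2
      omega
    · intro j hj
      obtain ⟨q, hqQ, hne, hd⟩ := hmem i j hj
      exact hown q (Finset.mem_filter.1 hqQ).1 i j hne hd
  calc Q.card * (ρ * ρ) ≤ 2 * Q'.card * (ρ * ρ) := Nat.mul_le_mul_right _ hhalf
    _ = 2 * (Q'.card * (ρ * ρ)) := by ring
    _ ≤ 2 * (Fintype.card I * (4 * (R + 2 * ρ))) := by
      have := h1.trans (h2.trans h3); omega
    _ = _ := by ring

open Classical in
lemma exists_mem_open_forall_ne_zero {I J : Type*} [Fintype I] [Finite J] (φ : J → (I → ℝ) → ℝ)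
    (hc : ∀ j, Continuous (φ j))
    (hφ : ∀ j, ∃ i, ∃ c : ℝ, c ≠ 0 ∧ ∀ b t, φ j (b + t • Pi.single i 1) = φ j b + t * c)
    {U : Set (I → ℝ)} (hU : IsOpen U) (hne : U.Nonempty) : ∃ b ∈ U, ∀ j, φ j b ≠ 0 := by
  have hopen : ∀ j, IsOpen {b | φ j b ≠ 0} := fun j => isOpen_ne_fun (hc j) continuous_const
  have hdense : ∀ j, Dense {b | φ j b ≠ 0} := by
    intro j
    obtain ⟨i, c, hc0, h⟩ := hφ j
    rw [dense_iff_inter_open]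
    rintro V hV ⟨b, hb⟩
    by_cases hb0 : φ j b = 0
    · have hcont : Continuous fun t : ℝ => b + t • (Pi.single i 1 : I → ℝ) := by fun_prop
      have hmem : (fun t : ℝ => b + t • (Pi.single i 1 : I → ℝ)) ⁻¹' V ∈ nhds (0 : ℝ) :=
        (hV.preimage hcont).mem_nhds (by simpa using hb)
      obtain ⟨ε, hε, hball⟩ := Metric.mem_nhds_iff.1 hmem
      refine ⟨b + (ε / 2) • Pi.single i 1, hball ?_, ?_⟩
      · rw [Metric.mem_ball, Real.dist_eq, sub_zero, abs_of_pos (by linarith)]; linarith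
      · rw [Set.mem_ofPred_eq, h, hb0, zero_add]
        exact mul_ne_zero (by linarith) hc0
    · exact ⟨b, hb, hb0⟩
  obtain ⟨b, hb, hbU⟩ := (dense_iInter_of_isOpen hopen hdense).exists_mem_open hU hne
  exact ⟨b, hbU, fun j => Set.mem_iInter.1 hb j⟩

/-- Slopes can be perturbed to be pairwise distinct and to avoid a finite set. -/
lemma exists_injective_slopes {I : Type*} [Fintype I] (X : Finset ℝ) {U : Set (I → ℝ)}
    (hU : IsOpen U) (hne : U.Nonempty) :
    ∃ m ∈ U, Function.Injective m ∧ ∀ i, m i ∉ X := by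
  classical
  obtain ⟨m, hm, h⟩ := exists_mem_open_forall_ne_zero
    (J := {p : I × I // p.1 ≠ p.2} ⊕ (I × X))
    (fun j m => Sum.elim (fun p => m p.1.1 - m p.1.2) (fun p => m p.1 - p.2.1) j)
    (by rintro (p | p) <;> simp only [Sum.elim_inl, Sum.elim_inr] <;> fun_prop)
    (by
      rintro (⟨⟨i, j⟩, hp⟩ | ⟨i, x⟩)
      · refine ⟨i, 1, one_ne_zero, fun b t => ?_⟩
        simp [Pi.single_eq_of_ne (Ne.symm hp)]; ring
      · refine ⟨i, 1, one_ne_zero, fun b t => ?_⟩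
        simp; ring) hU hne
  refine ⟨m, hm, fun i j hij => ?_, fun i hi => ?_⟩
  · by_contra hne
    exact h (Sum.inl ⟨(i, j), hne⟩) (sub_eq_zero.2 hij)
  · exact h (Sum.inr (i, ⟨m i, hi⟩)) (sub_self _)

/-- Intercepts can be perturbed to put a family of lines in general position. -/
lemma exists_generic_intercepts {I : Type*} [Fintype I] (X : Finset ℝ) (m : I → ℝ)
    {U : Set (I → ℝ)} (hU : IsOpen U) (hne : U.Nonempty) :
    ∃ b ∈ U, NoTripleMeet (fun i => (m i, b i)) ∧
      ∀ x ∈ X, ∀ i j, m i * x + b i = m j * x + b j → i = j := by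
  classical
  obtain ⟨b, hb, h⟩ := exists_mem_open_forall_ne_zero
    (J := ({p : I × I // p.1 ≠ p.2} × X) ⊕
      {p : I × I × I // m p.2.1 ≠ m p.1 ∧ m p.2.2 ≠ m p.1 ∧ p.2.1 ≠ p.2.2})
    (fun j b => Sum.elim (fun p => (m p.1.1.1 * p.2.1 + b p.1.1.1) - (m p.1.1.2 * p.2.1 + b p.1.1.2))
      (fun p => (b p.1.2.1 - b p.1.1) * (m p.1.1 - m p.1.2.2)
        - (b p.1.2.2 - b p.1.1) * (m p.1.1 - m p.1.2.1)) j)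
    (by rintro (p | p) <;> simp only [Sum.elim_inl, Sum.elim_inr] <;> fun_prop)
    (by
      rintro (⟨⟨⟨i, j⟩, hp⟩, x⟩ | ⟨⟨i, j, t⟩, hj, ht, hjt⟩)
      · refine ⟨i, 1, one_ne_zero, fun b t => ?_⟩
        simp [Pi.single_eq_of_ne (Ne.symm hp)]; ring
      · refine ⟨j, m i - m t, sub_ne_zero.2 (Ne.symm ht), fun b s => ?_⟩
        have hij : i ≠ j := by rintro rfl; exact hj rfl
        simp [Pi.single_eq_of_ne hij, Pi.single_eq_of_ne (Ne.symm hjt)]; ring) hU hne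
  refine ⟨b, hb, fun i j t hj ht heq => ?_, fun x hx i j hij => ?_⟩
  · by_contra hjt
    refine h (Sum.inr ⟨(i, j, t), hj, ht, hjt⟩) ?_
    simp only [meetX] at heq
    have h1 : m i - m j ≠ 0 := sub_ne_zero.2 (Ne.symm hj)
    have h2 : m i - m t ≠ 0 := sub_ne_zero.2 (Ne.symm ht)
    rw [div_eq_div_iff h1 h2] at heq
    simp only [Sum.elim_inr]
    linarith
  · by_contra hne
    exact h (Sum.inl (⟨(i, j), hne⟩, ⟨x, hx⟩)) (sub_eq_zero.2 hij)

open Classical in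
/-- A line can be lowered so that it misses a finite set without changing the points of the set
on or above it. -/
lemma exists_lower_line (Q : Finset (ℝ × ℝ)) (ℓ : ℝ × ℝ) :
    ∃ b ≤ ℓ.2, (∀ q ∈ Q, gap (ℓ.1, b) q ≠ 0) ∧
      ∀ q ∈ Q, 0 ≤ gap (ℓ.1, b) q → 0 ≤ gap ℓ q := by
  set N := Q.filter fun q => gap ℓ q < 0 with hN
  rcases N.eq_empty_or_nonempty with h | h
  · refine ⟨ℓ.2 - 1, by linarith, ?_, ?_⟩
    · intro q hq
      have : ¬ gap ℓ q < 0 := fun h0 => by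
        have : q ∈ N := Finset.mem_filter.2 ⟨hq, h0⟩
        simp [h] at this
      simp only [gap] at *
      intro h0; linarith
    · intro q hq _
      by_contra h0
      have : q ∈ N := Finset.mem_filter.2 ⟨hq, not_le.1 h0⟩
      simp [h] at this
  · obtain ⟨q₀, hq₀, hmax⟩ := Finset.exists_max_image N (fun q => gap ℓ q) h
    have h0 := (Finset.mem_filter.1 hq₀).2
    refine ⟨ℓ.2 + gap ℓ q₀ / 2, by linarith, ?_, ?_⟩
    · intro q hq
      have he : gap (ℓ.1, ℓ.2 + gap ℓ q₀ / 2) q = gap ℓ q - gap ℓ q₀ / 2 := by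
        simp only [gap]; ring
      rw [he]
      by_cases h1 : gap ℓ q < 0
      · have := hmax q (Finset.mem_filter.2 ⟨hq, h1⟩)
        intro h2; linarith
      · intro h2; linarith
    · intro q hq hge
      have he : gap (ℓ.1, ℓ.2 + gap ℓ q₀ / 2) q = gap ℓ q - gap ℓ q₀ / 2 := by
        simp only [gap]; ring
      rw [he] at hge
      by_contra h1
      have := hmax q (Finset.mem_filter.2 ⟨hq, not_le.1 h1⟩)
      linarith

open Classical in
/-- Points that each lie above a line with few points above it; the interval version covers
all points with abscissa in `[x, x']` by a single halfplane. -/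
lemma exists_chord_cap (Q : Finset (ℝ × ℝ)) (k : ℕ) (hne : Q.Nonempty)
    (hQ : ∀ q ∈ Q, ∃ g : ℝ × ℝ, 0 < gap g q ∧ (Q.filter fun p => 0 ≤ gap g p).card ≤ k)
    {x x' : ℝ} (hx : x < x') :
    ∃ ℓ : ℝ × ℝ, (∀ q ∈ Q, gap ℓ q ≠ 0) ∧
      (∀ q ∈ Q, x ≤ q.1 → q.1 ≤ x' → 0 < gap ℓ q) ∧
      (Q.filter fun p => 0 ≤ gap ℓ p).card ≤ (Q.filter fun p => x < p.1 ∧ p.1 < x').card + 2 * k := by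
  choose! g hg hgk using hQ
  obtain ⟨p, hp, hpmin⟩ := Finset.exists_min_image Q (fun q => (g q).1 * x + (g q).2) hne
  obtain ⟨p', hp', hpmin'⟩ := Finset.exists_min_image Q (fun q => (g q).1 * x' + (g q).2) hne
  set y := (g p).1 * x + (g p).2 with hy
  set y' := (g p').1 * x' + (g p').2 with hy'
  set s := (y' - y) / (x' - x) with hs
  have hxx : 0 < x' - x := by linarith
  have hs' : s * (x' - x) = y' - y := by rw [hs]; field_simp
  obtain ⟨b, hb, hb0, hbge⟩ := exists_lower_line Q (s, y - s * x)
  simp only at hb hb0 hbge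
  refine ⟨(s, b), hb0, ?_, ?_⟩
  · intro q hq h1 h2
    have e1 := hpmin q hq
    have e2 := hpmin' q hq
    have e3 := hg q hq
    simp only [gap] at e3 ⊢
    have h3 : s * q.1 + (y - s * x) ≤ (g q).1 * q.1 + (g q).2 := by
      have h4 : 0 ≤ ((g q).1 * q.1 + (g q).2 - (s * q.1 + (y - s * x))) * (x' - x) := by
        nlinarith [mul_nonneg (sub_nonneg.2 e1) (sub_nonneg.2 h2),
          mul_nonneg (sub_nonneg.2 e2) (sub_nonneg.2 h1)]
      have := nonneg_of_mul_nonneg_left h4 hxx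
      linarith
    linarith
  · have hsub : (Q.filter fun p => 0 ≤ gap (s, b) p) ⊆ (Q.filter fun p => x < p.1 ∧ p.1 < x') ∪
        ((Q.filter fun t => 0 ≤ gap (g p) t) ∪ (Q.filter fun t => 0 ≤ gap (g p') t)) := by
      intro t ht
      rw [Finset.mem_filter] at ht
      have hge := hbge t ht.1 ht.2
      simp only [Finset.mem_union, Finset.mem_filter, ht.1, true_and]
      by_contra! hcon
      obtain ⟨c1, c2, c3⟩ := hcon
      simp only [gap] at hge c2 c3
      rcases le_or_gt t.1 x with h | h
      · have e := hpmin' p hp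
        have : 0 ≤ ((g p).1 - s) * (x' - x) := by nlinarith
        have := nonneg_of_mul_nonneg_left this hxx
        nlinarith [mul_nonneg this (sub_nonneg.2 h)]
      · have h' := c1 h
        have e := hpmin p' hp'
        have : 0 ≤ (s - (g p').1) * (x' - x) := by nlinarith
        have := nonneg_of_mul_nonneg_left this hxx
        nlinarith [mul_nonneg this (sub_nonneg.2 h')]
    have := (Finset.card_le_card hsub).trans ((Finset.card_union_le _ _).trans
      (Nat.add_le_add_left (Finset.card_union_le _ _) _))
    have := hgk p hp
    have := hgk p' hp'
    omega

open Classical in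
lemma exists_cap_cover_aux (Q : Finset (ℝ × ℝ)) (k D : ℕ) (hD : 0 < D) (hne : Q.Nonempty)
    (hQ : ∀ q ∈ Q, ∃ g : ℝ × ℝ, 0 < gap g q ∧ (Q.filter fun p => 0 ≤ gap g p).card ≤ k) (n : ℕ) :
    ∀ x : ℝ, (Q.filter fun p => x < p.1).card ≤ n →
    ∃ 𝓒 : Finset (ℝ × ℝ), 𝓒.card * D ≤ (Q.filter fun p => x < p.1).card + D ∧
      (∀ ℓ ∈ 𝓒, (∀ q ∈ Q, gap ℓ q ≠ 0) ∧ (Q.filter fun p => 0 ≤ gap ℓ p).card ≤ D + 2 * k) ∧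
      ∀ q ∈ Q, x ≤ q.1 → ∃ ℓ ∈ 𝓒, 0 < gap ℓ q := by
  induction n using Nat.strong_induction_on with
  | _ n ih =>
    intro x hn
    set A := (Q.filter fun p => x < p.1 ∧ D ≤ (Q.filter fun t => x < t.1 ∧ t.1 ≤ p.1).card) with hA
    rcases A.eq_empty_or_nonempty with h | h
    · obtain ⟨x', hx', hlast⟩ : ∃ x', x < x' ∧ ∀ q ∈ Q, q.1 ≤ x' := by
        obtain ⟨q, hq, hmax⟩ := Finset.exists_max_image Q (fun q => q.1) hne
        exact ⟨max q.1 (x + 1), lt_max_of_lt_right (by linarith),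
          fun t ht => (hmax t ht).trans (le_max_left _ _)⟩
      obtain ⟨ℓ, h1, h2, h3⟩ := exists_chord_cap Q k hne hQ hx'
      refine ⟨{ℓ}, by simp, ?_, fun q hq hxq => ⟨ℓ, by simp, h2 q hq hxq (hlast q hq)⟩⟩
      intro ℓ' hℓ'
      rw [Finset.mem_singleton] at hℓ'
      subst hℓ'
      refine ⟨h1, h3.trans (Nat.add_le_add_right ?_ _)⟩
      by_contra hcon
      push Not at hcon
      obtain ⟨q, hq, hmax⟩ := Finset.exists_max_image (Q.filter fun p => x < p.1 ∧ p.1 < x')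
        (fun q => q.1) (Finset.card_pos.1 (by omega))
      have hq' := Finset.mem_filter.1 hq
      have : q ∈ A := by
        refine Finset.mem_filter.2 ⟨hq'.1, hq'.2.1, hcon.le.trans (Finset.card_le_card ?_)⟩
        intro t ht
        have ht' := Finset.mem_filter.1 ht
        exact Finset.mem_filter.2 ⟨ht'.1, ht'.2.1, hmax t ht⟩
      simp [h] at this
    · obtain ⟨p, hp, hmin⟩ := Finset.exists_min_image A (fun q => q.1) h
      obtain ⟨hpQ, hxp, hpD⟩ := by simpa only [hA, Finset.mem_filter] using hp
      have hsplit : (Q.filter fun t => x < t.1 ∧ t.1 ≤ p.1).card +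
          (Q.filter fun t => p.1 < t.1).card = (Q.filter fun t => x < t.1).card := by
        rw [← Finset.card_union_of_disjoint]
        · congr 1
          ext t
          simp only [Finset.mem_union, Finset.mem_filter]
          constructor
          · rintro (h | h)
            · exact ⟨h.1, h.2.1⟩
            · exact ⟨h.1, hxp.trans h.2⟩
          · intro h
            rcases le_or_gt t.1 p.1 with h' | h'
            · exact Or.inl ⟨h.1, h.2, h'⟩
            · exact Or.inr ⟨h.1, h'⟩
        · rw [Finset.disjoint_left]
          intro t ht ht'
          have := (Finset.mem_filter.1 ht).2.2
          have := (Finset.mem_filter.1 ht').2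
          linarith
      obtain ⟨𝓒, hc1, hc2, hc3⟩ := ih ((Q.filter fun t => p.1 < t.1).card) (by omega) p.1 le_rfl
      obtain ⟨ℓ, h1, h2, h3⟩ := exists_chord_cap Q k hne hQ hxp
      refine ⟨insert ℓ 𝓒, ?_, ?_, ?_⟩
      · have := Nat.mul_le_mul_right D (Finset.card_insert_le ℓ 𝓒)
        rw [Nat.add_mul] at this
        omega
      · intro ℓ' hℓ'
        rcases Finset.mem_insert.1 hℓ' with rfl | hℓ'
        · refine ⟨h1, h3.trans (Nat.add_le_add_right ?_ _)⟩
          by_contra hcon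
          push Not at hcon
          obtain ⟨q, hq, hmax⟩ := Finset.exists_max_image (Q.filter fun t => x < t.1 ∧ t.1 < p.1)
            (fun q => q.1) (Finset.card_pos.1 (by omega))
          have hq' := Finset.mem_filter.1 hq
          have : q ∈ A := by
            refine Finset.mem_filter.2 ⟨hq'.1, hq'.2.1, hcon.le.trans (Finset.card_le_card ?_)⟩
            intro t ht
            have ht' := Finset.mem_filter.1 ht
            exact Finset.mem_filter.2 ⟨ht'.1, ht'.2.1, hmax t ht⟩
          have := hmin q this
          linarith [hq'.2.2]
        · exact hc2 ℓ' hℓ'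
      · intro q hq hxq
        rcases le_or_gt q.1 p.1 with h' | h'
        · exact ⟨ℓ, Finset.mem_insert_self _ _, h2 q hq hxq h'⟩
        · obtain ⟨ℓ', hℓ', h''⟩ := hc3 q hq h'.le
          exact ⟨ℓ', Finset.mem_insert_of_mem hℓ', h''⟩

open Classical in
/-- Shallow points can be covered by few halfplanes containing few points each. -/
lemma exists_cap_cover (Q : Finset (ℝ × ℝ)) (k D : ℕ) (hD : 0 < D) (hne : Q.Nonempty)
    (hQ : ∀ q ∈ Q, ∃ g : ℝ × ℝ, 0 < gap g q ∧ (Q.filter fun p => 0 ≤ gap g p).card ≤ k) :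
    ∃ 𝓒 : Finset (ℝ × ℝ), 𝓒.card * D ≤ Q.card + D ∧
      (∀ ℓ ∈ 𝓒, (∀ q ∈ Q, gap ℓ q ≠ 0) ∧ (Q.filter fun p => 0 ≤ gap ℓ p).card ≤ D + 2 * k) ∧
      ∀ q ∈ Q, ∃ ℓ ∈ 𝓒, 0 < gap ℓ q := by
  obtain ⟨q, hq, hmin⟩ := Finset.exists_min_image Q (fun q => q.1) hne
  obtain ⟨𝓒, h1, h2, h3⟩ := exists_cap_cover_aux Q k D hD hne hQ _ q.1 le_rfl
  exact ⟨𝓒, h1.trans (Nat.add_le_add_right (Finset.card_filter_le _ _) _), h2,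
    fun t ht => h3 t ht (hmin t ht)⟩

lemma exists_exit_lines (𝓒 : Finset (ℝ × ℝ)) (hne : 𝓒.Nonempty) (t : ℝ × ℝ)
    (ht : ∀ ℓ ∈ 𝓒, ℓ.1 ≠ t.1) :
    ∃ e : Bool → ℝ × ℝ, (∀ s, e s ∈ 𝓒) ∧
      ∀ v, gap t v = 0 → (∃ ℓ ∈ 𝓒, 0 < gap ℓ v) → ∃ s, 0 < gap (e s) v := by
  classical
  obtain ⟨ℓ₀, hℓ₀⟩ := hne
  have key : ∀ ℓ ∈ 𝓒, ∀ v, gap t v = 0 → gap ℓ v = (t.1 - ℓ.1) * (v.1 - meetX t ℓ) := by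
    intro ℓ hℓ v hv
    have : v = pointAt t v.1 := by
      ext
      · rfl
      · simp only [gap] at hv
        simp only [pointAt]; linarith
    conv_lhs => rw [this]
    exact gap_pointAt_of_ne (ht ℓ hℓ) _
  have h1 : ∃ e ∈ 𝓒, ∀ ℓ ∈ 𝓒, ℓ.1 < t.1 → e.1 < t.1 ∧ meetX t e ≤ meetX t ℓ := by
    rcases (𝓒.filter fun ℓ => ℓ.1 < t.1).eq_empty_or_nonempty with h | h
    · exact ⟨ℓ₀, hℓ₀, fun ℓ hℓ hlt => (Finset.filter_eq_empty_iff.1 h hℓ hlt).elim⟩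
    · obtain ⟨e, he, hmin⟩ := Finset.exists_min_image _ (meetX t) h
      rw [Finset.mem_filter] at he
      exact ⟨e, he.1, fun ℓ hℓ hlt => ⟨he.2, hmin ℓ (Finset.mem_filter.2 ⟨hℓ, hlt⟩)⟩⟩
  have h2 : ∃ e ∈ 𝓒, ∀ ℓ ∈ 𝓒, t.1 < ℓ.1 → t.1 < e.1 ∧ meetX t ℓ ≤ meetX t e := by
    rcases (𝓒.filter fun ℓ => t.1 < ℓ.1).eq_empty_or_nonempty with h | h
    · exact ⟨ℓ₀, hℓ₀, fun ℓ hℓ hlt => (Finset.filter_eq_empty_iff.1 h hℓ hlt).elim⟩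
    · obtain ⟨e, he, hmin⟩ := Finset.exists_max_image _ (meetX t) h
      rw [Finset.mem_filter] at he
      exact ⟨e, he.1, fun ℓ hℓ hlt => ⟨he.2, hmin ℓ (Finset.mem_filter.2 ⟨hℓ, hlt⟩)⟩⟩
  obtain ⟨e₁, he₁, h1⟩ := h1
  obtain ⟨e₂, he₂, h2⟩ := h2
  refine ⟨fun s => if s then e₁ else e₂, fun s => by cases s <;> simpa, ?_⟩
  rintro v hv ⟨ℓ, hℓ, hpos⟩
  rw [key ℓ hℓ v hv] at hpos
  rcases lt_or_gt_of_ne (ht ℓ hℓ) with hlt | hlt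
  · refine ⟨true, ?_⟩
    obtain ⟨h3, h4⟩ := h1 ℓ hℓ hlt
    simp only [if_true]
    rw [key e₁ he₁ v hv]
    have := (mul_pos_iff_of_pos_left (sub_pos.2 hlt)).1 hpos
    exact mul_pos (sub_pos.2 h3) (by linarith)
  · refine ⟨false, ?_⟩
    obtain ⟨h3, h4⟩ := h2 ℓ hℓ hlt
    simp only [Bool.false_eq_true, if_false]
    rw [key e₂ he₂ v hv]
    have h5 : v.1 - meetX t ℓ < 0 := by
      by_contra h6
      have := mul_nonpos_of_nonpos_of_nonneg (sub_neg.2 hlt).le (not_lt.1 h6)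
      linarith
    exact mul_pos_of_neg_of_neg (sub_neg.2 h3) (by linarith)

/-- A positive lower bound for finitely many nonzero gaps. -/
lemma exists_pos_le_abs_gap {I : Type*} [Fintype I] (Q : Finset (ℝ × ℝ)) (ℓ : I → ℝ × ℝ)
    (h : ∀ i, ∀ q ∈ Q, gap (ℓ i) q ≠ 0) : ∃ ε > 0, ∀ i, ∀ q ∈ Q, ε ≤ |gap (ℓ i) q| := by
  classical
  rcases (Finset.univ ×ˢ Q : Finset (I × (ℝ × ℝ))).eq_empty_or_nonempty with h0 | h0
  · refine ⟨1, one_pos, fun i q hq => ?_⟩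
    have : (i, q) ∈ (Finset.univ ×ˢ Q : Finset (I × (ℝ × ℝ))) := by simp [hq]
    simp [h0] at this
  · obtain ⟨p, hp, hmin⟩ := Finset.exists_min_image _ (fun p => |gap (ℓ p.1) p.2|) h0
    refine ⟨_, abs_pos.2 (h p.1 p.2 (Finset.mem_product.1 hp).2), fun i q hq => ?_⟩
    exact hmin (i, q) (by simp [hq])

open Classical in
theorem exists_arrangement {ι : Type*} [Fintype ι] (Q : Finset (ℝ × ℝ)) (L : ι → ℝ × ℝ)
    (hL : ∀ i, ∀ q ∈ Q, gap (L i) q ≠ 0) (𝓒 : Finset (ℝ × ℝ)) (hne : 𝓒.Nonempty)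
    (h𝓒 : ∀ ℓ ∈ 𝓒, ∀ q ∈ Q, gap ℓ q ≠ 0) (hcov : ∀ q ∈ Q, ∃ ℓ ∈ 𝓒, 0 < gap ℓ q) (ρ : ℕ) :
    ∃ (ℓ : ι ⊕ ((ι × Bool) ⊕ (𝓒 × Fin (2 * ρ + 1))) → ℝ × ℝ)
      (o : (ι × Bool) ⊕ (𝓒 × Fin (2 * ρ + 1)) → ι ⊕ ((ι × Bool) ⊕ (𝓒 × Fin (2 * ρ + 1)))),
      (∀ q ∈ Q, ∀ j, gap (ℓ j) q ≠ 0) ∧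
      (∀ q ∈ Q, ∀ i j, gap (ℓ i) q = gap (ℓ j) q → i = j) ∧
      NoTripleMeet ℓ ∧
      (∀ i, ∀ j, j ≠ Sum.inl i → (ℓ j).1 ≠ (ℓ (Sum.inl i)).1) ∧
      (∀ i, ∀ q ∈ Q, 0 < gap (ℓ (Sum.inl i)) q * gap (L i) q) ∧
      (∀ a, ∃ C ∈ 𝓒, ∀ q ∈ Q, 0 ≤ gap (ℓ (Sum.inr a)) q → 0 ≤ gap C q) ∧
      ∀ q ∈ Q, ∀ i j, (ℓ j).1 ≠ (ℓ i).1 → lineDist ℓ q (meet (ℓ i) (ℓ j)) ≤ 2 * ρ →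
        ∃ a, (o a = j ∨ Sum.inr a = j) ∧ 0 ≤ gap (ℓ (Sum.inr a)) (meet (ℓ i) (ℓ j)) := by
  obtain ⟨m, hmU, hminj, hmX⟩ := exists_injective_slopes (𝓒.image Prod.fst)
    (U := {m : ι → ℝ | ∀ i, ∀ q : Q, 0 < gap (m i, (L i).2) q * gap (L i) q})
    (by
      simp only [Set.ofPred_forall]
      refine isOpen_iInter_of_finite fun i => isOpen_iInter_of_finite fun q => ?_
      refine isOpen_lt continuous_const ?_
      simp only [gap]
      fun_prop)
    ⟨fun i => (L i).1, fun i q => mul_self_pos.2 (hL i q q.2)⟩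
  set T : ι → ℝ × ℝ := fun i => (m i, (L i).2) with hT
  have hTC : ∀ i, ∀ ℓ ∈ 𝓒, ℓ.1 ≠ (T i).1 := fun i ℓ hℓ h =>
    hmX i (Finset.mem_image.2 ⟨ℓ, hℓ, h⟩)
  choose e heC he using fun i => exists_exit_lines 𝓒 hne (T i) (hTC i)
  set base : ι ⊕ ((ι × Bool) ⊕ (𝓒 × Fin (2 * ρ + 1))) → ℝ × ℝ :=
    Sum.elim T (Sum.elim (fun p => e p.1 p.2) (fun p => p.1)) with hbase
  have hbase0 : ∀ j, ∀ q ∈ Q, gap (base j) q ≠ 0 := by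
    rintro (i | p | p) q hq
    · exact left_ne_zero_of_mul (hmU i ⟨q, hq⟩).ne'
    · exact h𝓒 _ (heC _ _) q hq
    · exact h𝓒 _ p.1.2 q hq
  obtain ⟨ε, hε, hεb⟩ := exists_pos_le_abs_gap Q base hbase0
  set δ : ι ⊕ ((ι × Bool) ⊕ (𝓒 × Fin (2 * ρ + 1))) → ℝ :=
    Sum.elim (fun _ => -(ε / 4)) (Sum.elim (fun _ => -(ε / 2)) (fun _ => ε / 4)) with hδ
  obtain ⟨b, hbU, hgen, hbinj⟩ := exists_generic_intercepts (Q.image Prod.fst)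
    (fun j => (base j).1)
    (U := {b | ∀ j, |b j - ((base j).2 + δ j)| < ε / 16})
    (by
      simp only [Set.ofPred_forall]
      refine isOpen_iInter_of_finite fun i => ?_
      refine isOpen_lt ?_ continuous_const
      fun_prop)
    ⟨fun j => (base j).2 + δ j, fun j => by simp; linarith⟩
  have hb : ∀ j, |b j - ((base j).2 + δ j)| < ε / 16 := hbU
  set ℓ : ι ⊕ ((ι × Bool) ⊕ (𝓒 × Fin (2 * ρ + 1))) → ℝ × ℝ :=
    fun j => ((base j).1, b j) with hℓ
  have hgapv : ∀ j v, gap (ℓ j) v = gap (base j) v - (b j - (base j).2) := by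
    intro j v; simp only [gap, hℓ]; ring
  have hδle : ∀ j, |δ j| ≤ ε / 2 := by
    rintro (i | p | p)
    · simp only [hδ, Sum.elim_inl, abs_neg]; rw [abs_of_pos (by linarith)]; linarith
    · simp only [hδ, Sum.elim_inl, Sum.elim_inr, abs_neg]; rw [abs_of_pos (by linarith)]
    · simp only [hδ, Sum.elim_inr]; rw [abs_of_pos (by linarith)]; linarith
  have hsign : ∀ j, ∀ q ∈ Q, 0 < gap (ℓ j) q * gap (base j) q := by
    intro j q hq
    have h1 := hεb j q hq
    have h2 := abs_lt.1 (hb j)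
    have h3 := abs_le.1 (hδle j)
    rw [hgapv]
    rcases le_abs.1 h1 with h4 | h4
    · exact mul_pos (by linarith) (by linarith)
    · exact mul_pos_of_neg_of_neg (by linarith) (by linarith)
  refine ⟨ℓ, Sum.elim (fun p => Sum.inl p.1) (fun p => Sum.inr (Sum.inr p)), ?_, ?_, hgen, ?_, ?_,
    ?_, ?_⟩
  · exact fun q hq j => left_ne_zero_of_mul (hsign j q hq).ne'
  · intro q hq i j hij
    refine hbinj q.1 (Finset.mem_image_of_mem _ hq) i j ?_
    simp only [gap, hℓ] at hij
    linarith
  · rintro i (j | p | p) hj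
    · exact fun h => hj (congrArg _ (hminj h))
    · exact hTC i (e p.1 p.2) (heC _ _)
    · exact hTC i p.1 p.1.2
  · intro i q hq
    have h1 := hsign (Sum.inl i) q hq
    have h2 : 0 < gap (T i) q * gap (L i) q := hmU i ⟨q, hq⟩
    have h3 : 0 < (gap (ℓ (Sum.inl i)) q * gap (L i) q) * (gap (T i) q * gap (T i) q) := by
      have := mul_pos h1 h2
      have h4 : gap (base (Sum.inl i)) q = gap (T i) q := rfl
      rw [h4] at this
      linarith
    exact pos_of_mul_pos_left h3 (mul_self_nonneg _)
  · intro a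
    have hmem : base (Sum.inr a) ∈ 𝓒 := by
      rcases a with p | p
      · exact heC _ _
      · exact p.1.2
    refine ⟨_, hmem, fun q hq h => ?_⟩
    exact (pos_of_mul_pos_right (hsign (Sum.inr a) q hq) h).le
  · intro q hq i j hij hdist
    set v := meet (ℓ i) (ℓ j) with hv
    have hvj : gap (ℓ j) v = 0 := gap_meet hij
    obtain ⟨C, hC, hCq⟩ := hcov q hq
    have hCv : 0 < gap C v := by
      obtain ⟨t, ht⟩ : ∃ t : Fin (2 * ρ + 1), 0 < gap (ℓ (Sum.inr (Sum.inr (⟨C, hC⟩, t)))) v := by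
        by_contra hcon
        push Not at hcon
        have : (2 * ρ + 1) ≤ lineDist ℓ q v := by
          have hinj : Function.Injective fun t : Fin (2 * ρ + 1) =>
              (Sum.inr (Sum.inr (⟨C, hC⟩, t)) :
                ι ⊕ ((ι × Bool) ⊕ (𝓒 × Fin (2 * ρ + 1)))) := by
            intro s t hst; simpa using hst
          have hcard : (Finset.univ.image fun t : Fin (2 * ρ + 1) =>
              (Sum.inr (Sum.inr (⟨C, hC⟩, t)) :
                ι ⊕ ((ι × Bool) ⊕ (𝓒 × Fin (2 * ρ + 1))))).card = 2 * ρ + 1 := by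
            rw [Finset.card_image_of_injective _ hinj]; simp
          refine hcard.symm.le.trans (Finset.card_le_card fun x hx => ?_)
          obtain ⟨t, -, rfl⟩ := Finset.mem_image.1 hx
          refine Finset.mem_filter.2 ⟨Finset.mem_univ _, ?_⟩
          have h1 := hsign (Sum.inr (Sum.inr (⟨C, hC⟩, t))) q hq
          have h2 : 0 < gap (ℓ (Sum.inr (Sum.inr (⟨C, hC⟩, t)))) q :=
            pos_of_mul_pos_left h1 hCq.le
          exact mul_nonpos_of_nonneg_of_nonpos h2.le (hcon t)
        omega
      have h1 := abs_lt.1 (hb (Sum.inr (Sum.inr (⟨C, hC⟩, t))))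
      rw [hgapv] at ht
      simp only [hbase, hδ, Sum.elim_inr] at ht h1
      linarith
    rcases j with i' | a
    · have h1 := abs_lt.1 (hb (Sum.inl i'))
      rw [hgapv] at hvj
      simp only [hbase, hδ, Sum.elim_inl] at hvj h1
      set r := -gap (T i') v with hr
      have hshift : ∀ g : ℝ × ℝ, gap g (v.1, v.2 + r) = gap g v + r := by
        intro g; simp only [gap]; ring
      obtain ⟨s, hs⟩ := he i' (v.1, v.2 + r) (by rw [hshift, hr]; ring)
        ⟨C, hC, by rw [hshift]; linarith⟩
      refine ⟨Sum.inl (i', s), Or.inl rfl, ?_⟩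
      have h2 := abs_lt.1 (hb (Sum.inr (Sum.inl (i', s))))
      rw [hgapv]
      rw [hshift] at hs
      simp only [hbase, hδ, Sum.elim_inl, Sum.elim_inr] at h2 ⊢
      linarith
    · exact ⟨a, Or.inr rfl, hvj.ge⟩

open Classical in
lemma exists_close_pair_of_card_le {ι : Type*} [Fintype ι] (Q : Finset (ℝ × ℝ)) (k : ℕ)
    (hk : 1 ≤ k) (hQ2 : 1 < Q.card)
    (hQ : ∀ q ∈ Q, ∃ g : ℝ × ℝ, 0 < gap g q ∧ (Q.filter fun p => 0 ≤ gap g p).card ≤ k)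
    (L : ι → ℝ × ℝ) (hL : ∀ i, ∀ q ∈ Q, gap (L i) q ≠ 0) (hcard : Q.card ≤ Fintype.card ι) :
    ∃ p ∈ Q, ∃ q ∈ Q, p ≠ q ∧
      ((Finset.univ.filter fun i => gap (L i) p * gap (L i) q < 0).card : ℝ) * Q.card ≤
        80000 * Fintype.card ι * √k := by
  by_contra! hcon
  set N := Q.card with hN
  set l := Fintype.card ι with hl
  set s := √(k : ℝ) with hs
  have hk' : (1 : ℝ) ≤ k := by exact_mod_cast hk
  have hss : s * s = k := Real.mul_self_sqrt (by linarith)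
  have hs1 : 1 ≤ s := Real.one_le_sqrt.2 hk'
  have hsk : s ≤ k := by nlinarith
  have hN0 : (0 : ℝ) < N := by exact_mod_cast (by omega : 0 < N)
  have hNl : (N : ℝ) ≤ l := by exact_mod_cast hcard
  have hl0 : (0 : ℝ) < l := by linarith
  have hNs : 80000 * s < N := by
    obtain ⟨p, hp, q, hq, hpq⟩ := Finset.one_lt_card.1 hQ2
    have h1 := hcon p hp q hq hpq
    have h2 : ((Finset.univ.filter fun i => gap (L i) p * gap (L i) q < 0).card : ℝ) ≤ l := by
      exact_mod_cast Finset.card_le_univ _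
    have h3 := mul_le_mul_of_nonneg_right h2 hN0.le
    have h4 : l * (80000 * s) < l * N := by linarith
    exact lt_of_mul_lt_mul_left h4 hl0.le
  have hne : Q.Nonempty := Finset.card_pos.1 (by omega)
  obtain ⟨𝓒, hM, h𝓒, hcov⟩ := exists_cap_cover Q k (60000 * k) (by omega) hne hQ
  set ρ := ⌊20000 * l * s / N⌋₊ with hρ
  have hρ1 : ρ * N ≤ 20000 * l * s := by
    have := Nat.floor_le (by positivity : 0 ≤ 20000 * l * s / N)
    rwa [le_div_iff₀ hN0] at this
  have hρ2 : 20000 * l * s < (ρ + 1) * N := by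
    have := Nat.lt_floor_add_one (20000 * l * s / N)
    rwa [div_lt_iff₀ hN0] at this
  have hls : (N : ℝ) ≤ l * s := by nlinarith
  have hρpos : (1 : ℝ) ≤ ρ := by
    have : 0 < ρ := by
      by_contra h0
      have h0 : ρ = 0 := by omega
      rw [h0] at hρ2
      norm_num at hρ2
      linarith
    exact_mod_cast this
  have hρl : 4 * (ρ : ℝ) ≤ l := by
    have h1 : 4 * (ρ : ℝ) * N ≤ l * N := by
      have := mul_le_mul_of_nonneg_left hNs.le hl0.le
      linarith
    exact le_of_mul_le_mul_right h1 hN0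
  have hρl' : 4 * ρ ≤ l := by exact_mod_cast hρl
  have hρpos' : 1 ≤ ρ := by exact_mod_cast hρpos
  obtain ⟨q₀, hq₀⟩ := hne
  obtain ⟨ℓ₀, hℓ₀, -⟩ := hcov q₀ hq₀
  obtain ⟨ℓ, o, hℓQ, hinj, hgen, hslope, hsign, hcap, hown⟩ := exists_arrangement Q L hL 𝓒
    ⟨ℓ₀, hℓ₀⟩ (fun ℓ hℓ => (h𝓒 ℓ hℓ).1) hcov ρ
  set n := Fintype.card ((ι × Bool) ⊕ (𝓒 × Fin (2 * ρ + 1))) with hn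
  have hn' : n = l * 2 + 𝓒.card * (2 * ρ + 1) := by simp [hn, hl]
  have hI : Fintype.card (ι ⊕ ((ι × Bool) ⊕ (𝓒 × Fin (2 * ρ + 1)))) = l + n := by
    rw [Fintype.card_sum]
  set R := 2 * n * (60000 * k + 2 * k) / N + 1 with hR
  have hRN : 2 * n * (60000 * k + 2 * k) ≤ R * N := by
    have := Nat.lt_div_mul_add (a := 2 * n * (60000 * k + 2 * k)) (b := N) (by omega)
    rw [hR, add_mul, one_mul]; exact this.le
  have hRN' : R * N ≤ 2 * n * (60000 * k + 2 * k) + N := by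
    rw [hR, add_mul, one_mul]
    exact Nat.add_le_add_right (Nat.div_mul_le_self _ _) _
  have main := card_mul_sq_le_of_separated ℓ Sum.inr o Sum.inr_injective Q ρ (60000 * k + 2 * k) R
    hℓQ hinj hgen (by omega)
    (by
      intro j
      have h1 : l - 1 ≤ (((Finset.univ : Finset ι).image
          (Sum.inl : ι → ι ⊕ ((ι × Bool) ⊕ (𝓒 × Fin (2 * ρ + 1))))).erase j).card := by
        refine le_trans ?_ Finset.pred_card_le_card_erase
        rw [Finset.card_image_of_injective _ Sum.inl_injective, Finset.card_univ]
      refine le_trans (by omega : ρ ≤ l - 1) (h1.trans (Finset.card_le_card fun x hx => ?_))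
      obtain ⟨hxj, hx⟩ := Finset.mem_erase.1 hx
      obtain ⟨i, -, rfl⟩ := Finset.mem_image.1 hx
      exact Finset.mem_filter.2 ⟨Finset.mem_univ _, (hslope i j hxj.symm).symm⟩)
    (by
      intro p hp q hq hpq
      have h1 := hcon p hp q hq hpq
      have h2 : 4 * ρ < (Finset.univ.filter fun i => gap (L i) p * gap (L i) q < 0).card := by
        have h3 : (4 * ρ : ℝ) * N <
            ((Finset.univ.filter fun i => gap (L i) p * gap (L i) q < 0).card : ℝ) * N := by
          linarith
        exact_mod_cast lt_of_mul_lt_mul_right h3 hN0.le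
      refine h2.trans_le ?_
      rw [← Finset.card_image_of_injective _ (Sum.inl_injective
        (β := (ι × Bool) ⊕ (𝓒 × Fin (2 * ρ + 1))))]
      refine Finset.card_le_card fun x hx => ?_
      obtain ⟨i, hi, rfl⟩ := Finset.mem_image.1 hx
      have h3 := (Finset.mem_filter.1 hi).2
      refine Finset.mem_filter.2 ⟨Finset.mem_univ _, ?_⟩
      by_contra! h4
      have h5 := mul_pos (hsign i p hp) (hsign i q hq)
      have h6 := mul_nonpos_of_nonneg_of_nonpos h4 h3.le
      linarith)
    hown
    (by
      intro a
      obtain ⟨C, hC, h⟩ := hcap a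
      refine le_trans (Finset.card_le_card fun q hq => ?_) (h𝓒 C hC).2
      rw [Finset.mem_filter] at hq ⊢
      exact ⟨hq.1, h q hq.1 hq.2⟩)
    hRN
  rw [hI] at main
  have main' : (N : ℝ) * (ρ * ρ) ≤ 8 * (R + 2 * ρ) * (l + n) := by exact_mod_cast main
  have hRN'' : (R : ℝ) * N ≤ 2 * n * (60000 * k + 2 * k) + N := by exact_mod_cast hRN'
  have hM' : (𝓒.card : ℝ) * (60000 * k) ≤ N + 60000 * k := by exact_mod_cast hM
  have hn'' : (n : ℝ) = l * 2 + 𝓒.card * (2 * ρ + 1) := by exact_mod_cast hn'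
  have hMρ : 3 * ((𝓒.card : ℝ) * ρ) ≤ 2 * l := by
    have h1 : (𝓒.card : ℝ) * (60000 * k) * ρ ≤ (N + 60000 * k) * ρ :=
      mul_le_mul_of_nonneg_right hM' (by linarith)
    have h2 : 60000 * k * (4 * (ρ : ℝ)) ≤ 60000 * k * l :=
      mul_le_mul_of_nonneg_left hρl (by linarith)
    have h3 : l * s ≤ l * k := mul_le_mul_of_nonneg_left hsk hl0.le
    have h4 : (60000 * (k : ℝ)) * (3 * ((𝓒.card : ℝ) * ρ)) ≤ (60000 * k) * (2 * l) := by
      have : 0 ≤ l * (k : ℝ) := by positivity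
      linarith
    exact le_of_mul_le_mul_left h4 (by linarith)
  have hn3 : (n : ℝ) + l ≤ 5 * l := by
    have : (𝓒.card : ℝ) ≤ 𝓒.card * ρ := le_mul_of_one_le_right (by positivity) hρpos
    rw [hn'']; linarith
  have hfin : (N * ρ) * (N * (ρ : ℝ)) ≤ 40 * l * (600020 * l * k + 3 * (ρ * N)) := by
    have h1 : (N : ℝ) * (N * (ρ * ρ)) ≤ N * (8 * (R + 2 * ρ) * (l + n)) :=
      mul_le_mul_of_nonneg_left main' hN0.le
    have h2 : (R : ℝ) * N + 2 * (ρ * N) ≤ 600020 * l * k + 3 * (ρ * N) := by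
      have h3 : (N : ℝ) ≤ ρ * N := le_mul_of_one_le_left hN0.le hρpos
      have h4 : (n : ℝ) * k ≤ (5 * l) * k :=
        mul_le_mul_of_nonneg_right (by linarith) (by linarith)
      linarith
    have h3 : (l + n : ℝ) * (R * N + 2 * (ρ * N)) ≤
        (5 * l) * (600020 * l * k + 3 * (ρ * N)) :=
      mul_le_mul (by linarith) h2 (by positivity) (by positivity)
    linarith
  have hlow : 10000 * (l * s) ≤ N * ρ := by
    have h3 : (N : ℝ) ≤ ρ * N := le_mul_of_one_le_left hN0.le hρpos
    linarith
  have hlow2 : (10000 * (l * s)) * (10000 * (l * s)) ≤ (N * ρ) * (N * (ρ : ℝ)) :=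
    mul_self_le_mul_self (by positivity) hlow
  have e1 : (10000 * (l * s)) * (10000 * (l * s)) = 100000000 * (l * (l * k)) := by
    rw [← hss]; ring
  have h5 : (l : ℝ) * (ρ * N) ≤ l * (20000 * (l * k)) :=
    mul_le_mul_of_nonneg_left (by nlinarith) hl0.le
  have h6 : 0 < (l : ℝ) * (l * k) := by positivity
  linarith

open Classical in
lemma exists_close_pair_of_above {ι : Type*} (Q : Finset (ℝ × ℝ)) (k : ℕ)
    (hk : 1 ≤ k) (hQ2 : 1 < Q.card)
    (hQ : ∀ q ∈ Q, ∃ g : ℝ × ℝ, 0 < gap g q ∧ (Q.filter fun p => 0 ≤ gap g p).card ≤ k)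
    (F : Finset ι) (w : ι → ℕ) (L : ι → ℝ × ℝ) (hL : ∀ i ∈ F, ∀ q ∈ Q, gap (L i) q ≠ 0) :
    ∃ p ∈ Q, ∃ q ∈ Q, p ≠ q ∧
      ((∑ i ∈ F with gap (L i) p * gap (L i) q < 0, w i : ℕ) : ℝ) * Q.card ≤
        80000 * (∑ i ∈ F, w i : ℕ) * √k := by
  have hN0 : (0 : ℝ) < Q.card := by exact_mod_cast (by omega : 0 < Q.card)
  rcases Nat.eq_zero_or_pos (∑ i ∈ F, w i) with h0 | h0
  · obtain ⟨p, hp, q, hq, hpq⟩ := Finset.one_lt_card.1 hQ2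
    refine ⟨p, hp, q, hq, hpq, ?_⟩
    have : ∑ i ∈ F with gap (L i) p * gap (L i) q < 0, w i = 0 :=
      Nat.eq_zero_of_le_zero (h0 ▸ Finset.sum_le_sum_of_subset (Finset.filter_subset _ _))
    rw [h0, this]; simp
  have hcard : Fintype.card (Σ i : F, Fin (w i * Q.card)) = (∑ i ∈ F, w i) * Q.card := by
    rw [Fintype.card_sigma, Finset.sum_mul, ← Finset.sum_coe_sort F]
    simp
  obtain ⟨p, hp, q, hq, hpq, h⟩ := exists_close_pair_of_card_le
    (ι := Σ i : F, Fin (w i * Q.card)) Q k hk hQ2 hQ (fun x => L x.1)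
    (fun x q hq => hL x.1 x.1.2 q hq)
    (by rw [hcard]; exact Nat.le_mul_of_pos_left _ h0)
  refine ⟨p, hp, q, hq, hpq, ?_⟩
  have hfil : (Finset.univ.filter fun x : Σ i : F, Fin (w i * Q.card) =>
      gap (L x.1) p * gap (L x.1) q < 0).card =
      (∑ i ∈ F with gap (L i) p * gap (L i) q < 0, w i) * Q.card := by
    rw [Finset.card_filter, Fintype.sum_sigma, Finset.sum_filter, Finset.sum_mul,
      ← Finset.sum_coe_sort F]
    refine Finset.sum_congr rfl fun i _ => ?_
    split_ifs <;> simp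
  rw [hfil, hcard] at h
  push_cast at h ⊢
  refine le_of_mul_le_mul_right ?_ hN0
  linarith

/-- On a finite set, an open halfplane is cut out by a nonvertical line missing the set. -/
lemma exists_nonvertical_line (S : Finset (ℝ × ℝ)) (a b c : ℝ) :
    ∃ ℓ : ℝ × ℝ, (∀ q ∈ S, gap ℓ q ≠ 0) ∧
      ((∀ q ∈ S, a * q.1 + b * q.2 + c < 0 ↔ 0 < gap ℓ q) ∨
        (∀ q ∈ S, a * q.1 + b * q.2 + c < 0 ↔ gap ℓ q < 0)) := by
  have hev : ∀ᶠ ε in nhdsWithin (0 : ℝ) (Set.Ioi 0), b + ε ^ 2 ≠ 0 ∧ ∀ q ∈ S,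
      (a * q.1 + b * q.2 + c < 0 → a * q.1 + (b + ε ^ 2) * q.2 + (c + ε) < 0) ∧
      (0 ≤ a * q.1 + b * q.2 + c → 0 < a * q.1 + (b + ε ^ 2) * q.2 + (c + ε)) := by
    refine Filter.Eventually.and ?_ ((Filter.eventually_all_finset S).2 fun q _ => ?_)
    · rcases eq_or_ne b 0 with rfl | hb
      · filter_upwards [self_mem_nhdsWithin] with ε hε
        have : (0 : ℝ) < ε := hε
        positivity
      · refine Filter.Eventually.filter_mono nhdsWithin_le_nhds ?_
        have hc : ContinuousAt (fun ε : ℝ => b + ε ^ 2) 0 := by fun_prop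
        exact hc.eventually_ne (by simpa using hb)
    · refine Filter.Eventually.and ?_ ?_
      · by_cases h : a * q.1 + b * q.2 + c < 0
        · refine Filter.Eventually.filter_mono nhdsWithin_le_nhds ?_
          have hc : ContinuousAt (fun ε : ℝ => a * q.1 + (b + ε ^ 2) * q.2 + (c + ε)) 0 := by
            fun_prop
          filter_upwards [hc.eventually_lt_const (u := 0) (by simpa using h)] with ε hε _ using hε
        · exact Filter.Eventually.of_forall fun ε h' => absurd h' h
      · have hc : ContinuousAt (fun ε : ℝ => 1 + ε * q.2) 0 := by fun_prop
        have h1 := (hc.eventually_const_lt (u := 0) (by simp)).filter_mono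
          (nhdsWithin_le_nhds (s := Set.Ioi 0))
        filter_upwards [h1, self_mem_nhdsWithin] with ε h2 hε h
        have := mul_pos (show (0 : ℝ) < ε from hε) h2
        nlinarith
  obtain ⟨ε, hb, hε⟩ := hev.exists
  set b' := b + ε ^ 2
  have hgap : ∀ q, gap (-a / b', -(c + ε) / b') q = (a * q.1 + b' * q.2 + (c + ε)) / b' := by
    intro q; simp only [gap]; field_simp; ring
  have hiff : ∀ q ∈ S, a * q.1 + b * q.2 + c < 0 ↔ a * q.1 + b' * q.2 + (c + ε) < 0 :=
    fun q hq => ⟨(hε q hq).1, fun h => by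
      by_contra h'
      exact lt_asymm h ((hε q hq).2 (not_lt.1 h'))⟩
  refine ⟨(-a / b', -(c + ε) / b'), fun q hq => ?_, ?_⟩
  · rw [hgap]
    refine div_ne_zero (fun h0 => ?_) hb
    rcases lt_or_ge (a * q.1 + b * q.2 + c) 0 with h | h
    · exact ((hε q hq).1 h).ne h0
    · exact ((hε q hq).2 h).ne' h0
  · rcases lt_or_gt_of_ne hb with hb | hb
    · left
      intro q hq
      rw [hgap, hiff q hq, lt_div_iff_of_neg hb, zero_mul]
    · right
      intro q hq
      rw [hgap, hiff q hq, div_lt_iff₀ hb, zero_mul]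

open Classical in
/-- In a finite set of points of small halfplane depth some two points are separated by few
members, counted with weight, of a given family of halfplanes. -/
theorem exists_close_pair (S₀ S : Finset (ℝ × ℝ)) (hSS : S ⊆ S₀) (k : ℕ) (hk : 1 ≤ k)
    (hS2 : 1 < S.card)
    (hS : ∀ q ∈ S, ∃ a b c : ℝ, a * q.1 + b * q.2 + c < 0 ∧
      (S.filter fun p => a * p.1 + b * p.2 + c < 0).card ≤ k)
    (𝓕 : Finset (Finset (ℝ × ℝ)))
    (h𝓕 : ∀ A ∈ 𝓕, ∃ a b c : ℝ, A = S₀.filter fun p => a * p.1 + b * p.2 + c < 0)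
    (w : Finset (ℝ × ℝ) → ℕ) :
    ∃ p ∈ S, ∃ q ∈ S, p ≠ q ∧
      ((∑ A ∈ 𝓕 with ¬ (p ∈ A ↔ q ∈ A), w A : ℕ) : ℝ) * S.card ≤
        160000 * (∑ A ∈ 𝓕, w A : ℕ) * √k := by
  have hs1 : 1 ≤ √(k : ℝ) := Real.one_le_sqrt.2 (by exact_mod_cast hk)
  have hrep : ∀ A : Finset (ℝ × ℝ), ∃ ℓ : ℝ × ℝ, A ∈ 𝓕 → (∀ q ∈ S, gap ℓ q ≠ 0) ∧
      ∀ p ∈ S, ∀ q ∈ S, ¬ (p ∈ A ↔ q ∈ A) → gap ℓ p * gap ℓ q < 0 := by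
    intro A
    by_cases hA : A ∈ 𝓕
    · obtain ⟨a, b, c, rfl⟩ := h𝓕 A hA
      obtain ⟨ℓ, hℓ, h⟩ := exists_nonvertical_line S a b c
      refine ⟨ℓ, fun _ => ⟨hℓ, fun p hp q hq hpq => ?_⟩⟩
      simp only [Finset.mem_filter, hSS hp, hSS hq, true_and] at hpq
      have hp0 := lt_or_gt_of_ne (hℓ p hp)
      have hq0 := lt_or_gt_of_ne (hℓ q hq)
      have hmul : gap ℓ p * gap ℓ q < 0 ↔ _ := mul_neg_iff
      rcases h with h | h
      · rw [h p hp, h q hq] at hpq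
        grind
      · rw [h p hp, h q hq] at hpq
        grind
    · exact ⟨0, fun h => absurd h hA⟩
  choose L hL using hrep
  have hmono : ∀ p ∈ S, ∀ q ∈ S, (∑ A ∈ 𝓕 with ¬ (p ∈ A ↔ q ∈ A), w A) ≤
      ∑ A ∈ 𝓕 with gap (L A) p * gap (L A) q < 0, w A := by
    intro p hp q hq
    refine Finset.sum_le_sum_of_subset fun A hA => ?_
    rw [Finset.mem_filter] at hA ⊢
    exact ⟨hA.1, (hL A hA.1).2 p hp q hq hA.2⟩
  set U := S.filter fun q => ∃ g : ℝ × ℝ, 0 < gap g q ∧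
    (S.filter fun p => 0 ≤ gap g p).card ≤ k with hU
  set D := S.filter fun q => ∃ g : ℝ × ℝ, gap g q < 0 ∧
    (S.filter fun p => gap g p ≤ 0).card ≤ k with hD
  have hUD : S ⊆ U ∪ D := by
    intro q hq
    obtain ⟨a, b, c, hneg, hcard⟩ := hS q hq
    obtain ⟨ℓ, hℓ, h | h⟩ := exists_nonvertical_line S a b c
    · refine Finset.mem_union_left _ (Finset.mem_filter.2 ⟨hq, ℓ, (h q hq).1 hneg, ?_⟩)
      refine le_trans (Finset.card_le_card fun p hp => ?_) hcard
      rw [Finset.mem_filter] at hp ⊢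
      exact ⟨hp.1, (h p hp.1).2 (lt_of_le_of_ne hp.2 (hℓ p hp.1).symm)⟩
    · refine Finset.mem_union_right _ (Finset.mem_filter.2 ⟨hq, ℓ, (h q hq).1 hneg, ?_⟩)
      refine le_trans (Finset.card_le_card fun p hp => ?_) hcard
      rw [Finset.mem_filter] at hp ⊢
      exact ⟨hp.1, (h p hp.1).2 (lt_of_le_of_ne hp.2 (hℓ p hp.1))⟩
  have hcardUD : S.card ≤ U.card + D.card :=
    (Finset.card_le_card hUD).trans (Finset.card_union_le _ _)
  have hUS : U ⊆ S := Finset.filter_subset _ _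
  have hDS : D ⊆ S := Finset.filter_subset _ _
  by_cases hsmall : S.card ≤ 2
  · obtain ⟨p, hp, q, hq, hpq⟩ := Finset.one_lt_card.1 hS2
    refine ⟨p, hp, q, hq, hpq, ?_⟩
    have h1 : (∑ A ∈ 𝓕 with ¬ (p ∈ A ↔ q ∈ A), w A) ≤ ∑ A ∈ 𝓕, w A :=
      Finset.sum_le_sum_of_subset (Finset.filter_subset _ _)
    have h2 : (∑ A ∈ 𝓕 with ¬ (p ∈ A ↔ q ∈ A), w A) * S.card ≤ (∑ A ∈ 𝓕, w A) * 2 :=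
      Nat.mul_le_mul h1 hsmall
    have h3 : ((∑ A ∈ 𝓕 with ¬ (p ∈ A ↔ q ∈ A), w A : ℕ) : ℝ) * S.card ≤
      (∑ A ∈ 𝓕, w A : ℕ) * 2 := by exact_mod_cast h2
    have h4 : (0 : ℝ) ≤ (∑ A ∈ 𝓕, w A : ℕ) := Nat.cast_nonneg _
    have h5 := le_mul_of_one_le_right h4 hs1
    linarith
  have hfinish : ∀ Q ⊆ S, S.card ≤ 2 * Q.card → ∀ p ∈ Q, ∀ q ∈ Q,
      ((∑ A ∈ 𝓕 with gap (L A) p * gap (L A) q < 0, w A : ℕ) : ℝ) * Q.card ≤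
        80000 * (∑ A ∈ 𝓕, w A : ℕ) * √k →
      ((∑ A ∈ 𝓕 with ¬ (p ∈ A ↔ q ∈ A), w A : ℕ) : ℝ) * S.card ≤
        160000 * (∑ A ∈ 𝓕, w A : ℕ) * √k := by
    intro Q hQS hcard p hp q hq h
    have h1 : ((∑ A ∈ 𝓕 with ¬ (p ∈ A ↔ q ∈ A), w A : ℕ) : ℝ) ≤
        (∑ A ∈ 𝓕 with gap (L A) p * gap (L A) q < 0, w A : ℕ) := by
      exact_mod_cast hmono p (hQS hp) q (hQS hq)
    have h2 : (S.card : ℝ) ≤ 2 * Q.card := by exact_mod_cast hcard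
    have h3 := mul_le_mul h1 h2 (Nat.cast_nonneg _) (Nat.cast_nonneg _)
    linarith
  by_cases hcase : D.card ≤ U.card
  · obtain ⟨p, hp, q, hq, hpq, h⟩ := exists_close_pair_of_above U k hk (by omega)
      (by
        intro q hq
        obtain ⟨-, g, hg, hgk⟩ := Finset.mem_filter.1 hq
        exact ⟨g, hg, (Finset.card_le_card (Finset.filter_subset_filter _ hUS)).trans hgk⟩)
      𝓕 w L (fun A hA q hq => (hL A hA).1 q (hUS hq))
    exact ⟨p, hUS hp, q, hUS hq, hpq, hfinish U hUS (by omega) p hp q hq h⟩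
  · set r : ℝ × ℝ → ℝ × ℝ := fun p => (p.1, -p.2) with hr
    have hrinj : Function.Injective r := fun p q h => by
      simp only [hr, Prod.mk.injEq, neg_inj] at h
      exact Prod.ext h.1 h.2
    have hgr : ∀ ℓ p, gap (-ℓ) (r p) = -gap ℓ p := by
      intro ℓ p; simp only [gap, hr, Prod.fst_neg, Prod.snd_neg]; ring
    have hcardr : (D.image r).card = D.card := Finset.card_image_of_injective _ hrinj
    obtain ⟨p', hp', q', hq', hpq, h⟩ := exists_close_pair_of_above (D.image r) k hk (by omega)
      (by
        intro q' hq'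
        obtain ⟨q, hq, rfl⟩ := Finset.mem_image.1 hq'
        obtain ⟨-, g, hg, hgk⟩ := Finset.mem_filter.1 hq
        refine ⟨-g, by rw [hgr]; linarith, ?_⟩
        rw [Finset.filter_image, Finset.card_image_of_injective _ hrinj]
        refine le_trans (Finset.card_le_card fun p hp => ?_) hgk
        rw [Finset.mem_filter, hgr] at hp
        exact Finset.mem_filter.2 ⟨hDS hp.1, by linarith⟩)
      𝓕 w (fun A => -L A) (by
        intro A hA q' hq'
        obtain ⟨q, hq, rfl⟩ := Finset.mem_image.1 hq'
        rw [hgr]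
        exact neg_ne_zero.2 ((hL A hA).1 q (hDS hq)))
    obtain ⟨p, hp, rfl⟩ := Finset.mem_image.1 hp'
    obtain ⟨q, hq, rfl⟩ := Finset.mem_image.1 hq'
    simp only [hgr, neg_mul_neg, hcardr] at h
    exact ⟨p, hDS hp, q, hDS hq, fun h => hpq (congrArg r h),
      hfinish D hDS (by omega) p hp q hq h⟩

/-- Multiplicative reweighting: if every subset contains a pair separated by few members of `𝓕`,
counted with weight, then there is a connected set of edges crossed few times by every member. -/
lemma exists_low_crossing_edges {α : Type*} [DecidableEq α] (𝓕 : Finset (Finset α)) (γ : ℕ → ℝ)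
    (hγ : ∀ n, 0 ≤ γ n) (S₀ : Finset α)
    (hpair : ∀ S ⊆ S₀, 1 < S.card → ∀ w : Finset α → ℕ, ∃ p ∈ S, ∃ q ∈ S, p ≠ q ∧
      ((∑ A ∈ 𝓕 with ¬ (p ∈ A ↔ q ∈ A), w A : ℕ) : ℝ) ≤ γ S.card * (∑ A ∈ 𝓕, w A : ℕ)) :
    ∀ n, ∀ S ⊆ S₀, S.card = n + 1 → ∀ w : Finset α → ℕ, ∃ E : List (α × α),
      (∀ e ∈ E, e.1 ∈ S ∧ e.2 ∈ S) ∧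
      (∀ r : Setoid α, (∀ e ∈ E, r e.1 e.2) → ∀ x ∈ S, ∀ y ∈ S, r x y) ∧
      ((∑ A ∈ 𝓕, w A * 2 ^ E.countP (fun e => ¬ (e.1 ∈ A ↔ e.2 ∈ A)) : ℕ) : ℝ) ≤
        (∑ A ∈ 𝓕, w A : ℕ) * ∏ i ∈ Finset.range n, (1 + γ (i + 2)) := by
  intro n
  induction n with
  | zero =>
    intro S hS hcard w
    obtain ⟨a, rfl⟩ := Finset.card_eq_one.1 hcard
    refine ⟨[], by simp, fun r _ x hx y hy => ?_, by simp⟩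
    rw [Finset.mem_singleton.1 hx, Finset.mem_singleton.1 hy]
  | succ n ih =>
    intro S hS hcard w
    obtain ⟨p, hp, q, hq, hpq, hsep⟩ := hpair S hS (by omega) w
    obtain ⟨E, hE, hconn, hsum⟩ := ih (S.erase p) ((Finset.erase_subset _ _).trans hS)
      (by rw [Finset.card_erase_of_mem hp, hcard]; rfl)
      (fun A => w A * 2 ^ (if ¬ (p ∈ A ↔ q ∈ A) then 1 else 0))
    have hq' : q ∈ S.erase p := Finset.mem_erase.2 ⟨hpq.symm, hq⟩
    refine ⟨(p, q) :: E, ?_, ?_, ?_⟩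
    · intro e he
      rcases List.mem_cons.1 he with rfl | he
      · exact ⟨hp, hq⟩
      · exact ⟨Finset.mem_of_mem_erase (hE e he).1, Finset.mem_of_mem_erase (hE e he).2⟩
    · intro r hr
      have hto : ∀ x ∈ S, r x q := by
        intro x hx
        by_cases hxp : x = p
        · rw [hxp]; exact hr (p, q) List.mem_cons_self
        · exact hconn r (fun e he => hr e (List.mem_cons_of_mem _ he)) x
            (Finset.mem_erase.2 ⟨hxp, hx⟩) q hq'
      exact fun x hx y hy => r.trans (hto x hx) (r.symm (hto y hy))
    · have h1 : ∑ A ∈ 𝓕, w A * 2 ^ ((p, q) :: E).countP (fun e => ¬ (e.1 ∈ A ↔ e.2 ∈ A)) =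
          ∑ A ∈ 𝓕, w A * 2 ^ (if ¬ (p ∈ A ↔ q ∈ A) then 1 else 0) *
            2 ^ E.countP (fun e => ¬ (e.1 ∈ A ↔ e.2 ∈ A)) := by
        refine Finset.sum_congr rfl fun A _ => ?_
        rw [List.countP_cons, add_comm, pow_add, mul_assoc]
        simp only [decide_eq_true_eq]
      have h2 : ∑ A ∈ 𝓕, w A * 2 ^ (if ¬ (p ∈ A ↔ q ∈ A) then 1 else 0) =
          ∑ A ∈ 𝓕, w A + ∑ A ∈ 𝓕 with ¬ (p ∈ A ↔ q ∈ A), w A := by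
        rw [Finset.sum_filter, ← Finset.sum_add_distrib]
        refine Finset.sum_congr rfl fun A _ => ?_
        split_ifs <;> ring
      rw [h1]
      refine hsum.trans ?_
      rw [h2, Finset.prod_range_succ, mul_comm (∏ i ∈ Finset.range n, _), ← mul_assoc]
      refine mul_le_mul_of_nonneg_right ?_
        (Finset.prod_nonneg fun i _ => by have := hγ (i + 2); linarith)
      rw [hcard] at hsep
      push_cast at hsep ⊢
      linarith

/-- A connected set of edges on a finite vertex set contains a spanning tree. -/
lemma exists_isTree_of_edges {α : Type*} [DecidableEq α] (φ : α → Prop) (S : Finset α)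
    (hS : ∀ x, x ∈ S ↔ φ x) (hne : S.Nonempty) (E : List (α × α))
    (hE : ∀ e ∈ E, e.1 ∈ S ∧ e.2 ∈ S)
    (hconn : ∀ r : Setoid α, (∀ e ∈ E, r e.1 e.2) → ∀ x ∈ S, ∀ y ∈ S, r x y) :
    ∃ T : SimpleGraph {x // φ x}, T.IsTree ∧ ∀ A : Finset α,
      {e : Sym2 {x // φ x} | e ∈ T.edgeSet ∧ ∃ u v, e = s(u, v) ∧ u.1 ∈ A ∧ v.1 ∉ A}.ncard ≤
        E.countP (fun e => ¬ (e.1 ∈ A ↔ e.2 ∈ A)) := by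
  have : Finite {x // φ x} := Set.Finite.subset S.finite_toSet fun x hx => (hS x).2 hx
  set G : SimpleGraph {x // φ x} := SimpleGraph.fromRel fun u v => (u.1, v.1) ∈ E with hG
  have hpre : G.Preconnected := by
    intro u v
    let r : Setoid α :=
      { r := fun x y => (φ x ↔ φ y) ∧ ∀ hx hy, G.Reachable ⟨x, hx⟩ ⟨y, hy⟩
        iseqv :=
          { refl := fun x => ⟨Iff.rfl, fun _ _ => SimpleGraph.Reachable.refl _⟩
            symm := fun h => ⟨h.1.symm, fun hx hy => (h.2 hy hx).symm⟩
            trans := fun h h' => ⟨h.1.trans h'.1, fun hx hy =>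
              (h.2 hx (h.1.1 hx)).trans (h'.2 (h.1.1 hx) hy)⟩ } }
    refine (hconn r (fun e he => ?_) u ((hS _).2 u.2) v ((hS _).2 v.2)).2 u.2 v.2
    have h1 := (hS _).1 (hE e he).1
    have h2 := (hS _).1 (hE e he).2
    refine ⟨⟨fun _ => h2, fun _ => h1⟩, fun hx hy => ?_⟩
    by_cases heq : e.1 = e.2
    · have : (⟨e.1, hx⟩ : {x // φ x}) = ⟨e.2, hy⟩ := Subtype.ext heq
      rw [this]
    · refine SimpleGraph.Adj.reachable ?_
      rw [hG, SimpleGraph.fromRel_adj]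
      exact ⟨fun h => heq (congrArg Subtype.val h), Or.inl he⟩
  obtain ⟨x₀, hx₀⟩ := hne
  have : Nonempty {x // φ x} := ⟨⟨x₀, (hS _).1 hx₀⟩⟩
  obtain ⟨T, hTG, hT⟩ := (SimpleGraph.Connected.mk hpre).exists_isTree_le
  refine ⟨T, hT, fun A => ?_⟩
  rw [← Set.ncard_image_of_injective _ (Sym2.map.injective Subtype.val_injective),
    List.countP_eq_length_filter]
  set E' := E.filter fun e => ¬ (e.1 ∈ A ↔ e.2 ∈ A) with hE'
  calc _ ≤ ((E'.map fun e => s(e.1, e.2)).toFinset : Set (Sym2 α)).ncard := by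
        refine Set.ncard_le_ncard ?_ (Finset.finite_toSet _)
        rintro _ ⟨e, ⟨heT, u, v, rfl, hu, hv⟩, rfl⟩
        have hadj : G.Adj u v := hTG heT
        rw [hG, SimpleGraph.fromRel_adj] at hadj
        simp only [Sym2.map_mk, Finset.mem_coe, List.mem_toFinset, List.mem_map]
        rcases hadj.2 with h | h
        · exact ⟨(u.1, v.1), by simp [hE', h, hu, hv], rfl⟩
        · exact ⟨(v.1, u.1), by simp [hE', h, hu, hv], Sym2.eq_swap⟩
    _ = (E'.map fun e => s(e.1, e.2)).toFinset.card := Set.ncard_coe_finset _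
    _ ≤ (E'.map fun e => s(e.1, e.2)).length := List.toFinset_card_le _
    _ = E'.length := List.length_map _

/-- Open halfplanes shatter no four points. -/
lemma card_le_three_of_shatters (T : Finset (ℝ × ℝ))
    (hT : ∀ t ⊆ T, ∃ a b c : ℝ, ∀ p ∈ T, p ∈ t ↔ a * p.1 + b * p.2 + c < 0) : T.card ≤ 3 := by
  classical
  by_contra! hcard
  have hdep : ¬ AffineIndependent ℝ (fun x : T => (x : ℝ × ℝ)) := by
    intro h
    have h1 := h.card_le_finrank_succ
    have h2 : Module.finrank ℝ (vectorSpan ℝ (Set.range fun x : T => (x : ℝ × ℝ))) ≤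
        Module.finrank ℝ (ℝ × ℝ) := Submodule.finrank_le _
    rw [Module.finrank_prod, Module.finrank_self] at h2
    rw [Fintype.card_coe] at h1
    omega
  obtain ⟨I, x, hx, hx'⟩ := Convex.radon_partition hdep
  obtain ⟨a, b, c, h⟩ := hT (T.filter fun p => ∃ hp : p ∈ T, (⟨p, hp⟩ : T) ∈ I)
    (Finset.filter_subset _ _)
  have hlin : IsLinearMap ℝ fun p : ℝ × ℝ => a * p.1 + b * p.2 := by
    constructor
    · intro p q; simp only [Prod.fst_add, Prod.snd_add]; ring
    · intro r p; simp only [Prod.smul_fst, Prod.smul_snd, smul_eq_mul]; ring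
  have h1 : a * x.1 + b * x.2 < -c := by
    refine convexHull_min (?_ : _ ⊆ {p : ℝ × ℝ | a * p.1 + b * p.2 < -c})
      (convex_halfSpace_lt hlin _) hx
    rintro _ ⟨y, hy, rfl⟩
    have := (h y y.2).1 (Finset.mem_filter.2 ⟨y.2, y.2, hy⟩)
    rw [Set.mem_ofPred_eq]; linarith
  have h2 : -c ≤ a * x.1 + b * x.2 := by
    refine convexHull_min (?_ : _ ⊆ {p : ℝ × ℝ | -c ≤ a * p.1 + b * p.2})
      (convex_halfSpace_ge hlin _) hx'
    rintro _ ⟨y, hy, rfl⟩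
    rw [Set.mem_ofPred_eq]
    by_contra! hlt
    obtain ⟨-, _, hmem⟩ := Finset.mem_filter.1 ((h y y.2).2 (by linarith))
    exact hy hmem
  linarith

lemma card_halfplane_cuts_le (S : Finset (ℝ × ℝ)) (𝓕 : Finset (Finset (ℝ × ℝ)))
    (h𝓕 : ∀ A ∈ 𝓕, ∃ a b c : ℝ, ∀ p, p ∈ A ↔ p ∈ S ∧ a * p.1 + b * p.2 + c < 0) :
    𝓕.card ≤ (S.card + 1) ^ 3 := by
  classical
  have hsub : 𝓕.shatterer ⊆ (Finset.range 4).biUnion fun j => S.powersetCard j := by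
    intro T hT
    rw [Finset.mem_shatterer] at hT
    have hTS : T ⊆ S := by
      obtain ⟨A, hA, hTA⟩ := hT (Finset.Subset.refl T)
      obtain ⟨a, b, c, h⟩ := h𝓕 A hA
      exact fun p hp => ((h p).1 (Finset.inter_eq_left.1 hTA hp)).1
    have hcard := card_le_three_of_shatters T fun t ht => by
      obtain ⟨A, hA, hTA⟩ := hT ht
      obtain ⟨a, b, c, h⟩ := h𝓕 A hA
      refine ⟨a, b, c, fun p hp => ?_⟩
      rw [← hTA, Finset.mem_inter, h p]
      exact ⟨fun h => h.2.2, fun h => ⟨hp, hTS hp, h⟩⟩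
    exact Finset.mem_biUnion.2 ⟨T.card, Finset.mem_range.2 (by omega),
      Finset.mem_powersetCard.2 ⟨hTS, rfl⟩⟩
  calc 𝓕.card ≤ 𝓕.shatterer.card := 𝓕.card_le_card_shatterer
    _ ≤ _ := Finset.card_le_card hsub
    _ ≤ ∑ j ∈ Finset.range 4, (S.powersetCard j).card := Finset.card_biUnion_le
    _ ≤ ∑ j ∈ Finset.range 4, S.card ^ j := Finset.sum_le_sum fun j _ => by
        rw [Finset.card_powersetCard]; exact Nat.choose_le_pow _ _
    _ ≤ (S.card + 1) ^ 3 := by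
        simp only [Finset.sum_range_succ, Finset.sum_range_zero]
        nlinarith

lemma sum_sqrt_min_div_le {k : ℕ} (hk : 1 ≤ k) {m N : ℕ} (hmN : m ≤ N) (hkN : k ≤ N) :
    ∑ i ∈ Finset.range m, √((min (i + 1) k : ℕ) : ℝ) / ((i + 1 : ℕ) : ℝ) ≤
      2 * √k + √k * Real.log (N / k) := by
  have hk0 : (0 : ℝ) < k := by exact_mod_cast hk
  have hsmall : ∀ m : ℕ, ∑ i ∈ Finset.range m, √((min (i + 1) k : ℕ) : ℝ) / ((i + 1 : ℕ) : ℝ) ≤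
      2 * √m := by
    intro m
    induction m with
    | zero => simp
    | succ m ih =>
      rw [Finset.sum_range_succ]
      have h1 : √((min (m + 1) k : ℕ) : ℝ) ≤ √((m + 1 : ℕ) : ℝ) :=
        Real.sqrt_le_sqrt (by exact_mod_cast min_le_left _ _)
      set s := √((m + 1 : ℕ) : ℝ) with hs
      have hs0 : 0 < s := Real.sqrt_pos.2 (by positivity)
      have hss : s * s = ((m + 1 : ℕ) : ℝ) := Real.mul_self_sqrt (by positivity)
      have htt : √(m : ℝ) * √(m : ℝ) = m := Real.mul_self_sqrt (by positivity)
      have h2 : √((min (m + 1) k : ℕ) : ℝ) / ((m + 1 : ℕ) : ℝ) ≤ 1 / s := by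
        rw [div_le_div_iff₀ (by positivity) hs0, one_mul, ← hss]
        exact mul_le_mul_of_nonneg_right h1 hs0.le
      have h3 : 1 / s ≤ 2 * s - 2 * √(m : ℝ) := by
        rw [div_le_iff₀ hs0]
        push_cast at hss
        nlinarith [sq_nonneg (s - √(m : ℝ))]
      linarith
  have hlarge : ∀ j : ℕ, ∑ i ∈ Finset.range (k + j),
      √((min (i + 1) k : ℕ) : ℝ) / ((i + 1 : ℕ) : ℝ) ≤
        2 * √k + √k * Real.log ((k + j : ℕ) / k) := by
    intro j
    induction j with
    | zero => simpa [div_self hk0.ne'] using hsmall k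
    | succ j ih =>
      rw [← add_assoc, Finset.sum_range_succ, min_eq_right (by omega)]
      have hx : (0 : ℝ) < (k + j : ℕ) := by positivity
      have h1 : 1 / ((k + j + 1 : ℕ) : ℝ) ≤
          Real.log ((k + j + 1 : ℕ) / k) - Real.log ((k + j : ℕ) / k) := by
        rw [Real.log_div (by positivity) hk0.ne', Real.log_div hx.ne' hk0.ne']
        have := Real.one_sub_inv_le_log_of_pos
          (x := ((k + j + 1 : ℕ) : ℝ) / (k + j : ℕ)) (by positivity)
        rw [Real.log_div (by positivity) hx.ne'] at this
        have h2 : 1 - (((k + j + 1 : ℕ) : ℝ) / (k + j : ℕ))⁻¹ = 1 / ((k + j + 1 : ℕ) : ℝ) := by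
          rw [inv_div]
          push_cast at hx ⊢
          field_simp
          ring
        linarith
      have h2 := mul_le_mul_of_nonneg_left h1 (Real.sqrt_nonneg (k : ℝ))
      rw [div_eq_mul_one_div]
      linarith
  have hlogN : ∀ m : ℕ, 0 < m → m ≤ N → Real.log (m / k) ≤ Real.log (N / k) := fun m hm hmN =>
    Real.log_le_log (div_pos (by exact_mod_cast hm) hk0)
      (div_le_div_of_nonneg_right (by exact_mod_cast hmN) hk0.le)
  rcases le_total m k with h | h
  · refine (hsmall m).trans ?_
    have h1 : √(m : ℝ) ≤ √k := Real.sqrt_le_sqrt (by exact_mod_cast h)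
    have h2 : 0 ≤ Real.log (N / k : ℝ) :=
      Real.log_nonneg ((one_le_div hk0).2 (by exact_mod_cast hkN))
    have h3 := mul_nonneg (Real.sqrt_nonneg (k : ℝ)) h2
    linarith
  · obtain ⟨j, rfl⟩ := Nat.exists_eq_add_of_le h
    refine (hlarge j).trans ?_
    have := mul_le_mul_of_nonneg_left (hlogN (k + j) (by omega) hmN) (Real.sqrt_nonneg (k : ℝ))
    linarith

lemma crossing_number_le {k : ℕ} (hk : 1 ≤ k) {n N x : ℕ} (hnN : n + 1 ≤ N) (hkN : k ≤ N)
    (h : (2 : ℝ) ^ x ≤ (n + 2 : ℝ) ^ 3 * ∏ i ∈ Finset.range n,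
      (1 + 160000 * (√((min (i + 2) k : ℕ) : ℝ) / ((i + 2 : ℕ) : ℝ)))) :
    (x : ℝ) ≤ 2000000 * √k * Real.log (2 * N / k) := by
  have hk0 : (0 : ℝ) < k := by exact_mod_cast hk
  have hkN' : (k : ℝ) ≤ N := by exact_mod_cast hkN
  have hN0 : (0 : ℝ) < N := by linarith
  have hs1 : 1 ≤ √(k : ℝ) := Real.one_le_sqrt.2 (by exact_mod_cast hk)
  set γ : ℕ → ℝ := fun i => √((min (i + 1) k : ℕ) : ℝ) / ((i + 1 : ℕ) : ℝ) with hγ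
  have hγ0 : ∀ i, 0 ≤ γ i := fun i => by positivity
  set s := √(k : ℝ) with hs
  set T := Real.log (2 * N / k) with hT
  have hlog2 : (1 / 2 : ℝ) ≤ Real.log 2 := by have := Real.log_two_gt_d9; linarith
  have hTeq : T = Real.log 2 + Real.log (N / k) := by
    rw [hT, mul_div_assoc, Real.log_mul (by norm_num) (by positivity)]
  have hlogN : 0 ≤ Real.log (N / k : ℝ) := Real.log_nonneg ((one_le_div hk0).2 hkN')
  have hprod : ∏ i ∈ Finset.range n, (1 + 160000 * γ (i + 1)) ≤
      Real.exp (160000 * ∑ i ∈ Finset.range n, γ (i + 1)) := by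
    rw [Finset.mul_sum, Real.exp_sum]
    refine Finset.prod_le_prod (fun i _ => by have := hγ0 (i + 1); linarith) fun i _ => ?_
    rw [add_comm]; exact Real.add_one_le_exp _
  have hsum : ∑ i ∈ Finset.range n, γ (i + 1) ≤ 2 * s + s * Real.log (N / k) := by
    have h1 := sum_sqrt_min_div_le hk hnN hkN
    rw [Finset.sum_range_succ'] at h1
    have := hγ0 0
    exact (le_add_of_nonneg_right this).trans h1
  have h2 : (2 : ℝ) ^ x ≤ (2 * N) ^ 3 * Real.exp (160000 * (2 * s + s * Real.log (N / k))) := by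
    refine h.trans (mul_le_mul ?_ (hprod.trans ?_) ?_ (by positivity))
    · have : (n + 1 : ℝ) ≤ N := by exact_mod_cast hnN
      have h3 : (0 : ℝ) ≤ n := Nat.cast_nonneg n
      exact pow_le_pow_left₀ (by positivity) (by linarith) 3
    · exact Real.exp_le_exp.2 (by linarith)
    · exact Finset.prod_nonneg fun i _ => by have := hγ0 (i + 1); positivity
  have h3 := Real.log_le_log (by positivity) h2
  rw [Real.log_pow, Real.log_mul (by positivity) (Real.exp_pos _).ne', Real.log_exp,
    Real.log_pow] at h3
  have h4 : Real.log (2 * N) = T + 2 * Real.log s := by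
    have : (k : ℝ) = s ^ 2 := (Real.sq_sqrt hk0.le).symm
    have hlk : Real.log k = 2 * Real.log s := by rw [this, Real.log_pow]; norm_num
    rw [hT, Real.log_div (by positivity) hk0.ne', hlk]; ring
  have h5 : Real.log s ≤ s := (Real.log_le_sub_one_of_pos (by linarith)).trans (by linarith)
  have hT2 : 1 / 2 ≤ T := by linarith
  have h6 : s * (1 / 2) ≤ s * T := mul_le_mul_of_nonneg_left hT2 (by linarith)
  have h7 : T ≤ s * T := le_mul_of_one_le_left (by linarith) hs1
  have h8 : s * Real.log (N / k) ≤ s * T := mul_le_mul_of_nonneg_left (by linarith) (by linarith)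
  have h9 : (x : ℝ) * (1 / 2) ≤ x * Real.log 2 :=
    mul_le_mul_of_nonneg_left hlog2 (Nat.cast_nonneg x)
  push_cast at h3
  rw [h4] at h3
  linarith

open Classical in
lemma exists_shallow_halfplane {P : Finset (ℝ × ℝ)} {k : ℕ} {p : ℝ × ℝ} (hp : p ∉ Dk P k) :
    ∃ a b c : ℝ, a * p.1 + b * p.2 + c < 0 ∧
      (P.filter fun q => a * q.1 + b * q.2 + c < 0).card ≤ k := by
  simp only [Dk, Set.mem_sInter, not_forall] at hp
  obtain ⟨H, ⟨⟨a, b, c, -, rfl⟩, hcard⟩, hpH⟩ := hp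
  refine ⟨a, b, c, by simpa using hpH, ?_⟩
  have h1 : ((P : Set (ℝ × ℝ)) ∩ {x : ℝ × ℝ | 0 ≤ a * x.1 + b * x.2 + c}) =
      (P.filter fun q => ¬ a * q.1 + b * q.2 + c < 0 : Finset (ℝ × ℝ)) := by
    ext q; simp
  rw [h1, Set.ncard_coe_finset] at hcard
  have := P.card_filter_add_card_filter_not fun q => a * q.1 + b * q.2 + c < 0
  omega

/-- There is a spanning tree on `P \ Dk(P)` such that each line crosses at most
`C·√k·log(2n/k)` of its edges. -/
theorem spanning_tree_outside_Dk :
    ∃ C : ℝ, 0 < C ∧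
      ∀ (P : Finset (ℝ × ℝ)) (k : ℕ), 1 ≤ k → k ≤ P.card →
        (∃ p ∈ P, p ∉ Dk P k) →
        ∃ T : SimpleGraph {p : ℝ × ℝ // p ∈ P ∧ p ∉ Dk P k},
          T.IsTree ∧
          ∀ a b c : ℝ, (a, b) ≠ (0, 0) →
            (({e : Sym2 {p : ℝ × ℝ // p ∈ P ∧ p ∉ Dk P k} |
                e ∈ T.edgeSet ∧ ∃ u v, e = s(u, v) ∧
                  a * u.1.1 + b * u.1.2 + c < 0 ∧
                  0 < a * v.1.1 + b * v.1.2 + c}).ncard : ℝ)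
              ≤ C * Real.sqrt (k : ℝ) * Real.log (2 * (P.card : ℝ) / (k : ℝ)) := by
  classical
  refine ⟨2000000, by norm_num, fun P k hk hkP hex => ?_⟩
  set S := P.filter fun p => p ∉ Dk P k with hS
  have hSmem : ∀ p, p ∈ S ↔ p ∈ P ∧ p ∉ Dk P k := fun p => Finset.mem_filter
  obtain ⟨p₀, hp₀, hp₀'⟩ := hex
  have hne : S.Nonempty := ⟨p₀, (hSmem _).2 ⟨hp₀, hp₀'⟩⟩
  set 𝓕 := S.powerset.filter fun A => ∃ a b c : ℝ,
    A = S.filter fun p => a * p.1 + b * p.2 + c < 0 with h𝓕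
  have h𝓕mem : ∀ A ∈ 𝓕, ∃ a b c : ℝ, A = S.filter fun p => a * p.1 + b * p.2 + c < 0 :=
    fun A hA => (Finset.mem_filter.1 hA).2
  set γ : ℕ → ℝ := fun i => 160000 * (√((min i k : ℕ) : ℝ) / (i : ℝ)) with hγ
  have hpair : ∀ S' ⊆ S, 1 < S'.card → ∀ w : Finset (ℝ × ℝ) → ℕ, ∃ p ∈ S', ∃ q ∈ S', p ≠ q ∧
      ((∑ A ∈ 𝓕 with ¬ (p ∈ A ↔ q ∈ A), w A : ℕ) : ℝ) ≤ γ S'.card * (∑ A ∈ 𝓕, w A : ℕ) := by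
    intro S' hS' hcard w
    obtain ⟨p, hp, q, hq, hpq, h⟩ := exists_close_pair S S' hS' (min S'.card k)
      (le_min hcard.le hk) hcard (fun q hq => by
        obtain ⟨a, b, c, hneg, hle⟩ := exists_shallow_halfplane ((hSmem q).1 (hS' hq)).2
        refine ⟨a, b, c, hneg, le_min (Finset.card_filter_le _ _) ?_⟩
        exact (Finset.card_le_card (Finset.filter_subset_filter _
          (hS'.trans (Finset.filter_subset _ _)))).trans hle) 𝓕 h𝓕mem w
    refine ⟨p, hp, q, hq, hpq, ?_⟩
    have h0 : (0 : ℝ) < S'.card := by exact_mod_cast (by omega : 0 < S'.card)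
    rw [← le_div_iff₀ h0] at h
    refine h.trans_eq ?_
    rw [hγ]; ring
  obtain ⟨n, hn⟩ := Nat.exists_eq_add_of_lt (Finset.card_pos.2 hne)
  rw [zero_add] at hn
  obtain ⟨E, hE, hconn, hsum⟩ := exists_low_crossing_edges 𝓕 γ (fun n => by positivity) S hpair n S
    (Finset.Subset.refl S) hn (fun _ => 1)
  obtain ⟨T, hT, hcross⟩ := exists_isTree_of_edges (fun p => p ∈ P ∧ p ∉ Dk P k) S hSmem hne E hE
    hconn
  refine ⟨T, hT, fun a b c _ => ?_⟩
  set A := S.filter fun p => a * p.1 + b * p.2 + c < 0 with hA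
  have hA𝓕 : A ∈ 𝓕 := Finset.mem_filter.2
    ⟨Finset.mem_powerset.2 (Finset.filter_subset _ _), a, b, c, rfl⟩
  have hncard : {e : Sym2 {p : ℝ × ℝ // p ∈ P ∧ p ∉ Dk P k} |
      e ∈ T.edgeSet ∧ ∃ u v, e = s(u, v) ∧
        a * u.1.1 + b * u.1.2 + c < 0 ∧ 0 < a * v.1.1 + b * v.1.2 + c}.ncard ≤
      E.countP (fun e => ¬ (e.1 ∈ A ↔ e.2 ∈ A)) := by
    have : Finite {p : ℝ × ℝ // p ∈ P ∧ p ∉ Dk P k} :=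
      Set.Finite.subset S.finite_toSet fun x hx => (hSmem x).2 hx
    refine le_trans (Set.ncard_le_ncard ?_ (Set.toFinite _)) (hcross A)
    rintro e ⟨he, u, v, rfl, hu, hv⟩
    refine ⟨he, u, v, rfl, Finset.mem_filter.2 ⟨(hSmem _).2 u.2, hu⟩, fun hv' => ?_⟩
    exact lt_asymm hv (Finset.mem_filter.1 hv').2
  refine le_trans (Nat.cast_le.2 hncard) (crossing_number_le (n := n) hk ?_ hkP ?_)
  · rw [← hn]; exact Finset.card_le_card (Finset.filter_subset _ _)
  · have h1 : 2 ^ E.countP (fun e => ¬ (e.1 ∈ A ↔ e.2 ∈ A)) ≤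
        ∑ A ∈ 𝓕, 1 * 2 ^ E.countP (fun e => ¬ (e.1 ∈ A ↔ e.2 ∈ A)) := by
      simp only [one_mul]
      exact Finset.single_le_sum
        (f := fun A => 2 ^ E.countP (fun e => ¬ (e.1 ∈ A ↔ e.2 ∈ A)))
        (fun _ _ => Nat.zero_le _) hA𝓕
    have h2 : 𝓕.card ≤ (n + 2) ^ 3 := by
      have := card_halfplane_cuts_le S 𝓕 fun A hA => by
        obtain ⟨a, b, c, rfl⟩ := h𝓕mem A hA
        exact ⟨a, b, c, fun p => Finset.mem_filter⟩
      rwa [hn] at this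
    have h3 : (2 : ℝ) ^ E.countP (fun e => ¬ (e.1 ∈ A ↔ e.2 ∈ A)) ≤ _ :=
      le_trans (by exact_mod_cast h1) hsum
    refine h3.trans (mul_le_mul_of_nonneg_right ?_ (Finset.prod_nonneg fun i _ => by positivity))
    simp only [Finset.sum_const, smul_eq_mul, mul_one]
    exact_mod_cast h2
end

section
/- There is an absolute constant C > 0 with the following property. For every finite set P of n ≥ 2 points in ℝ², there exists a spanning tree T of P (a connected acyclic graph with vertex set P, edges realized as straight segments) such that every line ℓ in ℝ² with weight w_ℓ ≥ 1 with respect to P crosses at most C·√(w_ℓ)·log(2n/w_ℓ) edges of T. -/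
/-- The weight of the line `{x | a·x₁ + b·x₂ + c = 0}` with respect to `P`:
the smaller of the numbers of points of `P` in the two open halfplanes. -/
noncomputable def lineWeight (P : Finset (ℝ × ℝ)) (a b c : ℝ) : ℕ :=
  min (((↑P : Set (ℝ × ℝ)) ∩ {x | 0 < a * x.1 + b * x.2 + c}).ncard)
      (((↑P : Set (ℝ × ℝ)) ∩ {x | a * x.1 + b * x.2 + c < 0}).ncard)

namespace RelativeCrossing

open Finset

/-- Weighted form of Haussler's bound on the number of edges of the unit distance graph of a set
family which shatters no set of `d + 1` elements. -/
theorem sum_min_le_mul_sum {α : Type*} [DecidableEq α] (U : Finset α) :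
    ∀ (d : ℕ) (w : Finset α → ℕ),
      (∀ T ⊆ U, T.card = d + 1 → ∃ T' ⊆ T, ∀ z ⊆ U, z ∩ T = T' → w z = 0) →
      ∑ x ∈ U, ∑ z ∈ (U.erase x).powerset, min (w z) (w (insert x z)) ≤
        d * ∑ z ∈ U.powerset, w z := by
  induction U using Finset.induction_on with
  | empty => intro d w _; simp
  | insert x U hx ih =>
    intro d w hw
    rcases d with _ | d
    · rw [zero_mul, Nat.le_zero]
      refine Finset.sum_eq_zero fun y hy => Finset.sum_eq_zero fun z hz => ?_
      obtain ⟨T', hT', h⟩ := hw {y} (by simpa using hy) (by simp)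
      rw [mem_powerset, subset_erase] at hz
      rcases Finset.subset_singleton_iff.1 hT' with rfl | rfl
      · rw [h z hz.1 (by simp [hz.2])]; simp
      · rw [h (insert y z) (insert_subset hy hz.1) (by ext; simp)]; simp
    · have h1 := ih (d + 1) (fun z => max (w z) (w (insert x z))) (by
        intro T hT hc
        obtain ⟨T', hT', h⟩ := hw T (hT.trans (subset_insert _ _)) hc
        refine ⟨T', hT', fun z hz hzT => ?_⟩
        rw [h z (hz.trans (subset_insert _ _)) hzT, h (insert x z) (insert_subset_insert _ hz)]
        · simp
        · rw [insert_inter_of_notMem (fun h => hx (hT h)), hzT])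
      have h2 := ih d (fun z => min (w z) (w (insert x z))) (by
        intro T hT hc
        have hxT : x ∉ T := fun h => hx (hT h)
        obtain ⟨T', hT', h⟩ := hw (insert x T) (insert_subset_insert _ hT)
          (by rw [card_insert_of_notMem hxT, hc])
        refine ⟨T'.erase x, by rw [← subset_insert_iff]; exact hT', fun z hz hzT => ?_⟩
        have hxz : x ∉ z := fun h => hx (hz h)
        by_cases hxT' : x ∈ T'
        · rw [h (insert x z) (insert_subset_insert _ hz)]
          · simp
          · rw [← insert_inter_distrib, hzT, insert_erase hxT']
        · rw [h z (hz.trans (subset_insert _ _))]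
          · simp
          · rw [inter_insert_of_notMem hxz, hzT, erase_eq_of_notMem hxT'])
      rw [sum_insert hx, erase_insert hx, sum_powerset_insert hx, ← sum_add_distrib]
      have key : ∑ y ∈ U, ∑ z ∈ ((insert x U).erase y).powerset, min (w z) (w (insert y z)) ≤
          ∑ y ∈ U, ∑ z ∈ (U.erase y).powerset,
              min (max (w z) (w (insert x z)))
                (max (w (insert y z)) (w (insert x (insert y z)))) +
          ∑ y ∈ U, ∑ z ∈ (U.erase y).powerset,
              min (min (w z) (w (insert x z)))
                (min (w (insert y z)) (w (insert x (insert y z)))) := by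
        rw [← sum_add_distrib]
        refine sum_le_sum fun y hy => ?_
        have hxy : x ≠ y := fun h => hx (h ▸ hy)
        rw [erase_insert_of_ne hxy, sum_powerset_insert (fun h => hx (mem_of_mem_erase h)),
          ← sum_add_distrib, ← sum_add_distrib]
        refine sum_le_sum fun z _ => ?_
        rw [insert_comm y x z]
        omega
      have e : ∑ z ∈ U.powerset, (w z + w (insert x z)) =
          ∑ z ∈ U.powerset, max (w z) (w (insert x z)) +
          ∑ z ∈ U.powerset, min (w z) (w (insert x z)) := by
        rw [← sum_add_distrib]
        exact sum_congr rfl fun z _ => by omega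
      rw [e]
      linarith

/-- Resampling one coordinate of a product distribution does not change expectations. -/
theorem le_sum_prod_mul_of_update {ι κ : Type*} [Fintype ι] [Fintype κ] [DecidableEq κ]
    (μ : ι → ℝ) (hμ : ∀ A, 0 ≤ μ A) (h1 : ∑ A, μ A = 1) (i : κ) (X : (κ → ι) → ℝ) (c : ℝ)
    (h : ∀ a, c ≤ ∑ A, μ A * X (Function.update a i A)) :
    c ≤ ∑ a : κ → ι, (∏ j, μ (a j)) * X a := by
  classical
  have htot : ∑ a : κ → ι, ∏ j, μ (a j) = 1 := by
    have := Finset.prod_univ_sum (fun _ : κ => (univ : Finset ι)) (fun _ A => μ A)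
    simpa [h1] using this.symm
  let e : Equiv.Perm ((κ → ι) × ι) := Function.Involutive.toPerm
    (fun q => (Function.update q.1 i q.2, q.1 i)) (fun q => by simp)
  have hM : ∀ (a : κ → ι) (A : ι), (∏ j, μ (a j)) * μ A =
      (∏ j, μ (Function.update a i A j)) * μ (a i) := by
    intro a A
    rw [← Finset.mul_prod_erase univ _ (mem_univ i),
      ← Finset.mul_prod_erase univ (fun j => μ (Function.update a i A j)) (mem_univ i)]
    have : ∏ j ∈ univ.erase i, μ (Function.update a i A j) = ∏ j ∈ univ.erase i, μ (a j) :=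
      prod_congr rfl fun j hj => by rw [Function.update_of_ne (ne_of_mem_erase hj)]
    rw [this, Function.update_self]; ring
  calc c = ∑ a : κ → ι, (∏ j, μ (a j)) * c := by rw [← sum_mul, htot, one_mul]
    _ ≤ ∑ a : κ → ι, (∏ j, μ (a j)) * ∑ A, μ A * X (Function.update a i A) :=
        sum_le_sum fun a _ => mul_le_mul_of_nonneg_left (h a) (prod_nonneg fun j _ => hμ _)
    _ = ∑ q : (κ → ι) × ι, (∏ j, μ (q.1 j)) * μ q.2 * X (Function.update q.1 i q.2) := by
        rw [Fintype.sum_prod_type]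
        refine sum_congr rfl fun a _ => ?_
        rw [mul_sum]
        exact sum_congr rfl fun A _ => by ring
    _ = ∑ q : (κ → ι) × ι, (∏ j, μ (q.1 j)) * μ q.2 * X q.1 := by
        rw [← Equiv.sum_comp e]
        refine sum_congr rfl fun q _ => ?_
        obtain ⟨a, A⟩ := q
        have he : e (a, A) = (Function.update a i A, a i) := rfl
        rw [hM a A, he]
        simp
    _ = ∑ a : κ → ι, (∏ j, μ (a j)) * X a := by
        rw [Fintype.sum_prod_type]
        refine sum_congr rfl fun a _ => ?_
        dsimp only
        rw [← sum_mul, ← mul_sum, h1, mul_one]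

/-- A crude form of the Sauer–Shelah lemma. -/
theorem card_le_pow_of_not_shatters {α : Type*} [DecidableEq α] (𝒜 : Finset (Finset α))
    (U : Finset α) (hU : ∀ A ∈ 𝒜, A ⊆ U) (d : ℕ)
    (h : ∀ T ⊆ U, T.card = d + 1 → ¬ 𝒜.Shatters T) : 𝒜.card ≤ (U.card + 1) ^ d := by
  have hsub : 𝒜.shatterer ⊆ (range (d + 1)).biUnion (fun k => powersetCard k U) := by
    intro T hT
    rw [mem_shatterer] at hT
    obtain ⟨A, hA, hTA⟩ := hT.exists_superset
    have hTU := hTA.trans (hU A hA)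
    simp only [mem_biUnion, mem_range, mem_powersetCard]
    refine ⟨T.card, ?_, hTU, rfl⟩
    by_contra! hc
    obtain ⟨T', hT', hc'⟩ := exists_subset_card_eq hc
    exact h T' (hT'.trans hTU) hc' (hT.mono_right hT')
  have hpow : ∀ e : ℕ, ∑ k ∈ range (e + 1), U.card ^ k ≤ (U.card + 1) ^ e := by
    intro e
    induction e with
    | zero => simp
    | succ e ih =>
      rw [sum_range_succ, pow_succ U.card, pow_succ (U.card + 1)]
      have := Nat.pow_le_pow_left (Nat.le_succ U.card) e
      nlinarith
  calc 𝒜.card ≤ 𝒜.shatterer.card := card_le_card_shatterer 𝒜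
    _ ≤ ∑ k ∈ range (d + 1), (powersetCard k U).card := (card_le_card hsub).trans card_biUnion_le
    _ ≤ ∑ k ∈ range (d + 1), U.card ^ k :=
        sum_le_sum fun k _ => by rw [card_powersetCard]; exact Nat.choose_le_pow _ _
    _ ≤ _ := hpow d

section Packing

variable {α ι : Type*}

open Classical in
/-- In a `δ`-separated set, a random range splits off many points on average. -/
theorem separated_le_sum_min [Fintype ι] (S : ι → Set α) (μ : ι → ℝ) (hμ : ∀ A, 0 ≤ μ A) (δ : ℝ)
    (Q : Finset α) (hne : Q.Nonempty)
    (hδ : ∀ p ∈ Q, ∀ q ∈ Q, p ≠ q → δ ≤ ∑ A, if (p ∈ S A ↔ q ∈ S A) then 0 else μ A) :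
    δ / 2 * ((Q.card : ℝ) - 1) ≤ ∑ A, μ A *
      ((min (Q.filter (fun p => p ∉ S A)).card (Q.filter (fun p => p ∈ S A)).card : ℕ) : ℝ) := by
  have hQ : 0 < (Q.card : ℝ) := by exact_mod_cast hne.card_pos
  have h1 : δ * (Q.card * (Q.card - 1)) ≤ ∑ x ∈ Q.offDiag,
      ∑ A, if (x.1 ∈ S A ↔ x.2 ∈ S A) then 0 else μ A := by
    have : ((Q.offDiag.card : ℕ) : ℝ) = Q.card * (Q.card - 1) := by
      rw [offDiag_card, Nat.cast_sub (Nat.le_mul_self _)]; push_cast; ring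
    rw [← this, mul_comm, ← nsmul_eq_mul]
    refine card_nsmul_le_sum _ _ _ fun x hx => ?_
    rw [mem_offDiag] at hx
    exact hδ _ hx.1 _ hx.2.1 hx.2.2
  have h2 : ∀ A, ∑ x ∈ Q.offDiag, (if (x.1 ∈ S A ↔ x.2 ∈ S A) then 0 else μ A) ≤
      2 * Q.card * (μ A * ((min (Q.filter (fun p => p ∉ S A)).card
        (Q.filter (fun p => p ∈ S A)).card : ℕ) : ℝ)) := by
    intro A
    set N := Q.filter (fun p => p ∉ S A)
    set Y := Q.filter (fun p => p ∈ S A)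
    have hc : Y.card + N.card = Q.card := card_filter_add_card_filter_not _
    have hsub : Q.offDiag.filter (fun x => ¬ (x.1 ∈ S A ↔ x.2 ∈ S A)) ⊆ Y ×ˢ N ∪ N ×ˢ Y := by
      intro x hx
      simp only [mem_filter, mem_offDiag, mem_union, mem_product, Y, N] at hx ⊢
      tauto
    have hb : (Q.offDiag.filter (fun x => ¬ (x.1 ∈ S A ↔ x.2 ∈ S A))).card ≤
        2 * Q.card * min N.card Y.card := by
      refine (card_le_card hsub).trans ((card_union_le _ _).trans ?_)
      rw [card_product, card_product]
      rcases le_total N.card Y.card with h | h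
      · rw [min_eq_left h]; nlinarith
      · rw [min_eq_right h]; nlinarith
    have : ∑ x ∈ Q.offDiag, (if (x.1 ∈ S A ↔ x.2 ∈ S A) then 0 else μ A) =
        (Q.offDiag.filter (fun x => ¬ (x.1 ∈ S A ↔ x.2 ∈ S A))).card * μ A := by
      rw [← nsmul_eq_mul, ← sum_const, sum_filter]
      exact sum_congr rfl fun x _ => by split_ifs <;> simp_all
    rw [this]
    have hb' : ((Q.offDiag.filter (fun x => ¬ (x.1 ∈ S A ↔ x.2 ∈ S A))).card : ℝ) ≤
        2 * Q.card * ((min N.card Y.card : ℕ) : ℝ) := by exact_mod_cast hb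
    nlinarith [hμ A]
  rw [sum_comm] at h1
  have h3 := h1.trans (sum_le_sum fun A _ => h2 A)
  rw [← mul_sum] at h3
  have : 2 * (Q.card : ℝ) * (δ / 2 * ((Q.card : ℝ) - 1)) = δ * (Q.card * (Q.card - 1)) := by ring
  rw [← this] at h3
  exact le_of_mul_le_mul_left h3 (by positivity)

open Classical in
/-- The set of coordinates `i` for which `p` lies in the range `a i`. -/
noncomputable def trace (S : ι → Set α) {n : ℕ} (a : Fin n → ι) (p : α) : Finset (Fin n) :=
  univ.filter fun i => p ∈ S (a i)

theorem mem_trace {S : ι → Set α} {n : ℕ} {a : Fin n → ι} {p : α} {i : Fin n} :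
    i ∈ trace S a p ↔ p ∈ S (a i) := by
  simp [trace]

theorem trace_update_erase (S : ι → Set α) {n : ℕ} (a : Fin n → ι) (p : α) (i : Fin n) (A : ι) :
    (trace S (Function.update a i A) p).erase i = (trace S a p).erase i := by
  ext j
  rw [mem_erase, mem_erase, mem_trace, mem_trace]
  refine and_congr_right fun hj => ?_
  rw [Function.update_of_ne hj]

/-- On `F`, no three of the ranges cut out all eight cells of their Venn diagram. -/
def NoThreeIndependent (S : ι → Set α) (F : Finset α) : Prop :=
  ∀ i j k, ∃ x y z : Prop, ∀ p ∈ F, ¬ ((p ∈ S i ↔ x) ∧ (p ∈ S j ↔ y) ∧ (p ∈ S k ↔ z))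

theorem NoThreeIndependent.exists_inter_trace_ne {S : ι → Set α} {F : Finset α}
    (hS : NoThreeIndependent S F) {n : ℕ} (a : Fin n → ι) (T : Finset (Fin n)) (hT : T.card = 3) :
    ∃ T' ⊆ T, ∀ p ∈ F, trace S a p ∩ T ≠ T' := by
  classical
  obtain ⟨i, j, k, hij, hik, hjk, rfl⟩ := card_eq_three.1 hT
  obtain ⟨x, y, z, h⟩ := hS (a i) (a j) (a k)
  refine ⟨({i, j, k} : Finset (Fin n)).filter
    (fun l => (l = i ∧ x) ∨ (l = j ∧ y) ∨ (l = k ∧ z)), filter_subset _ _, fun p hp hc => ?_⟩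
  refine h p hp ⟨?_, ?_, ?_⟩
  · have := congrArg (i ∈ ·) hc
    simpa [mem_trace, hij, hik] using this
  · have := congrArg (j ∈ ·) hc
    simpa [mem_trace, hij.symm, hjk] using this
  · have := congrArg (k ∈ ·) hc
    simpa [mem_trace, hik.symm, hjk.symm] using this

open Classical in
theorem NoThreeIndependent.card_image_erase_le {S : ι → Set α} {F : Finset α}
    (hS : NoThreeIndependent S F) {n : ℕ} (a : Fin n → ι) (i : Fin n) :
    (F.image fun p => (trace S a p).erase i).card ≤ (n + 1) ^ 2 := by
  have h0 : (F.image fun p => trace S a p).card ≤ (n + 1) ^ 2 := by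
    have := card_le_pow_of_not_shatters (F.image fun p => trace S a p) univ
      (fun A _ => subset_univ A) 2 (fun T _ hT hsh => by
        obtain ⟨T', hT', h⟩ := hS.exists_inter_trace_ne a T hT
        obtain ⟨u, hu, hTu⟩ := hsh hT'
        obtain ⟨p, hp, rfl⟩ := mem_image.1 hu
        exact h p hp (by rw [inter_comm]; exact hTu))
    simpa using this
  have : (F.image fun p => (trace S a p).erase i) =
      (F.image fun p => trace S a p).image (fun z => z.erase i) := by
    rw [image_image]; rfl
  rw [this]
  exact card_image_le.trans h0

open Classical in
/-- Haussler's packing lemma, for families whose dual shatters no three ranges. -/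
theorem NoThreeIndependent.card_le_of_separated [Fintype ι] {S : ι → Set α} {F : Finset α}
    (hS : NoThreeIndependent S F) (μ : ι → ℝ) (hμ : ∀ A, 0 ≤ μ A) (h1 : ∑ A, μ A = 1)
    (δ : ℝ) (hδ : ∀ p ∈ F, ∀ q ∈ F, p ≠ q → δ ≤ ∑ A, if (p ∈ S A ↔ q ∈ S A) then 0 else μ A)
    (hδ0 : 0 ≤ δ) (n : ℕ) (hn : 8 ≤ n * δ) : F.card ≤ 2 * (n + 1) ^ 2 := by
  let w : (Fin n → ι) → Finset (Fin n) → ℕ := fun a z => (F.filter fun p => trace S a p = z).card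
  let X : Fin n → (Fin n → ι) → ℝ := fun i a =>
    ((∑ z ∈ (univ.erase i).powerset, min (w a z) (w a (insert i z)) : ℕ) : ℝ)
  have hupper : ∀ a, ∑ i, X i a ≤ 2 * F.card := by
    intro a
    have h := sum_min_le_mul_sum (univ : Finset (Fin n)) 2 (w a) (by
      intro T _ hT
      obtain ⟨T', hT', h⟩ := hS.exists_inter_trace_ne a T hT
      refine ⟨T', hT', fun z _ hz => ?_⟩
      rw [card_eq_zero, filter_eq_empty_iff]
      rintro p hp rfl
      exact h p hp hz)
    have hw : ∑ z ∈ (univ : Finset (Fin n)).powerset, w a z = F.card :=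
      (card_eq_sum_card_fiberwise (fun p _ => mem_powerset.2 (subset_univ _))).symm
    rw [hw] at h
    simp only [X]
    exact_mod_cast h
  have hlower : ∀ i a, δ / 2 * (F.card - ((n : ℝ) + 1) ^ 2) ≤
      ∑ A, μ A * X i (Function.update a i A) := by
    intro i a
    let Q : Finset (Fin n) → Finset α := fun z => F.filter fun p => (trace S a p).erase i = z
    let I := F.image fun p => (trace S a p).erase i
    have hmem : ∀ A p, i ∈ trace S (Function.update a i A) p ↔ p ∈ S A := by
      intro A p
      rw [mem_trace, Function.update_self]
    have hI : I ⊆ (univ.erase i).powerset := by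
      intro z hz
      obtain ⟨p, _, rfl⟩ := mem_image.1 hz
      exact mem_powerset.2 (erase_subset_erase _ (subset_univ _))
    have hX : ∀ A, ∑ z ∈ I, ((min ((Q z).filter (fun p => p ∉ S A)).card
        ((Q z).filter (fun p => p ∈ S A)).card : ℕ) : ℝ) ≤ X i (Function.update a i A) := by
      intro A
      simp only [X]
      rw [← Nat.cast_sum, Nat.cast_le]
      refine (sum_le_sum fun z hz => ?_).trans (sum_le_sum_of_subset hI)
      have hiz : i ∉ z := fun h => notMem_erase i _ (mem_powerset.1 (hI hz) h)
      refine min_le_min (card_le_card ?_) (card_le_card ?_)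
      · intro p hp
        simp only [Q, mem_filter] at hp ⊢
        refine ⟨hp.1.1, ?_⟩
        rw [← trace_update_erase S a p i A, erase_eq_of_notMem] at hp
        · exact hp.1.2
        · rw [hmem]; exact hp.2
      · intro p hp
        simp only [Q, mem_filter] at hp ⊢
        refine ⟨hp.1.1, ?_⟩
        rw [← hp.1.2, ← trace_update_erase S a p i A, insert_erase ((hmem A p).2 hp.2)]
    have hF : (F.card : ℝ) = ∑ z ∈ I, ((Q z).card : ℝ) := by
      rw [← Nat.cast_sum, Nat.cast_inj]
      exact card_eq_sum_card_image _ _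
    have hIc : (I.card : ℝ) ≤ ((n : ℝ) + 1) ^ 2 := by
      exact_mod_cast hS.card_image_erase_le a i
    calc δ / 2 * (F.card - ((n : ℝ) + 1) ^ 2) ≤ δ / 2 * (F.card - I.card) :=
          mul_le_mul_of_nonneg_left (by linarith) (by linarith)
      _ = ∑ z ∈ I, δ / 2 * (((Q z).card : ℝ) - 1) := by
          rw [hF, ← mul_sum, sum_sub_distrib]; simp
      _ ≤ ∑ z ∈ I, ∑ A, μ A * ((min ((Q z).filter (fun p => p ∉ S A)).card
            ((Q z).filter (fun p => p ∈ S A)).card : ℕ) : ℝ) := by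
          refine sum_le_sum fun z hz => separated_le_sum_min S μ hμ δ (Q z) ?_ ?_
          · obtain ⟨p, hp, rfl⟩ := mem_image.1 hz
            exact ⟨p, mem_filter.2 ⟨hp, rfl⟩⟩
          · intro p hp q hq
            exact hδ p (mem_filter.1 hp).1 q (mem_filter.1 hq).1
      _ = ∑ A, μ A * ∑ z ∈ I, ((min ((Q z).filter (fun p => p ∉ S A)).card
            ((Q z).filter (fun p => p ∈ S A)).card : ℕ) : ℝ) := by
          rw [sum_comm]
          exact sum_congr rfl fun A _ => (mul_sum _ _ _).symm
      _ ≤ _ := sum_le_sum fun A _ => mul_le_mul_of_nonneg_left (hX A) (hμ A)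
  have hE : ∀ i, δ / 2 * (F.card - ((n : ℝ) + 1) ^ 2) ≤ ∑ a : Fin n → ι, (∏ j, μ (a j)) * X i a :=
    fun i => le_sum_prod_mul_of_update μ hμ h1 i (X i) _ (hlower i)
  have htot : ∑ a : Fin n → ι, ∏ j, μ (a j) = 1 := by
    have := Finset.prod_univ_sum (fun _ : Fin n => (univ : Finset ι)) (fun _ A => μ A)
    simpa [h1] using this.symm
  have hsum : n * (δ / 2 * (F.card - ((n : ℝ) + 1) ^ 2)) ≤ 2 * F.card := by
    calc (n : ℝ) * (δ / 2 * (F.card - ((n : ℝ) + 1) ^ 2))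
        = ∑ _i : Fin n, δ / 2 * (F.card - ((n : ℝ) + 1) ^ 2) := by simp
      _ ≤ ∑ i : Fin n, ∑ a : Fin n → ι, (∏ j, μ (a j)) * X i a := sum_le_sum fun i _ => hE i
      _ = ∑ a : Fin n → ι, (∏ j, μ (a j)) * ∑ i, X i a := by
          rw [sum_comm]
          exact sum_congr rfl fun a _ => (mul_sum _ _ _).symm
      _ ≤ ∑ a : Fin n → ι, (∏ j, μ (a j)) * (2 * F.card) :=
          sum_le_sum fun a _ => mul_le_mul_of_nonneg_left (hupper a) (prod_nonneg fun j _ => hμ _)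
      _ = 2 * F.card := by rw [← sum_mul, htot, one_mul]
  by_contra! hc
  have hc' : 2 * ((n : ℝ) + 1) ^ 2 < F.card := by exact_mod_cast hc
  nlinarith [mul_nonneg (sub_nonneg.2 hn) (by nlinarith : 0 ≤ (F.card : ℝ) - ((n : ℝ) + 1) ^ 2)]

open Classical in
/-- Some two points of `F` are separated by a fraction `O(1/√|F|)` of the ranges. -/
theorem NoThreeIndependent.exists_separation_le [Fintype ι] {S : ι → Set α} {F : Finset α}
    (hS : NoThreeIndependent S F) (μ : ι → ℝ) (hμ : ∀ A, 0 ≤ μ A) (hF : 2 ≤ F.card) :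
    ∃ p ∈ F, ∃ q ∈ F, p ≠ q ∧ (∑ A, if (p ∈ S A ↔ q ∈ S A) then 0 else μ A) ≤
      32 / √F.card * ∑ A, μ A := by
  obtain ⟨p₀, hp₀, q₀, hq₀, hpq₀⟩ := one_lt_card.1 hF
  have hle : ∀ p q, (∑ A, if (p ∈ S A ↔ q ∈ S A) then 0 else μ A) ≤ ∑ A, μ A := fun p q =>
    sum_le_sum fun A _ => by split_ifs; exacts [hμ A, le_rfl]
  have h0 : 0 ≤ ∑ A, μ A := sum_nonneg fun A _ => hμ A
  have hsq : 0 < √(F.card : ℝ) := Real.sqrt_pos.2 (by exact_mod_cast (by omega : 0 < F.card))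
  rcases lt_or_ge (√(F.card : ℝ)) 32 with hsmall | hbig
  · refine ⟨p₀, hp₀, q₀, hq₀, hpq₀, (hle _ _).trans (le_mul_of_one_le_left h0 ?_)⟩
    rw [one_le_div hsq]; exact hsmall.le
  by_contra! hc
  have hpos : 0 < ∑ A, μ A := by
    refine lt_of_le_of_ne h0 fun h => ?_
    have := hc p₀ hp₀ q₀ hq₀ hpq₀
    rw [← h, mul_zero] at this
    exact absurd (hle p₀ q₀) (by rw [← h]; exact not_le.2 this)
  set M := ∑ A, μ A
  set n := ⌊√(F.card : ℝ) / 2⌋₊ - 1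
  have hn1 : (n : ℝ) + 1 ≤ √(F.card : ℝ) / 2 := by
    have h2 : 1 ≤ ⌊√(F.card : ℝ) / 2⌋₊ := Nat.le_floor (by push_cast; linarith)
    have h3 : ((n + 1 : ℕ) : ℝ) = (⌊√(F.card : ℝ) / 2⌋₊ : ℝ) := by congr 1; omega
    push_cast at h3
    rw [h3]
    exact Nat.floor_le (by positivity)
  have hn2 : √(F.card : ℝ) / 2 - 2 ≤ n := by
    have h2 := Nat.lt_floor_add_one (√(F.card : ℝ) / 2)
    have h3 : ((⌊√(F.card : ℝ) / 2⌋₊ : ℕ) : ℝ) ≤ ((n + 1 : ℕ) : ℝ) := by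
      exact_mod_cast (by omega)
    push_cast at h3
    linarith
  have := hS.card_le_of_separated (fun A => μ A / M) (fun A => div_nonneg (hμ A) h0)
    (by rw [← sum_div]; exact div_self hpos.ne') (32 / √F.card)
    (fun p hp q hq hpq => by
      have h := (hc p hp q hq hpq).le
      have e : (∑ A, if (p ∈ S A ↔ q ∈ S A) then 0 else μ A / M) =
          (∑ A, if (p ∈ S A ↔ q ∈ S A) then 0 else μ A) / M := by
        rw [sum_div]
        exact sum_congr rfl fun A _ => by split_ifs <;> simp
      rw [e, le_div_iff₀ hpos]
      exact h)
    (by positivity) n (by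
      rw [mul_div_assoc', le_div_iff₀ hsq]
      linarith)
  have h4 : (F.card : ℝ) ≤ 2 * ((n : ℝ) + 1) ^ 2 := by exact_mod_cast this
  have h5 : √(F.card : ℝ) ^ 2 = F.card := Real.sq_sqrt (Nat.cast_nonneg _)
  nlinarith

/-- The edges in `E` form a connected graph on the vertex set `R`. -/
def Links (E : Finset (α × α)) (R : Finset α) : Prop :=
  E ⊆ R ×ˢ R ∧ ∀ u ∈ R, ∀ v ∈ R, Relation.EqvGen (fun x y => (x, y) ∈ E) u v

open Classical in
/-- The number of edges in `E` whose endpoints are strictly on different sides of `{f = 0}`. -/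
noncomputable def crossings (f : α → ℝ) (E : Finset (α × α)) : ℕ :=
  (E.filter fun e => f e.1 < 0 ∧ 0 < f e.2 ∨ 0 < f e.1 ∧ f e.2 < 0).card

theorem crossings_neg (f : α → ℝ) (E : Finset (α × α)) :
    crossings (fun p => - f p) E = crossings f E := by
  unfold crossings
  congr 1
  ext e
  simp only [mem_filter, Left.neg_neg_iff, Left.neg_pos_iff]
  tauto

theorem Links.crossings_eq_zero_of_nonneg {E : Finset (α × α)} {R : Finset α} (h : Links E R)
    {f : α → ℝ} (hf : ∀ p ∈ R, 0 ≤ f p) : crossings f E = 0 := by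
  rw [crossings, card_eq_zero, filter_eq_empty_iff]
  intro e he
  have := mem_product.1 (h.1 he)
  have h1 := hf _ this.1
  have h2 := hf _ this.2
  rintro (⟨h3, h4⟩ | ⟨h3, h4⟩) <;> linarith

theorem Links.crossings_eq_zero_of_nonpos {E : Finset (α × α)} {R : Finset α} (h : Links E R)
    {f : α → ℝ} (hf : ∀ p ∈ R, f p ≤ 0) : crossings f E = 0 := by
  rw [← crossings_neg]
  exact h.crossings_eq_zero_of_nonneg fun p hp => by linarith [hf p hp]

theorem eqvGen_edges_mono {E E' : Finset (α × α)} (h : E ⊆ E') {u v : α}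
    (huv : Relation.EqvGen (fun x y => (x, y) ∈ E) u v) :
    Relation.EqvGen (fun x y => (x, y) ∈ E') u v :=
  Relation.EqvGen.mono (fun _ _ hxy => h hxy) _ _ huv

open Classical in
/-- Two connected graphs can be joined by a single edge. -/
theorem Links.exists_union [DecidableEq α] {E₁ E₂ : Finset (α × α)} {R₁ R₂ : Finset α} (h₁ : Links E₁ R₁)
    (h₂ : Links E₂ R₂) : ∃ E, Links E (R₁ ∪ R₂) ∧
      ∀ f : α → ℝ, crossings f E ≤ crossings f E₁ + crossings f E₂ + 1 := by
  rcases R₁.eq_empty_or_nonempty with rfl | ⟨r₁, hr₁⟩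
  · exact ⟨E₂, by simpa using h₂, fun f => by omega⟩
  rcases R₂.eq_empty_or_nonempty with rfl | ⟨r₂, hr₂⟩
  · exact ⟨E₁, by simpa using h₁, fun f => by omega⟩
  refine ⟨insert (r₁, r₂) (E₁ ∪ E₂), ⟨?_, ?_⟩, fun f => ?_⟩
  · refine insert_subset ?_ (union_subset ?_ ?_)
    · simp [hr₁, hr₂]
    · exact h₁.1.trans (product_subset_product subset_union_left subset_union_left)
    · exact h₂.1.trans (product_subset_product subset_union_right subset_union_right)
  · have key : ∀ u ∈ R₁ ∪ R₂,
        Relation.EqvGen (fun x y => (x, y) ∈ insert (r₁, r₂) (E₁ ∪ E₂)) r₁ u := by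
      intro u hu
      rcases mem_union.1 hu with hu | hu
      · exact eqvGen_edges_mono (subset_union_left.trans (subset_insert _ _)) (h₁.2 r₁ hr₁ u hu)
      · exact (Relation.EqvGen.rel r₁ r₂ (mem_insert_self _ _)).trans _ _ _
          (eqvGen_edges_mono (subset_union_right.trans (subset_insert _ _)) (h₂.2 r₂ hr₂ u hu))
    exact fun u hu v hv => ((key u hu).symm).trans _ _ _ (key v hv)
  · unfold crossings
    refine (card_le_card (filter_subset_filter _ (insert_eq _ _).subset)).trans ?_
    rw [filter_union, filter_union]
    have h3 := card_union_le ({(r₁, r₂)} : Finset (α × α)) (E₁ ∪ E₂)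
    refine (card_union_le _ _).trans ?_
    have h4 := (card_filter_le ({(r₁, r₂)} : Finset (α × α))
      fun e => f e.1 < 0 ∧ 0 < f e.2 ∨ 0 < f e.1 ∧ f e.2 < 0)
    rw [card_singleton] at h4
    refine (Nat.add_le_add h4 (card_union_le _ _)).trans ?_
    omega

open Classical in
/-- Welzl's construction, stated as an average over all ranges. -/
theorem NoThreeIndependent.exists_links [Fintype ι] {S : ι → Set α} (n : ℕ) :
    ∀ (F : Finset α), F.card = n → NoThreeIndependent S F → ∀ μ : ι → ℝ, (∀ A, 0 ≤ μ A) →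
    ∃ E, Links E F ∧
      ∑ A, μ A * 2 ^ (E.filter fun e => ¬ (e.1 ∈ S A ↔ e.2 ∈ S A)).card ≤
        (∑ A, μ A) * Real.exp (64 * √n) := by
  induction n with
  | zero =>
    intro F hF _ μ hμ
    rw [card_eq_zero] at hF
    subst hF
    exact ⟨∅, ⟨by simp, by simp⟩, by simp⟩
  | succ n ih =>
    intro F hF hS μ hμ
    rcases n with _ | m
    · obtain ⟨p, rfl⟩ := card_eq_one.1 hF
      refine ⟨∅, ⟨by simp, ?_⟩, ?_⟩
      · simp only [mem_singleton]
        rintro u rfl v rfl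
        exact Relation.EqvGen.refl _
      · simp only [filter_empty, card_empty, pow_zero, mul_one]
        exact le_mul_of_one_le_right (sum_nonneg fun A _ => hμ A)
          (Real.one_le_exp (by positivity))
    set n := m + 1
    obtain ⟨p, hp, q, hq, hpq, hle⟩ := hS.exists_separation_le μ hμ (by omega)
    obtain ⟨E, hE, hsum⟩ := ih (F.erase p) (by rw [card_erase_of_mem hp, hF]; rfl)
      (fun i j k => by
        obtain ⟨x, y, z, h⟩ := hS i j k
        exact ⟨x, y, z, fun p hp => h p (mem_of_mem_erase hp)⟩)
      (fun A => μ A + if (p ∈ S A ↔ q ∈ S A) then 0 else μ A)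
      (fun A => by have := hμ A; split_ifs <;> linarith)
    refine ⟨insert (p, q) E, ⟨?_, ?_⟩, ?_⟩
    · exact insert_subset (by simp [hp, hq])
        (hE.1.trans (product_subset_product (erase_subset _ _) (erase_subset _ _)))
    · have hq' : q ∈ F.erase p := mem_erase.2 ⟨hpq.symm, hq⟩
      have key : ∀ u ∈ F, Relation.EqvGen (fun x y => (x, y) ∈ insert (p, q) E) q u := by
        intro u hu
        by_cases hup : u = p
        · rw [hup]
          exact (Relation.EqvGen.rel _ _ (by simp)).symm
        · exact eqvGen_edges_mono (subset_insert _ _)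
            (hE.2 q hq' u (mem_erase.2 ⟨hup, hu⟩))
      exact fun u hu v hv => ((key u hu).symm).trans _ _ _ (key v hv)
    · calc ∑ A, μ A * 2 ^ ((insert (p, q) E).filter fun e => ¬ (e.1 ∈ S A ↔ e.2 ∈ S A)).card
          ≤ ∑ A, (μ A + if (p ∈ S A ↔ q ∈ S A) then 0 else μ A) *
              2 ^ (E.filter fun e => ¬ (e.1 ∈ S A ↔ e.2 ∈ S A)).card := by
            refine sum_le_sum fun A _ => ?_
            rw [filter_insert]
            by_cases h : p ∈ S A ↔ q ∈ S A
            · simp [h]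
            · simp only [h, not_false_eq_true, if_true, if_false]
              have : (2 : ℝ) ^ (insert (p, q)
                  (E.filter fun e => ¬ (e.1 ∈ S A ↔ e.2 ∈ S A))).card ≤
                  2 ^ ((E.filter fun e => ¬ (e.1 ∈ S A ↔ e.2 ∈ S A)).card + 1) :=
                pow_le_pow_right₀ (by norm_num) (card_insert_le _ _)
              refine (mul_le_mul_of_nonneg_left this (hμ A)).trans (le_of_eq ?_)
              rw [pow_succ]; ring
        _ ≤ _ := hsum
        _ ≤ ((∑ A, μ A) * (32 / √((n + 1 : ℕ) : ℝ) + 1)) * Real.exp (64 * √n) := by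
            refine mul_le_mul_of_nonneg_right ?_ (Real.exp_nonneg _)
            rw [sum_add_distrib]
            rw [hF] at hle
            linarith
        _ ≤ ((∑ A, μ A) * Real.exp (32 / √((n + 1 : ℕ) : ℝ))) * Real.exp (64 * √n) := by
            refine mul_le_mul_of_nonneg_right ?_ (Real.exp_nonneg _)
            exact mul_le_mul_of_nonneg_left (Real.add_one_le_exp _) (sum_nonneg fun A _ => hμ A)
        _ ≤ (∑ A, μ A) * Real.exp (64 * √((n + 1 : ℕ) : ℝ)) := by
            rw [mul_assoc, ← Real.exp_add]
            refine mul_le_mul_of_nonneg_left (Real.exp_le_exp.2 ?_) (sum_nonneg fun A _ => hμ A)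
            have hs : 0 < √((n + 1 : ℕ) : ℝ) := Real.sqrt_pos.2 (by positivity)
            have h1 : √((n + 1 : ℕ) : ℝ) ^ 2 = n + 1 := by
              rw [Real.sq_sqrt (by positivity)]; push_cast; ring
            have h2 : √(n : ℝ) ^ 2 = n := Real.sq_sqrt (by positivity)
            rw [← le_sub_iff_add_le, div_le_iff₀ hs]
            nlinarith [sq_nonneg (√((n + 1 : ℕ) : ℝ) - √(n : ℝ))]

end Packing

/-- The affine function with coefficients `a`, `b`, `c` on the plane. -/
def affineFun (a b c : ℝ) (p : ℝ × ℝ) : ℝ := a * p.1 + b * p.2 + c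

theorem affineFun_neg (a b c : ℝ) (p : ℝ × ℝ) :
    affineFun (-a) (-b) (-c) p = - affineFun a b c p := by
  simp only [affineFun]; ring

/-- Three lines in the plane do not cut out eight cells. -/
theorem noThreeIndependent_affine {ι : Type*} {S : ι → Set (ℝ × ℝ)} {F : Finset (ℝ × ℝ)}
    (hS : ∀ i, ∃ a b c, ∀ p ∈ F, p ∈ S i ↔ 0 < affineFun a b c p) : NoThreeIndependent S F := by
  intro i j k
  obtain ⟨a₁, b₁, c₁, h₁⟩ := hS i
  obtain ⟨a₂, b₂, c₂, h₂⟩ := hS j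
  obtain ⟨a₃, b₃, c₃, h₃⟩ := hS k
  obtain ⟨v, hv, hv0⟩ : ∃ v : Fin 3 → ℝ,
      (Matrix.mulVecLin !![a₁, a₂, a₃; b₁, b₂, b₃]) v = 0 ∧ v ≠ 0 :=
    Submodule.exists_mem_ne_zero_of_ne_bot (LinearMap.ker_ne_bot_of_finrank_lt (by simp))
  have ha := congrFun hv 0
  have hb := congrFun hv 1
  simp [Matrix.mulVec, dotProduct, Fin.sum_univ_three] at ha hb
  have hconst : ∀ p, v 0 * affineFun a₁ b₁ c₁ p + v 1 * affineFun a₂ b₂ c₂ p +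
      v 2 * affineFun a₃ b₃ c₃ p = v 0 * c₁ + v 1 * c₂ + v 2 * c₃ := by
    intro p
    simp only [affineFun]
    linear_combination p.1 * ha + p.2 * hb
  by_contra! hc
  obtain ⟨p, hp, p1, p2, p3⟩ := hc (0 < v 0) (0 < v 1) (0 < v 2)
  obtain ⟨q, hq, q1, q2, q3⟩ := hc (v 0 < 0) (v 1 < 0) (v 2 < 0)
  rw [h₁ p hp] at p1
  rw [h₂ p hp] at p2
  rw [h₃ p hp] at p3
  rw [h₁ q hq] at q1
  rw [h₂ q hq] at q2
  rw [h₃ q hq] at q3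
  have key : ∀ t x y : ℝ, (0 < x ↔ 0 < t) → (0 < y ↔ t < 0) → 0 ≤ t * x ∧ t * y ≤ 0 ∧
      (t ≠ 0 → t * y < t * x) := by
    intro t x y hx hy
    rcases lt_trichotomy t 0 with ht | rfl | ht
    · have h1 : x ≤ 0 := by by_contra! h; linarith [hx.1 h]
      have h2 := hy.2 ht
      have := mul_neg_of_neg_of_pos ht h2
      have := mul_nonneg_of_nonpos_of_nonpos ht.le h1
      exact ⟨by linarith, by linarith, fun _ => by linarith⟩
    · simp
    · have h1 : y ≤ 0 := by by_contra! h; linarith [hy.1 h]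
      have h2 := hx.2 ht
      have := mul_pos ht h2
      have := mul_nonpos_of_nonneg_of_nonpos ht.le h1
      exact ⟨by linarith, by linarith, fun _ => by linarith⟩
  obtain ⟨k1, l1, m1⟩ := key _ _ _ p1 q1
  obtain ⟨k2, l2, m2⟩ := key _ _ _ p2 q2
  obtain ⟨k3, l3, m3⟩ := key _ _ _ p3 q3
  have hp' := hconst p
  have hq' := hconst q
  apply hv0
  ext l
  by_contra hl
  fin_cases l
  · have := m1 hl; linarith
  · have := m2 hl; linarith
  · have := m3 hl; linarith

/-- Halfplanes shatter no four points. -/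
theorem not_shatters_of_affine {𝒜 : Finset (Finset (ℝ × ℝ))} {F : Finset (ℝ × ℝ)}
    (h𝒜 : ∀ B ∈ 𝒜, ∃ a b c, ∀ p ∈ F, p ∈ B ↔ 0 < affineFun a b c p)
    (T : Finset (ℝ × ℝ)) (hTF : T ⊆ F) (hT : T.card = 4) : ¬ 𝒜.Shatters T := by
  classical
  intro hsh
  obtain ⟨g, hg, hg0, hne⟩ :=
    Module.exists_nontrivial_relation_sum_zero_of_finrank_succ_lt_card (R := ℝ) (t := T)
      (by simp [hT])
  obtain ⟨x, hx, hgx⟩ := exists_pos_of_sum_zero_of_exists_nonzero g hg0 hne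
  obtain ⟨B, hB, hTB⟩ := hsh (filter_subset (fun p => 0 < g p) T)
  obtain ⟨a, b, c, h⟩ := h𝒜 B hB
  have hB' : ∀ p ∈ T, (0 < affineFun a b c p ↔ 0 < g p) := by
    intro p hp
    rw [← h p (hTF hp)]
    have := congrArg (p ∈ ·) hTB
    simpa [hp] using this
  have hzero : ∑ p ∈ T, g p * affineFun a b c p = 0 := by
    have h1 := congrArg Prod.fst hg
    have h2 := congrArg Prod.snd hg
    simp only [Prod.fst_sum, Prod.snd_sum, Prod.smul_fst, Prod.smul_snd, smul_eq_mul,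
      Prod.fst_zero, Prod.snd_zero] at h1 h2
    calc ∑ p ∈ T, g p * affineFun a b c p
        = a * ∑ p ∈ T, g p * p.1 + b * ∑ p ∈ T, g p * p.2 + c * ∑ p ∈ T, g p := by
          simp only [mul_sum, ← sum_add_distrib]
          exact sum_congr rfl fun p _ => by simp only [affineFun]; ring
      _ = 0 := by rw [h1, h2, hg0]; ring
  have hnn : ∀ p ∈ T, 0 ≤ g p * affineFun a b c p := by
    intro p hp
    rcases lt_or_ge 0 (g p) with h1 | h1
    · exact (mul_pos h1 ((hB' p hp).2 h1)).le
    · refine mul_nonneg_of_nonpos_of_nonpos h1 ?_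
      by_contra! h2
      exact absurd ((hB' p hp).1 h2) (not_lt.2 h1)
  have := (sum_eq_zero_iff_of_nonneg hnn).1 hzero x hx
  exact absurd this (mul_pos hgx ((hB' x hx).2 hgx)).ne'

open Classical in
/-- Welzl's theorem: every planar point set has a spanning tree with crossing number
`O(√n)`. -/
theorem exists_links_crossings_le (F : Finset (ℝ × ℝ)) :
    ∃ E, Links E F ∧ ∀ a b c : ℝ, (crossings (affineFun a b c) E : ℝ) ≤ 146 * √F.card := by
  obtain ⟨𝒜, hmem⟩ : ∃ 𝒜 : Finset (Finset (ℝ × ℝ)), ∀ B, B ∈ 𝒜 ↔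
      B ⊆ F ∧ ∃ a b c, ∀ p ∈ F, p ∈ B ↔ 0 < affineFun a b c p :=
    ⟨F.powerset.filter fun B => ∃ a b c, ∀ p ∈ F, p ∈ B ↔ 0 < affineFun a b c p, by simp⟩
  have h𝒜 : ∀ B ∈ 𝒜, ∃ a b c, ∀ p ∈ F, p ∈ B ↔ 0 < affineFun a b c p :=
    fun B hB => ((hmem B).1 hB).2
  have hcard : 𝒜.card ≤ (F.card + 1) ^ 3 :=
    card_le_pow_of_not_shatters 𝒜 F (fun B hB => ((hmem B).1 hB).1) 3
      (not_shatters_of_affine h𝒜)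
  obtain ⟨E, hE, hsum⟩ := NoThreeIndependent.exists_links (ι := 𝒜)
    (S := fun B => {p | p ∈ B.1}) F.card F rfl
    (noThreeIndependent_affine fun B => h𝒜 B.1 B.2) (fun _ => 1)
    (fun _ => zero_le_one)
  refine ⟨E, hE, fun a b c => ?_⟩
  rcases F.eq_empty_or_nonempty with rfl | hne
  · rw [hE.crossings_eq_zero_of_nonneg (by simp)]; simp
  obtain ⟨N, hNF⟩ : ∃ N : ℝ, N = F.card := ⟨_, rfl⟩
  rw [← hNF] at hsum ⊢
  simp only [one_mul, sum_const, card_univ, Fintype.card_coe, nsmul_eq_mul, mul_one,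
    Set.mem_ofPred_eq] at hsum
  let B := F.filter fun p => 0 < affineFun a b c p
  have hB : B ∈ 𝒜 := (hmem B).2 ⟨filter_subset _ _, a, b, c, fun p hp => by simp [B, hp]⟩
  have hcr : crossings (affineFun a b c) E ≤
      (E.filter fun e => ¬ (e.1 ∈ B ↔ e.2 ∈ B)).card := by
    refine card_le_card fun e he => ?_
    rw [mem_filter] at he ⊢
    have hF := mem_product.1 (hE.1 he.1)
    refine ⟨he.1, ?_⟩
    simp only [B, mem_filter, hF.1, hF.2, true_and]
    rcases he.2 with ⟨h1, h2⟩ | ⟨h1, h2⟩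
    · exact fun h => absurd (h.2 h2) (not_lt.2 h1.le)
    · exact fun h => absurd (h.1 h1) (not_lt.2 h2.le)
  have hone : (2 : ℝ) ^ (E.filter fun e => ¬ (e.1 ∈ B ↔ e.2 ∈ B)).card ≤
      𝒜.card * Real.exp (64 * √N) :=
    (single_le_sum (f := fun A : 𝒜 => (2 : ℝ) ^ (E.filter fun e =>
      ¬ (e.1 ∈ A.1 ↔ e.2 ∈ A.1)).card) (fun A _ => by positivity)
      (mem_univ (⟨B, hB⟩ : 𝒜))).trans hsum
  have hN : 1 ≤ N := by rw [hNF]; exact_mod_cast Nat.succ_le_of_lt hne.card_pos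
  have hs : 1 ≤ √N := by rw [Real.one_le_sqrt]; exact hN
  have hsq : √N ^ 2 = N := Real.sq_sqrt (by linarith)
  have h2 : (2 : ℝ) ^ crossings (affineFun a b c) E ≤ (N + 1) ^ 3 * Real.exp (64 * √N) := by
    refine (pow_le_pow_right₀ (by norm_num) hcr).trans (hone.trans ?_)
    refine mul_le_mul_of_nonneg_right ?_ (Real.exp_nonneg _)
    rw [hNF]
    exact_mod_cast hcard
  have h3 : (N + 1) ^ 3 ≤ Real.exp (9 * √N) := by
    have h4 : N + 1 ≤ Real.exp (3 * √N) := by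
      have := Real.quadratic_le_exp_of_nonneg (x := 3 * √N) (by positivity)
      nlinarith
    calc (N + 1) ^ 3 ≤ Real.exp (3 * √N) ^ 3 := pow_le_pow_left₀ (by linarith) h4 3
      _ = Real.exp (9 * √N) := by rw [← Real.exp_nat_mul]; congr 1; push_cast; ring
  have h5 : (2 : ℝ) ^ crossings (affineFun a b c) E ≤ Real.exp (73 * √N) := by
    refine h2.trans ((mul_le_mul_of_nonneg_right h3 (Real.exp_nonneg _)).trans (le_of_eq ?_))
    rw [← Real.exp_add]; congr 1; ring
  have h6 := Real.log_le_log (by positivity) h5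
  rw [Real.log_pow, Real.log_exp] at h6
  have := Real.log_two_gt_d9
  nlinarith [(Nat.cast_nonneg (crossings (affineFun a b c) E) : (0 : ℝ) ≤ _)]

/-- The height at abscissa `x` of the line of slope `t` through `p`. -/
def lineHeight (t : ℝ) (p : ℝ × ℝ) (x : ℝ) : ℝ := p.2 + t * (x - p.1)

theorem affineFun_lineHeight_pos {a b c t m : ℝ} (hb : 0 ≤ b) {p z₁ z₂ : ℝ × ℝ}
    (h₁ : z₁.2 ≤ lineHeight t p z₁.1) (h₂ : z₂.2 ≤ lineHeight t p z₂.1) (hm₁ : z₁.1 ≤ m)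
    (hm₂ : m ≤ z₂.1) (hf₁ : 0 < affineFun a b c z₁) (hf₂ : 0 < affineFun a b c z₂) :
    0 < affineFun a b c (m, lineHeight t p m) := by
  simp only [affineFun, lineHeight] at *
  have h3 := mul_le_mul_of_nonneg_left h₁ hb
  have h4 := mul_le_mul_of_nonneg_left h₂ hb
  rcases le_total 0 (a + b * t) with h | h
  · have := mul_le_mul_of_nonneg_left hm₁ h
    linarith
  · have := mul_le_mul_of_nonpos_left hm₂ h
    linarith

open Classical in
/-- A planar point set can be split evenly by a vertical line. -/
theorem exists_vertical_split {R : Finset (ℝ × ℝ)} (hR : R.Nonempty) {M : ℕ}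
    (hM : R.card ≤ 2 * M) : ∃ m R₁ R₂, R₁ ∪ R₂ = R ∧ R₁.card ≤ M ∧ R₂.card ≤ M ∧
      (∀ p ∈ R₁, p.1 ≤ m) ∧ (∀ p ∈ R₂, m ≤ p.1) ∧ ∃ r ∈ R, r.1 = m := by
  have greedy : ∀ j ≤ R.card, ∃ R₁ ⊆ R, R₁.card = j ∧ ∀ p ∈ R₁, ∀ q ∈ R \ R₁, p.1 ≤ q.1 := by
    intro j
    induction j with
    | zero => exact fun _ => ⟨∅, by simp, rfl, by simp⟩
    | succ j ih =>
      intro hj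
      obtain ⟨R₁, hR₁, hc, hsep⟩ := ih (by omega)
      have hne : (R \ R₁).Nonempty := by
        rw [← card_pos, card_sdiff_of_subset hR₁]; omega
      obtain ⟨r, hr, hmin⟩ := exists_min_image (R \ R₁) Prod.fst hne
      have hr' := mem_sdiff.1 hr
      refine ⟨insert r R₁, insert_subset hr'.1 hR₁, by rw [card_insert_of_notMem hr'.2, hc], ?_⟩
      intro p hp q hq
      have hq' : q ∈ R \ R₁ := sdiff_subset_sdiff Subset.rfl (subset_insert _ _) hq
      rcases mem_insert.1 hp with rfl | hp
      · exact hmin q hq'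
      · exact hsep p hp q hq'
  obtain ⟨R₁, hR₁, hc, hsep⟩ := greedy (min M R.card) (min_le_right _ _)
  have hpos := hR.card_pos
  have hne : R₁.Nonempty := by rw [← card_pos]; omega
  obtain ⟨r, hr, hmax⟩ := exists_max_image R₁ Prod.fst hne
  refine ⟨r.1, R₁, R \ R₁, union_sdiff_of_subset hR₁, by omega, ?_, hmax,
    fun q hq => hsep r hr q hq, r, hR₁ hr, rfl⟩
  rw [card_sdiff_of_subset hR₁]
  omega

/-- At abscissa `x`, the lines of slopes `s p` through the points `p` of `Q` all pass through
the halfplane where `f` is positive. -/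
def LinesPosAt (Q : Finset (ℝ × ℝ)) (s f : ℝ × ℝ → ℝ) (x : ℝ) : Prop :=
  ∀ p ∈ Q, 0 < f (x, lineHeight (s p) p x)

theorem Links.crossings_eq_zero_of_linesPosAt {Q R : Finset (ℝ × ℝ)} {s : ℝ × ℝ → ℝ}
    {E : Finset ((ℝ × ℝ) × (ℝ × ℝ))} (h : Links E R) (hR : R ⊆ Q) {a b c x₁ x₂ : ℝ} (hb : 0 ≤ b)
    (hx₁ : ∀ p ∈ R, x₁ ≤ p.1) (hx₂ : ∀ p ∈ R, p.1 ≤ x₂)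
    (h₁ : LinesPosAt Q s (affineFun a b c) x₁) (h₂ : LinesPosAt Q s (affineFun a b c) x₂) :
    crossings (affineFun a b c) E = 0 := by
  refine h.crossings_eq_zero_of_nonneg fun p hp => ?_
  have := affineFun_lineHeight_pos hb (t := s p) (p := p) le_rfl le_rfl (hx₁ p hp) (hx₂ p hp)
    (h₁ p (hR hp)) (h₂ p (hR hp))
  have e : (p.1, lineHeight (s p) p p.1) = p := by simp [lineHeight]
  rw [e] at this
  exact this.le

open Classical in
/-- A set of points, each of which has at most `k` points on or above some line through it, can be
connected by recursively splitting off the points above the lowest of these lines at a median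
abscissa. -/
theorem exists_links_of_upper_aux (Q : Finset (ℝ × ℝ)) (s : ℝ × ℝ → ℝ) (k : ℕ)
    (hs : ∀ p ∈ Q, (Q.filter fun q => lineHeight (s p) p q.1 ≤ q.2).card ≤ k) (h : ℕ) :
    ∀ R ⊆ Q, R.card ≤ k * 2 ^ h → ∃ E, Links E R ∧ ∀ a b c : ℝ, 0 ≤ b →
      (crossings (affineFun a b c) E : ℝ) ≤ 2 * (146 * √k + 2) * (h + 1) ∧
      ((∃ x, (∀ p ∈ R, x ≤ p.1) ∧ LinesPosAt Q s (affineFun a b c) x) ∨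
        (∃ x, (∀ p ∈ R, p.1 ≤ x) ∧ LinesPosAt Q s (affineFun a b c) x) →
        (crossings (affineFun a b c) E : ℝ) ≤ (146 * √k + 2) * (h + 1)) := by
  have small : ∀ R : Finset (ℝ × ℝ), R.card ≤ k → ∃ E, Links E R ∧ ∀ a b c : ℝ,
      (crossings (affineFun a b c) E : ℝ) ≤ 146 * √k := by
    intro R hR
    obtain ⟨E, hE, hc⟩ := exists_links_crossings_le R
    refine ⟨E, hE, fun a b c => (hc a b c).trans ?_⟩
    gcongr
  obtain ⟨D, hD⟩ : ∃ D, D = 146 * √(k : ℝ) + 2 := ⟨_, rfl⟩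
  have hD0 : 0 ≤ D := by rw [hD]; positivity
  rw [← hD]
  induction h with
  | zero =>
    intro R _ hc
    obtain ⟨E, hE, hcr⟩ := small R (by simpa using hc)
    refine ⟨E, hE, fun a b c _ => ⟨?_, fun _ => ?_⟩⟩ <;>
    · have := hcr a b c
      push_cast
      linarith
  | succ h ih =>
    intro R hR hc
    have hDh : 0 ≤ D * h := by positivity
    rcases R.eq_empty_or_nonempty with rfl | hne
    · obtain ⟨E, hE, hcr⟩ := small ∅ (by simp)
      refine ⟨E, hE, fun a b c _ => ⟨?_, fun _ => ?_⟩⟩ <;>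
      · have := hcr a b c
        push_cast
        linarith
    obtain ⟨m, R₁, R₂, hRu, hc₁, hc₂, hm₁, hm₂, r, hr, hrm⟩ :=
      exists_vertical_split hne (M := k * 2 ^ h) (by rw [pow_succ] at hc; linarith)
    obtain ⟨p, hp, hmin⟩ := exists_min_image Q (fun p => lineHeight (s p) p m) (hne.mono hR)
    obtain ⟨E₀, hE₀, hcr₀⟩ := small (R.filter fun q => lineHeight (s p) p q.1 ≤ q.2)
      ((card_le_card (filter_subset_filter _ hR)).trans (hs p hp))
    have hR₁ : R₁ ⊆ R := hRu ▸ subset_union_left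
    have hR₂ : R₂ ⊆ R := hRu ▸ subset_union_right
    obtain ⟨E₁, hE₁, hcr₁⟩ := ih (R₁.filter fun q => q.2 < lineHeight (s p) p q.1)
      ((filter_subset _ _).trans (hR₁.trans hR)) ((card_filter_le _ _).trans hc₁)
    obtain ⟨E₂, hE₂, hcr₂⟩ := ih (R₂.filter fun q => q.2 < lineHeight (s p) p q.1)
      ((filter_subset _ _).trans (hR₂.trans hR)) ((card_filter_le _ _).trans hc₂)
    obtain ⟨E₃, hE₃, hcr₃⟩ := hE₁.exists_union hE₂
    obtain ⟨E, hE, hcr⟩ := hE₀.exists_union hE₃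
    have hU : (R.filter fun q => lineHeight (s p) p q.1 ≤ q.2) ∪
        ((R₁.filter fun q => q.2 < lineHeight (s p) p q.1) ∪
          R₂.filter fun q => q.2 < lineHeight (s p) p q.1) = R := by
      rw [← filter_union, hRu]
      simp only [← not_le]
      exact filter_union_filter_not_eq _ _
    rw [hU] at hE
    refine ⟨E, hE, fun a b c hb => ?_⟩
    have hsum : (crossings (affineFun a b c) E : ℝ) ≤ D + crossings (affineFun a b c) E₁ +
        crossings (affineFun a b c) E₂ := by
      have h1 := hcr (affineFun a b c)
      have h2 := hcr₃ (affineFun a b c)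
      have h3 := hcr₀ a b c
      have h4 : (crossings (affineFun a b c) E : ℝ) ≤ crossings (affineFun a b c) E₀ +
        (crossings (affineFun a b c) E₁ + crossings (affineFun a b c) E₂ + 1) + 1 := by
        exact_mod_cast h1.trans (by omega)
      linarith
    obtain ⟨u₁, v₁⟩ := hcr₁ a b c hb
    obtain ⟨u₂, v₂⟩ := hcr₂ a b c hb
    push_cast
    by_cases hm : LinesPosAt Q s (affineFun a b c) m
    · have w₁ := v₁ (Or.inr ⟨m, fun q hq => hm₁ q (filter_subset _ _ hq), hm⟩)
      have w₂ := v₂ (Or.inl ⟨m, fun q hq => hm₂ q (filter_subset _ _ hq), hm⟩)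
      refine ⟨by linarith, ?_⟩
      rintro (⟨x, hx, hL⟩ | ⟨x, hx, hL⟩)
      · have : crossings (affineFun a b c) E₁ = 0 := hE₁.crossings_eq_zero_of_linesPosAt
          ((filter_subset _ _).trans (hR₁.trans hR)) hb
          (fun q hq => hx q (hR₁ (filter_subset _ _ hq)))
          (fun q hq => hm₁ q (filter_subset _ _ hq)) hL hm
        rw [this] at hsum
        push_cast at hsum
        linarith
      · have : crossings (affineFun a b c) E₂ = 0 := hE₂.crossings_eq_zero_of_linesPosAt
          ((filter_subset _ _).trans (hR₂.trans hR)) hb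
          (fun q hq => hm₂ q (filter_subset _ _ hq))
          (fun q hq => hx q (hR₂ (filter_subset _ _ hq))) hm hL
        rw [this] at hsum
        push_cast at hsum
        linarith
    · have hm' : ¬ 0 < affineFun a b c (m, lineHeight (s p) p m) := by
        intro h0
        refine hm fun q hq => h0.trans_le ?_
        have := mul_le_mul_of_nonneg_left (hmin q hq) hb
        simp only [affineFun]
        linarith
      have zero₁ : (∃ z : ℝ × ℝ, z.2 ≤ lineHeight (s p) p z.1 ∧ m ≤ z.1 ∧
          0 < affineFun a b c z) → (crossings (affineFun a b c) E₁ : ℝ) = 0 := by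
        rintro ⟨z, hz, hmz, hfz⟩
        rw [hE₁.crossings_eq_zero_of_nonpos, Nat.cast_zero]
        intro q hq
        rw [mem_filter] at hq
        by_contra! hf
        exact hm' (affineFun_lineHeight_pos hb hq.2.le hz (hm₁ q hq.1) hmz hf hfz)
      have zero₂ : (∃ z : ℝ × ℝ, z.2 ≤ lineHeight (s p) p z.1 ∧ z.1 ≤ m ∧
          0 < affineFun a b c z) → (crossings (affineFun a b c) E₂ : ℝ) = 0 := by
        rintro ⟨z, hz, hmz, hfz⟩
        rw [hE₂.crossings_eq_zero_of_nonpos, Nat.cast_zero]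
        intro q hq
        rw [mem_filter] at hq
        by_contra! hf
        exact hm' (affineFun_lineHeight_pos hb hz hq.2.le hmz (hm₂ q hq.1) hfz hf)
      constructor
      · by_cases hz : ∃ z : ℝ × ℝ, z.2 ≤ lineHeight (s p) p z.1 ∧ m ≤ z.1 ∧ 0 < affineFun a b c z
        · rw [zero₁ hz] at hsum
          linarith
        · have : crossings (affineFun a b c) E₂ = 0 := by
            refine hE₂.crossings_eq_zero_of_nonpos fun q hq => ?_
            rw [mem_filter] at hq
            by_contra! hf
            exact hz ⟨q, hq.2.le, hm₂ q hq.1, hf⟩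
          rw [this] at hsum
          push_cast at hsum
          linarith
      · rintro (⟨x, hx, hL⟩ | ⟨x, hx, hL⟩)
        · rw [zero₂ ⟨(x, lineHeight (s p) p x), le_rfl, hrm ▸ hx r hr, hL p hp⟩] at hsum
          have := v₁ (Or.inl ⟨x, fun q hq => hx q (hR₁ (filter_subset _ _ hq)), hL⟩)
          linarith
        · rw [zero₁ ⟨(x, lineHeight (s p) p x), le_rfl, hrm ▸ hx r hr, hL p hp⟩] at hsum
          have := v₂ (Or.inr ⟨x, fun q hq => hx q (hR₂ (filter_subset _ _ hq)), hL⟩)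
          linarith

open Classical in
theorem exists_links_of_upper (Q : Finset (ℝ × ℝ)) (k h : ℕ)
    (hs : ∀ p ∈ Q, ∃ t, (Q.filter fun q => lineHeight t p q.1 ≤ q.2).card ≤ k)
    (hQ : Q.card ≤ k * 2 ^ h) : ∃ E, Links E Q ∧ ∀ a b c : ℝ,
      (crossings (affineFun a b c) E : ℝ) ≤ 2 * (146 * √k + 2) * (h + 1) := by
  choose! s hs using hs
  obtain ⟨E, hE, hc⟩ := exists_links_of_upper_aux Q s k hs h Q Subset.rfl hQ
  refine ⟨E, hE, fun a b c => ?_⟩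
  rcases le_total 0 b with hb | hb
  · exact (hc a b c hb).1
  · have := (hc (-a) (-b) (-c) (by linarith)).1
    rwa [show affineFun (-a) (-b) (-c) = fun p => - affineFun a b c p from
      funext fun p => affineFun_neg a b c p, crossings_neg] at this

/-- Connected graphs can be transported along an equivalence. -/
theorem Links.map {α β : Type*} (e : α ≃ β) {E : Finset (α × α)} {R : Finset α} (h : Links E R) :
    Links (E.map (e.prodCongr e).toEmbedding) (R.map e.toEmbedding) := by
  refine ⟨?_, ?_⟩
  · intro x hx
    rw [mem_map_equiv] at hx
    have := mem_product.1 (h.1 hx)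
    simp only [mem_product, mem_map_equiv]
    exact this
  · intro u hu v hv
    rw [mem_map_equiv] at hu hv
    have key : ∀ x y, Relation.EqvGen (fun x y => (x, y) ∈ E) x y →
        Relation.EqvGen (fun x y => (x, y) ∈ E.map (e.prodCongr e).toEmbedding) (e x) (e y) := by
      intro x y hxy
      induction hxy with
      | rel x y hxy => exact .rel _ _ (by rw [mem_map_equiv]; simpa using hxy)
      | refl x => exact .refl _
      | symm x y _ ih => exact .symm _ _ ih
      | trans x y z _ _ ih₁ ih₂ => exact .trans _ _ _ ih₁ ih₂
    simpa using key _ _ (h.2 _ hu _ hv)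

theorem crossings_map {α β : Type*} (e : α ≃ β) (f : β → ℝ) (E : Finset (α × α)) :
    crossings f (E.map (e.prodCongr e).toEmbedding) = crossings (f ∘ e) E := by
  classical
  unfold crossings
  rw [filter_map, card_map]
  rfl

open Classical in
theorem exists_links_of_lower (Q : Finset (ℝ × ℝ)) (k h : ℕ)
    (hs : ∀ p ∈ Q, ∃ t, (Q.filter fun q => q.2 ≤ lineHeight t p q.1).card ≤ k)
    (hQ : Q.card ≤ k * 2 ^ h) : ∃ E, Links E Q ∧ ∀ a b c : ℝ,
      (crossings (affineFun a b c) E : ℝ) ≤ 2 * (146 * √k + 2) * (h + 1) := by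
  let e : ℝ × ℝ ≃ ℝ × ℝ := (Equiv.refl ℝ).prodCongr (Equiv.neg ℝ)
  have he : ∀ p, e p = (p.1, -p.2) := fun p => rfl
  have hee : (Q.map e.toEmbedding).map e.toEmbedding = Q := by
    ext p
    rw [mem_map_equiv, mem_map_equiv]
    simp only [e, Equiv.prodCongr_symm, Equiv.prodCongr_apply, Equiv.refl_symm, Equiv.neg_symm,
      Equiv.coe_refl, Equiv.neg_apply, Prod.map_map, neg_comp_neg]
    rfl
  obtain ⟨E, hE, hc⟩ := exists_links_of_upper (Q.map e.toEmbedding) k h (by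
    intro p hp
    obtain ⟨q, hq, rfl⟩ := mem_map.1 hp
    obtain ⟨t, ht⟩ := hs q hq
    refine ⟨-t, ?_⟩
    rw [filter_map, card_map]
    convert ht using 4 with r
    simp only [lineHeight, Function.comp, Equiv.coe_toEmbedding, he]
    constructor <;> intro h <;> linarith) (by rwa [card_map])
  refine ⟨_, hee ▸ hE.map e, fun a b c => ?_⟩
  rw [crossings_map]
  convert hc a (-b) c using 3
  ext p
  simp only [affineFun, Function.comp, he]
  ring

open Classical in
/-- At most `k` points of `P` lie on or above some nonvertical line through `p`. -/
def UpperShallow (P : Finset (ℝ × ℝ)) (k : ℕ) (p : ℝ × ℝ) : Prop :=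
  ∃ t, (P.filter fun q => lineHeight t p q.1 ≤ q.2).card ≤ k

open Classical in
/-- At most `k` points of `P` lie on or below some nonvertical line through `p`. -/
def LowerShallow (P : Finset (ℝ × ℝ)) (k : ℕ) (p : ℝ × ℝ) : Prop :=
  ∃ t, (P.filter fun q => q.2 ≤ lineHeight t p q.1).card ≤ k

open Classical in
theorem upperShallow_of_affineFun_pos {P : Finset (ℝ × ℝ)} {k : ℕ} {a b c : ℝ} (hb : 0 < b)
    {p : ℝ × ℝ} (hf : 0 < affineFun a b c p)
    (hk : (P.filter fun q => 0 < affineFun a b c q).card ≤ k) : UpperShallow P k p := by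
  refine ⟨-a / b, (card_le_card (monotone_filter_right _ fun q _ hq => ?_)).trans hk⟩
  have := mul_le_mul_of_nonneg_left hq hb.le
  have e : b * lineHeight (-a / b) p q.1 = b * p.2 - a * (q.1 - p.1) := by
    rw [lineHeight]; field_simp; ring
  rw [e] at this
  simp only [affineFun] at hf ⊢
  linarith

open Classical in
theorem lowerShallow_of_affineFun_pos {P : Finset (ℝ × ℝ)} {k : ℕ} {a b c : ℝ} (hb : b < 0)
    {p : ℝ × ℝ} (hf : 0 < affineFun a b c p)
    (hk : (P.filter fun q => 0 < affineFun a b c q).card ≤ k) : LowerShallow P k p := by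
  refine ⟨-a / b, (card_le_card (monotone_filter_right _ fun q _ hq => ?_)).trans hk⟩
  have := mul_le_mul_of_nonpos_left hq hb.le
  have e : b * lineHeight (-a / b) p q.1 = b * p.2 - a * (q.1 - p.1) := by
    have := hb.ne
    rw [lineHeight]; field_simp; ring
  rw [e] at this
  simp only [affineFun] at hf ⊢
  linarith

open Classical in
/-- The points in an open halfplane containing at most `k` points are shallow. -/
theorem shallow_of_affineFun_pos {P : Finset (ℝ × ℝ)} {k : ℕ} {a b c : ℝ} {p : ℝ × ℝ} (hp : p ∈ P)
    (hf : 0 < affineFun a b c p) (hk : (P.filter fun q => 0 < affineFun a b c q).card ≤ k) :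
    UpperShallow P k p ∨ LowerShallow P k p := by
  rcases lt_trichotomy b 0 with hb | rfl | hb
  · exact .inr (lowerShallow_of_affineFun_pos hb hf hk)
  · left
    obtain ⟨r, hr, hmax⟩ := exists_max_image P Prod.snd ⟨p, hp⟩
    have hpr := hmax p hp
    set ε := affineFun a 0 c p / (1 + (r.2 - p.2)) with hε
    have h1 : 0 < 1 + (r.2 - p.2) := by linarith
    have hε0 : 0 < ε := by positivity
    have hmul : ε * (1 + (r.2 - p.2)) = affineFun a 0 c p := by rw [hε]; field_simp
    have hadd : ∀ q : ℝ × ℝ, affineFun a ε (c - ε * r.2) q =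
        affineFun a 0 c q - ε * (r.2 - q.2) := by intro q; simp only [affineFun]; ring
    refine upperShallow_of_affineFun_pos (a := a) (c := c - ε * r.2) hε0 ?_
      ((card_le_card (monotone_filter_right _ fun q hq h => ?_)).trans hk)
    · rw [hadd]; linarith
    · rw [hadd] at h
      have := mul_nonneg hε0.le (sub_nonneg.2 (hmax q hq))
      linarith
  · exact .inl (upperShallow_of_affineFun_pos hb hf hk)

open Classical in
/-- Connecting the points layer by layer, according to their depth. -/
theorem exists_links_layers (P : Finset (ℝ × ℝ)) (L : ℕ) (hL : P.card ≤ 2 ^ L) (d : ℕ) :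
    ∀ j, j + d = L + 1 → ∃ E,
      Links E (P.filter fun p => ∀ i < j, ¬ (UpperShallow P (2 ^ i) p ∨ LowerShallow P (2 ^ i) p)) ∧
      ∀ a b c : ℝ, ∀ i, (P.filter fun q => 0 < affineFun a b c q).card ≤ 2 ^ i →
        (crossings (affineFun a b c) E : ℝ) ≤ ∑ l ∈ Ico j (i + 1),
          (2 * (2 * (146 * √((2 ^ l : ℕ) : ℝ) + 2) * ((L - l : ℕ) + 1)) + 2) := by
  induction d with
  | zero =>
    intro j hj
    have : (P.filter fun p => ∀ i < j,
        ¬ (UpperShallow P (2 ^ i) p ∨ LowerShallow P (2 ^ i) p)) = ∅ := by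
      rw [filter_eq_empty_iff]
      exact fun p _ h => h L (by omega) (.inl ⟨0, (card_filter_le _ _).trans hL⟩)
    rw [this]
    refine ⟨∅, ⟨by simp, by simp⟩, fun a b c i _ => ?_⟩
    simp only [crossings, filter_empty, card_empty, Nat.cast_zero]
    positivity
  | succ d ih =>
    intro j hj
    obtain ⟨E₂, hE₂, hc₂⟩ := ih (j + 1) (by omega)
    set Y := P.filter fun p => ∀ i < j, ¬ (UpperShallow P (2 ^ i) p ∨ LowerShallow P (2 ^ i) p)
      with hY
    have hcard : ∀ Z ⊆ Y, Z.card ≤ 2 ^ j * 2 ^ (L - j) := by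
      intro Z hZ
      rw [← pow_add, show j + (L - j) = L by omega]
      exact (card_le_card (hZ.trans (filter_subset _ _))).trans hL
    have hYP : Y ⊆ P := filter_subset _ _
    obtain ⟨E₀, hE₀, hc₀⟩ := exists_links_of_upper (Y.filter (UpperShallow P (2 ^ j))) (2 ^ j)
      (L - j) (by
        intro p hp
        obtain ⟨t, ht⟩ := (mem_filter.1 hp).2
        exact ⟨t, (card_le_card (filter_subset_filter _ ((filter_subset _ _).trans hYP))).trans ht⟩)
      (hcard _ (filter_subset _ _))
    obtain ⟨E₁, hE₁, hc₁⟩ := exists_links_of_lower (Y.filter (LowerShallow P (2 ^ j))) (2 ^ j)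
      (L - j) (by
        intro p hp
        obtain ⟨t, ht⟩ := (mem_filter.1 hp).2
        exact ⟨t, (card_le_card (filter_subset_filter _ ((filter_subset _ _).trans hYP))).trans ht⟩)
      (hcard _ (filter_subset _ _))
    obtain ⟨E₃, hE₃, hc₃⟩ := hE₀.exists_union hE₁
    obtain ⟨E, hE, hc⟩ := hE₃.exists_union hE₂
    have hU : (Y.filter (UpperShallow P (2 ^ j)) ∪ Y.filter (LowerShallow P (2 ^ j))) ∪
        (P.filter fun p => ∀ i < j + 1,
          ¬ (UpperShallow P (2 ^ i) p ∨ LowerShallow P (2 ^ i) p)) = Y := by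
      ext p
      simp only [hY, mem_union, mem_filter, Nat.forall_lt_succ_right]
      tauto
    rw [hU] at hE
    refine ⟨E, hE, fun a b c i hi => ?_⟩
    rcases lt_or_ge i j with hij | hij
    · have : crossings (affineFun a b c) E = 0 := by
        refine hE.crossings_eq_zero_of_nonpos fun p hp => ?_
        by_contra! hf
        exact (mem_filter.1 hp).2 i hij (shallow_of_affineFun_pos (hYP hp) hf hi)
      rw [this, Nat.cast_zero]
      positivity
    · rw [sum_eq_sum_Ico_succ_bot (by omega)]
      have h0 := hc₀ a b c
      have h1 := hc₁ a b c
      have h2 := hc₂ a b c i hi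
      have h3 := hc₃ (affineFun a b c)
      have h4 : (crossings (affineFun a b c) E : ℝ) ≤ crossings (affineFun a b c) E₀ +
        crossings (affineFun a b c) E₁ + 1 + crossings (affineFun a b c) E₂ + 1 := by
        exact_mod_cast (hc (affineFun a b c)).trans (by omega)
      linarith

theorem sum_layers_le (L : ℕ) : ∀ i ≤ L, ∑ l ∈ Ico 0 (i + 1),
    (2 * (2 * (146 * √((2 ^ l : ℕ) : ℝ) + 2) * ((L - l : ℕ) + 1)) + 2) ≤
      5940 * √((2 ^ i : ℕ) : ℝ) * ((L - i : ℕ) + 10) := by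
  have term : ∀ l : ℕ, 2 * (2 * (146 * √((2 ^ l : ℕ) : ℝ) + 2) * (((L - l : ℕ) : ℝ) + 1)) + 2 ≤
      594 * √((2 ^ l : ℕ) : ℝ) * (((L - l : ℕ) : ℝ) + 1) := by
    intro l
    have h1 : 1 ≤ √((2 ^ l : ℕ) : ℝ) :=
      Real.one_le_sqrt.2 (by exact_mod_cast Nat.one_le_two_pow)
    have h2 : 0 ≤ ((L - l : ℕ) : ℝ) := by positivity
    nlinarith [mul_nonneg (sub_nonneg.2 h1) h2]
  intro i
  induction i with
  | zero =>
    intro _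
    rw [zero_add, Nat.Ico_zero_eq_range, sum_range_one]
    refine (term 0).trans ?_
    have h2 : 0 ≤ ((L - 0 : ℕ) : ℝ) := by positivity
    simp only [pow_zero, Nat.cast_one, Real.sqrt_one]
    linarith
  | succ i ih =>
    intro hi
    rw [sum_Ico_succ_top (by omega)]
    have h1 := ih (by omega)
    have h2 := term (i + 1)
    obtain ⟨t, ht⟩ : ∃ t, L - (i + 1) = t := ⟨_, rfl⟩
    have ht' : L - i = t + 1 := by omega
    rw [ht] at h2 ⊢
    rw [ht'] at h1
    have hs : √((2 ^ (i + 1) : ℕ) : ℝ) = √((2 ^ i : ℕ) : ℝ) * √2 := by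
      rw [pow_succ, Nat.cast_mul, Real.sqrt_mul (by positivity), Nat.cast_ofNat]
    have h14 : 1.4 ≤ √(2 : ℝ) := Real.le_sqrt_of_sq_le (by norm_num)
    rw [hs] at h2 ⊢
    have hr : 0 ≤ √((2 ^ i : ℕ) : ℝ) := Real.sqrt_nonneg _
    set r := √((2 ^ i : ℕ) : ℝ)
    have ht0 : 0 ≤ (t : ℝ) := by positivity
    push_cast at h1 ⊢
    have h3 : 0 ≤ r * (√2 - 1.4) * (5346 * t + 58806) := by
      have := sub_nonneg.2 h14
      positivity
    have h4 : 0 ≤ r * t := by positivity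
    nlinarith

theorem exists_two_pow_near {w : ℕ} (hw : 1 ≤ w) :
    w ≤ 2 ^ (Nat.log 2 w + 1) ∧ 2 ^ (Nat.log 2 w + 1) ≤ 2 * w := by
  refine ⟨(Nat.lt_pow_succ_log_self (by norm_num) w).le, ?_⟩
  have := Nat.pow_log_le_self 2 (by omega : w ≠ 0)
  rw [pow_succ]
  omega

theorem sum_layers_le_sqrt_mul_log {w n : ℕ} (hw : 1 ≤ w) (hwn : w ≤ n) :
    5940 * √((2 ^ (Nat.log 2 w + 1) : ℕ) : ℝ) *
      (((Nat.log 2 n + 1 - (Nat.log 2 w + 1) : ℕ) : ℝ) + 10) ≤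
      200000 * √(w : ℝ) * Real.log (2 * (n : ℝ) / (w : ℝ)) := by
  have hw0 : 0 < (w : ℝ) := by exact_mod_cast hw
  have hwn' : (w : ℝ) ≤ n := by exact_mod_cast hwn
  have hlog2 := Real.log_two_gt_d9
  have hsq : √((2 ^ (Nat.log 2 w + 1) : ℕ) : ℝ) ≤ 1.5 * √(w : ℝ) := by
    rw [Real.sqrt_le_left (by positivity), mul_pow, Real.sq_sqrt hw0.le]
    have : ((2 ^ (Nat.log 2 w + 1) : ℕ) : ℝ) ≤ 2 * w := by
      exact_mod_cast (exists_two_pow_near hw).2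
    linarith
  have hlog : Real.log 2 ≤ Real.log (2 * (n : ℝ) / w) := by
    refine Real.log_le_log (by norm_num) ?_
    rw [le_div_iff₀ hw0]
    linarith
  have hmono : Nat.log 2 w ≤ Nat.log 2 n := Nat.log_mono_right hwn
  have hdiff : ((Nat.log 2 n + 1 - (Nat.log 2 w + 1) : ℕ) : ℝ) * Real.log 2 ≤
      Real.log (2 * (n : ℝ) / w) := by
    rw [← Real.log_pow]
    refine Real.log_le_log (by positivity) ?_
    rw [le_div_iff₀ hw0]
    have h1 := (exists_two_pow_near hw).1
    have h2 := (exists_two_pow_near (hw.trans hwn)).2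
    have h3 : 2 ^ (Nat.log 2 n + 1 - (Nat.log 2 w + 1)) * w ≤ 2 * n := by
      refine (Nat.mul_le_mul_left _ h1).trans ?_
      rw [← pow_add, Nat.sub_add_cancel (by omega)]
      exact h2
    exact_mod_cast h3
  set t : ℝ := ((Nat.log 2 n + 1 - (Nat.log 2 w + 1) : ℕ) : ℝ)
  have ht : 0 ≤ t := by positivity
  set lam := Real.log (2 * (n : ℝ) / w)
  have h1 : t + 10 ≤ 22 * lam := by nlinarith
  calc 5940 * √((2 ^ (Nat.log 2 w + 1) : ℕ) : ℝ) * (t + 10)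
      ≤ 5940 * (1.5 * √(w : ℝ)) * (22 * lam) := by gcongr
    _ ≤ 200000 * √(w : ℝ) * lam := by
      have : 0 ≤ √(w : ℝ) * lam := mul_nonneg (Real.sqrt_nonneg _) (by linarith)
      nlinarith

open Classical in
theorem exists_links_crossings_le_sqrt_mul_log (P : Finset (ℝ × ℝ)) (hP : P.Nonempty) :
    ∃ E, Links E P ∧ ∀ a b c : ℝ, 1 ≤ lineWeight P a b c →
      (crossings (affineFun a b c) E : ℝ) ≤ 200000 * √(lineWeight P a b c : ℝ) *
        Real.log (2 * (P.card : ℝ) / (lineWeight P a b c : ℝ)) := by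
  obtain ⟨E, hE, hc⟩ := exists_links_layers P (Nat.log 2 P.card + 1)
    (exists_two_pow_near hP.card_pos).1 (Nat.log 2 P.card + 1 + 1) 0 (by omega)
  rw [filter_true_of_mem (by simp)] at hE
  have side : ∀ a b c : ℝ, ∀ w : ℕ, 1 ≤ w → (P.filter fun q => 0 < affineFun a b c q).card = w →
      (crossings (affineFun a b c) E : ℝ) ≤
        200000 * √(w : ℝ) * Real.log (2 * (P.card : ℝ) / (w : ℝ)) := by
    intro a b c w hw hcw
    have hwn : w ≤ P.card := hcw ▸ card_filter_le _ _
    refine (hc a b c (Nat.log 2 w + 1) (hcw ▸ (exists_two_pow_near hw).1)).trans ?_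
    exact (sum_layers_le _ _ (Nat.succ_le_succ (Nat.log_mono_right hwn))).trans
      (sum_layers_le_sqrt_mul_log hw hwn)
  refine ⟨E, hE, fun a b c hw => ?_⟩
  have e : ∀ s : Set (ℝ × ℝ), ((P : Set (ℝ × ℝ)) ∩ s).ncard = (P.filter (· ∈ s)).card := by
    intro s
    rw [← Set.ncard_coe_finset, coe_filter]
    rfl
  rcases min_choice (((P : Set (ℝ × ℝ)) ∩ {x | 0 < a * x.1 + b * x.2 + c}).ncard)
    (((P : Set (ℝ × ℝ)) ∩ {x | a * x.1 + b * x.2 + c < 0}).ncard) with h | h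
  · refine side a b c _ hw ?_
    rw [lineWeight, h, e]
    rfl
  · rw [← crossings_neg, ← funext fun p => affineFun_neg a b c p]
    refine side _ _ _ _ hw ?_
    rw [lineWeight, h, e]
    simp only [affineFun_neg, Left.neg_pos_iff]
    rfl

/-- A connected graph given by a finite set of edges contains a spanning tree. -/
theorem Links.exists_isTree {E : Finset ((ℝ × ℝ) × (ℝ × ℝ))} {P : Finset (ℝ × ℝ)} (h : Links E P)
    (hP : P.Nonempty) : ∃ T : SimpleGraph {p : ℝ × ℝ // p ∈ P}, T.IsTree ∧
      ∀ a b c : ℝ, ({e : Sym2 {p : ℝ × ℝ // p ∈ P} | e ∈ T.edgeSet ∧ ∃ u v, e = s(u, v) ∧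
        a * u.1.1 + b * u.1.2 + c < 0 ∧ 0 < a * v.1.1 + b * v.1.2 + c}).ncard ≤
          crossings (affineFun a b c) E := by
  classical
  let G : SimpleGraph {p : ℝ × ℝ // p ∈ P} :=
    SimpleGraph.fromRel fun u v => ((u : ℝ × ℝ), (v : ℝ × ℝ)) ∈ E
  have hreach : ∀ x y, Relation.EqvGen (fun x y => (x, y) ∈ E) x y → x = y ∨
      ∃ (hx : x ∈ P) (hy : y ∈ P), G.Reachable ⟨x, hx⟩ ⟨y, hy⟩ := by
    intro x y hxy
    induction hxy with
    | rel x y hxy =>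
      by_cases hne : x = y
      · exact .inl hne
      · have := mem_product.1 (h.1 hxy)
        refine .inr ⟨this.1, this.2, SimpleGraph.Adj.reachable ?_⟩
        rw [SimpleGraph.fromRel_adj]
        exact ⟨by simpa using hne, .inl hxy⟩
    | refl x => exact .inl rfl
    | symm x y _ ih =>
      rcases ih with rfl | ⟨hx, hy, hr⟩
      · exact .inl rfl
      · exact .inr ⟨hy, hx, hr.symm⟩
    | trans x y z _ _ ih₁ ih₂ =>
      rcases ih₁ with rfl | ⟨hx, hy, hr⟩
      · exact ih₂
      · rcases ih₂ with rfl | ⟨_, hz, hr'⟩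
        · exact .inr ⟨hx, hy, hr⟩
        · exact .inr ⟨hx, hz, hr.trans hr'⟩
  have hconn : G.Connected := by
    obtain ⟨p, hp⟩ := hP
    have : Nonempty {p : ℝ × ℝ // p ∈ P} := ⟨⟨p, hp⟩⟩
    refine SimpleGraph.Connected.mk fun u v => ?_
    rcases hreach u v (h.2 u u.2 v v.2) with huv | ⟨_, _, hr⟩
    · rw [Subtype.ext huv]
    · exact hr
  obtain ⟨T, hTG, hT⟩ := hconn.exists_isTree_le
  refine ⟨T, hT, fun a b c => ?_⟩
  rw [crossings, ← Set.ncard_coe_finset]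
  have hsub : Sym2.map Subtype.val '' {e : Sym2 {p : ℝ × ℝ // p ∈ P} | e ∈ T.edgeSet ∧
      ∃ u v, e = s(u, v) ∧ a * u.1.1 + b * u.1.2 + c < 0 ∧ 0 < a * v.1.1 + b * v.1.2 + c} ⊆
      (fun e : (ℝ × ℝ) × (ℝ × ℝ) => s(e.1, e.2)) ''
        (E.filter fun e => affineFun a b c e.1 < 0 ∧ 0 < affineFun a b c e.2 ∨
          0 < affineFun a b c e.1 ∧ affineFun a b c e.2 < 0 : Finset _) := by
    rintro _ ⟨e, ⟨he, u, v, rfl, hu, hv⟩, rfl⟩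
    have hadj := hTG ((SimpleGraph.mem_edgeSet T).1 he)
    rw [SimpleGraph.fromRel_adj] at hadj
    rcases hadj.2 with huv | huv
    · exact ⟨(u.1, v.1), by simpa using ⟨huv, .inl ⟨hu, hv⟩⟩, rfl⟩
    · exact ⟨(v.1, u.1), by simpa using ⟨huv, .inr ⟨hv, hu⟩⟩, Sym2.eq_swap⟩
  rw [← Set.ncard_image_of_injective _ (Sym2.map.injective Subtype.val_injective)]
  exact (Set.ncard_le_ncard hsub ((Finset.finite_toSet _).image _)).trans
    (Set.ncard_image_le (Finset.finite_toSet _))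

end RelativeCrossing

/-- Every finite planar point set has a spanning tree with small *relative*
crossing number: every line of weight `w ≥ 1` crosses at most
`C·√w·log(2n/w)` edges of the tree. -/
theorem spanning_tree_small_relative_crossing :
    ∃ C : ℝ, 0 < C ∧
      ∀ P : Finset (ℝ × ℝ), 2 ≤ P.card →
        ∃ T : SimpleGraph {p : ℝ × ℝ // p ∈ P},
          T.IsTree ∧
          ∀ a b c : ℝ, (a, b) ≠ (0, 0) → 1 ≤ lineWeight P a b c →
            (({e : Sym2 {p : ℝ × ℝ // p ∈ P} |
                e ∈ T.edgeSet ∧ ∃ u v, e = s(u, v) ∧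
                  a * u.1.1 + b * u.1.2 + c < 0 ∧
                  0 < a * v.1.1 + b * v.1.2 + c}).ncard : ℝ)
              ≤ C * Real.sqrt (lineWeight P a b c : ℝ) *
                  Real.log (2 * (P.card : ℝ) / (lineWeight P a b c : ℝ)) := by
  refine ⟨200000, by norm_num, fun P hP => ?_⟩
  have hne : P.Nonempty := Finset.card_pos.1 (by omega)
  obtain ⟨E, hE, hc⟩ := RelativeCrossing.exists_links_crossings_le_sqrt_mul_log P hne
  obtain ⟨T, hT, hTc⟩ := hE.exists_isTree hne
  exact ⟨T, hT, fun a b c _ hw => le_trans (by exact_mod_cast hTc a b c) (hc a b c hw)⟩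
end
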